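/- arXiv:math/0207192 — 6 statements merged into one kernel-verified Lean document; each statement's English description precedes it below -/
import Mathlib

section
/- Let k ≥ 3. For every n ≥ 2k, L_n^k(2k−2) = L_{n−1}^k(2k−2) + L_{n−3}^k(2k−5) + L_{n−3}^k(2k−4) + L_{n−4}^k(2k−5) + L_{n−4}^k(2k−4). -/
/-- A permutation `α` of `{1,…,n}` (as `Equiv.Perm (Fin n)`, 0-indexed) contains the
pattern given in one-line notation by the list `w`: there are increasing positions
whose values are order-isomorphic to `w`. -/
def ContainsPattern {n : ℕ} (α : Equiv.Perm (Fin n)) (w : List ℕ) : Prop :=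
  ∃ f : Fin w.length → Fin n, StrictMono f ∧
    ∀ a b : Fin w.length, w.get a < w.get b ↔ α (f a) < α (f b)

/-- `α` avoids the pattern `w`. -/
def AvoidsPattern {n : ℕ} (α : Equiv.Perm (Fin n)) (w : List ℕ) : Prop :=
  ¬ ContainsPattern α w

/-- The pattern of length `2k` (in one-line notation, on values `1,…,2k`) beginning with
`a, k+2, k+3, …, 2k−1`, followed by `1, 2k` (if `sep = true`) or by `2k` (if `sep = false`),
and ending with the remaining elements of `{1,…,2k}` in increasing order. -/
def gonPattern (k a : ℕ) (sep : Bool) : List ℕ :=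
  let pre : List ℕ := a :: (List.range' (k+2) (k-2) ++ (if sep then [1, 2*k] else [2*k]))
  pre ++ ((List.range' 1 (2*k)).filter (fun x => !(pre.contains x)))

/-- `π` is a 321-`k`-gon-avoiding permutation: it avoids `321` and the four
patterns of `𝔓_k`. -/
def Avoids321Gon (k : ℕ) {n : ℕ} (π : Equiv.Perm (Fin n)) : Prop :=
  AvoidsPattern π [3, 2, 1] ∧
    AvoidsPattern π (gonPattern k k true) ∧ AvoidsPattern π (gonPattern k k false) ∧
    AvoidsPattern π (gonPattern k (k+1) true) ∧ AvoidsPattern π (gonPattern k (k+1) false)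

/-- `f_k(n)`: the number of 321-`k`-gon-avoiding permutations of `{1,…,n}`. -/
noncomputable def fgon (k n : ℕ) : ℕ :=
  Nat.card {π : Equiv.Perm (Fin n) // Avoids321Gon k π}

/-- `π` starts (in one-line notation on values `1,…,n`) with the entries listed in `l`,
i.e. `π(1) = l₁, π(2) = l₂, …`. -/
def StartsWith {n : ℕ} (π : Equiv.Perm (Fin n)) (l : List ℕ) : Prop :=
  ∀ (j : Fin l.length) (hj : (j : ℕ) < n), ((π ⟨j, hj⟩ : Fin n) : ℕ) + 1 = l.get j

/-- `f_k(n; i₁,…,i_m)`: the number of 321-`k`-gon-avoiding permutations of `{1,…,n}`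
starting with `i₁ i₂ ⋯ i_m` (given as the list `l`). -/
noncomputable def fstart (k n : ℕ) (l : List ℕ) : ℕ :=
  Nat.card {π : Equiv.Perm (Fin n) // Avoids321Gon k π ∧ StartsWith π l}

/-- `A_d(n,m) = Σ_{d ≤ i₁ < ⋯ < i_m ≤ n} f_k(n; i₁,…,i_m)`. -/
noncomputable def Aseq (k d n m : ℕ) : ℕ :=
  ∑ s ∈ (Finset.Icc d n).powersetCard m, fstart k n (s.sort (· ≤ ·))

/-- `B_d(n,m) = Σ_{d+1 ≤ i₁ < ⋯ < i_m ≤ n} f_k(n; d, i₁,…,i_m)`. -/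
noncomputable def Bseq (k d n m : ℕ) : ℕ :=
  ∑ s ∈ (Finset.Icc (d+1) n).powersetCard m, fstart k n (d :: s.sort (· ≤ ·))

/-- `C_d(n,m) = Σ_{d ≤ i₁ < ⋯ < i_m ≤ n} f_k(n; i₁,…,i_m, 1)`. -/
noncomputable def Cseq (k d n m : ℕ) : ℕ :=
  ∑ s ∈ (Finset.Icc d n).powersetCard m, fstart k n (s.sort (· ≤ ·) ++ [1])

/-- `L_n^k(s) = Σ_{j=0}^{s} (−1)^j C(s−j, j) f_k(n−j)`. -/
noncomputable def Lgon (k n s : ℕ) : ℤ :=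
  ∑ j ∈ Finset.range (s+1), (-1 : ℤ)^j * ((s-j).choose j : ℤ) * (fgon k (n-j) : ℤ)

namespace Gon

open Finset

/-- The number of elements of `S` with value less than `i`. -/
def cnt {n : ℕ} (S : Finset (Fin n)) (i : ℕ) : ℕ := #{x ∈ S | x.val < i}

section cnt

variable {n : ℕ} {S : Finset (Fin n)}

lemma cnt_zero : cnt S 0 = 0 := by simp [cnt]

lemma cnt_self : cnt S n = #S := by simp [cnt]

lemma cnt_mono {i j : ℕ} (h : i ≤ j) : cnt S i ≤ cnt S j :=
  card_le_card (monotone_filter_right _ fun _ _ hx => lt_of_lt_of_le hx h)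

lemma cnt_succ (x : Fin n) : cnt S (x + 1) = cnt S x + if x ∈ S then 1 else 0 := by
  split_ifs with h
  · have : {y ∈ S | y.val < x.val + 1} = insert x {y ∈ S | y.val < x.val} := by
      ext y
      simp only [mem_filter, mem_insert, Fin.ext_iff]
      constructor
      · rintro ⟨h1, h2⟩
        by_cases h3 : y.val = x
        · exact Or.inl h3
        · exact Or.inr ⟨h1, by omega⟩
      · rintro (h1 | h1)
        · exact ⟨by rwa [Fin.ext h1], by omega⟩
        · exact ⟨h1.1, by omega⟩
    rw [cnt, this, card_insert_of_notMem (by simp), cnt]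
  · have : {y ∈ S | y.val < x.val + 1} = {y ∈ S | y.val < x.val} := by
      refine filter_congr fun y hy => ?_
      have : y.val ≠ x := fun e => h (by rwa [← Fin.ext e])
      omega
    rw [cnt, this, cnt, add_zero]

lemma cnt_le_add {i j : ℕ} (h : i ≤ j) : cnt S j ≤ cnt S i + (j - i) := by
  induction j, h using Nat.le_induction with
  | base => simp
  | succ j hij ih =>
    by_cases hj : j < n
    · have := cnt_succ (S := S) ⟨j, hj⟩
      simp only at this
      split_ifs at this <;> omega
    · have : cnt S (j + 1) = cnt S j := by
        refine congrArg card (filter_congr fun y _ => ?_)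
        have := y.isLt
        omega
      omega

lemma cnt_add_compl {i : ℕ} (h : i ≤ n) : cnt S i + cnt Sᶜ i = i := by
  induction i with
  | zero => simp [cnt_zero]
  | succ i ih =>
    have h1 := cnt_succ (S := S) ⟨i, h⟩
    have h2 := cnt_succ (S := Sᶜ) ⟨i, h⟩
    have := ih (by omega)
    simp only [mem_compl] at h1 h2
    split_ifs at h1 h2 <;> omega

lemma cnt_lt_iff {x : Fin n} (hx : x ∈ S) {i : ℕ} : cnt S x < cnt S i ↔ x.val < i := by
  constructor
  · intro h
    by_contra h'
    exact absurd (cnt_mono (S := S) (not_lt.1 h')) (by omega)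
  · intro h
    have h1 := cnt_succ (S := S) x
    have h2 := cnt_mono (S := S) (Nat.succ_le_of_lt h)
    rw [if_pos hx] at h1
    simp only [Nat.succ_eq_add_one] at h2
    omega

lemma exists_cnt_eq {r i : ℕ} (h : r < cnt S i) : ∃ x ∈ S, cnt S x = r := by
  induction i with
  | zero => simp [cnt_zero] at h
  | succ i ih =>
    by_cases h' : r < cnt S i
    · exact ih h'
    by_cases hi : i < n
    · have h1 := cnt_succ (S := S) ⟨i, hi⟩
      simp only at h1
      split_ifs at h1 with h2
      · exact ⟨_, h2, by simp only; omega⟩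
      · omega
    · have : cnt S (i + 1) = cnt S i := by
        refine congrArg card (filter_congr fun y _ => ?_)
        have := y.isLt
        omega
      omega

lemma cnt_eq_of_strictMonoOn {T : Finset (Fin n)} {π : Equiv.Perm (Fin n)}
    (hπ : StrictMonoOn π S) (hT : ∀ x, π x ∈ T ↔ x ∈ S) {x : Fin n} (hx : x ∈ S) :
    cnt S x = cnt T (π x) := by
  refine card_bij' (fun y _ => π y) (fun y _ => π.symm y) ?_ ?_ (by simp) (by simp)
  · intro y hy
    simp only [mem_filter, Fin.val_fin_lt] at hy ⊢
    exact ⟨(hT y).2 hy.1, hπ hy.1 hx hy.2⟩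
  · intro y hy
    simp only [mem_filter, Fin.val_fin_lt] at hy ⊢
    have hy1 : π.symm y ∈ S := (hT _).1 (by simpa using hy.1)
    exact ⟨hy1, (hπ.lt_iff_lt hy1 hx).1 (by simpa using hy.2)⟩

lemma cnt_injOn : Set.InjOn (fun x : Fin n => cnt S x) S := by
  intro x hx y hy h
  have h1 := cnt_lt_iff (S := S) hx (i := y)
  have h2 := cnt_lt_iff (S := S) hy (i := x)
  simp only at h
  exact Fin.ext (by omega)

end cnt

section perm

variable {n : ℕ} {π : Equiv.Perm (Fin n)}

/-- The strict excedance positions of `π`. -/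
def exc (π : Equiv.Perm (Fin n)) : Finset (Fin n) := {x | x < π x}

/-- The strict excedance values of `π`. -/
def excVal (π : Equiv.Perm (Fin n)) : Finset (Fin n) := {x | π.symm x < x}

lemma mem_exc {x : Fin n} : x ∈ exc π ↔ x < π x := by simp [exc]

lemma apply_mem_excVal {x : Fin n} : π x ∈ excVal π ↔ x ∈ exc π := by simp [exc, excVal]

lemma contains_321_iff : ContainsPattern π [3, 2, 1] ↔
    ∃ x y z, x < y ∧ y < z ∧ π z < π y ∧ π y < π x := by
  constructor
  · rintro ⟨f, hf, h⟩
    exact ⟨f 0, f 1, f 2, hf (by decide), hf (by decide), (h 2 1).1 (by decide),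
      (h 1 0).1 (by decide)⟩
  · rintro ⟨x, y, z, hxy, hyz, h1, h2⟩
    refine ⟨![x, y, z], ?_, ?_⟩
    · refine (Fin.strictMono_iff_lt_succ (n := 2)).2 ?_
      intro i
      fin_cases i
      · exact hxy
      · exact hyz
    · have h3 := h1.trans h2
      intro a b
      change Fin 3 at a b
      fin_cases a <;> fin_cases b <;> simp [h1, h2, h3, h1.le, h2.le, h3.le]

lemma strictMonoOn_exc (h : AvoidsPattern π [3, 2, 1]) : StrictMonoOn π (exc π) := by
  intro x hx y hy hxy
  by_contra hlt
  have hyx : π y < π x := lt_of_le_of_ne (not_lt.1 hlt) (fun e => hxy.ne' (π.injective e))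
  refine h (contains_321_iff.2 ⟨x, y, ?_⟩)
  by_contra hc
  push Not at hc
  have hsub : (Iio (π y)).map π.symm.toEmbedding ⊆ (Iio y).erase x := by
    intro z hz
    simp only [mem_map_equiv, Equiv.symm_symm, mem_Iio] at hz
    simp only [mem_erase, mem_Iio]
    refine ⟨?_, ?_⟩
    · rintro rfl
      exact absurd hz hyx.asymm
    · by_contra hzy
      rcases (not_lt.1 hzy).eq_or_lt with rfl | hzy
      · exact lt_irrefl _ hz
      · exact absurd (hc z hxy hzy hz) (not_le.2 hyx)
  have hc := card_le_card hsub
  rw [card_map, card_erase_of_mem (by simpa using hxy)] at hc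
  simp only [Fin.card_Iio] at hc
  have : y < π y := by simpa [exc] using hy
  have := Fin.lt_def.1 this
  have := Fin.lt_def.1 hxy
  omega

lemma strictMonoOn_exc_compl (h : AvoidsPattern π [3, 2, 1]) :
    StrictMonoOn π ((exc π)ᶜ : Finset (Fin n)) := by
  intro x hx y hy hxy
  by_contra hlt
  have hyx : π y < π x := lt_of_le_of_ne (not_lt.1 hlt) (fun e => hxy.ne' (π.injective e))
  have hsub : (insert y (Iio x)).map π.toEmbedding ⊆ Iio (π x) := by
    intro z hz
    simp only [mem_map, mem_insert, mem_Iio, Equiv.coe_toEmbedding] at hz ⊢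
    obtain ⟨z, rfl | hz, rfl⟩ := hz
    · exact hyx
    · by_contra hzx
      have : π x < π z := lt_of_le_of_ne (not_lt.1 hzx) (fun e => hz.ne' (π.injective e))
      exact h (contains_321_iff.2 ⟨z, x, y, hz, hxy, hyx, this⟩)
  have hc := card_le_card hsub
  rw [card_map, card_insert_of_notMem (by simpa using hxy.le)] at hc
  simp only [Fin.card_Iio] at hc
  have : π x ≤ x := by simpa [exc] using hx
  have := Fin.le_def.1 this
  omega

lemma avoids_321_of_strictMonoOn {S : Finset (Fin n)} (h : StrictMonoOn π S)
    (hc : StrictMonoOn π (Sᶜ : Finset (Fin n))) : AvoidsPattern π [3, 2, 1] := by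
  rw [AvoidsPattern, contains_321_iff]
  rintro ⟨x, y, z, hxy, hyz, h1, h2⟩
  have key : ∀ {a b}, a < b → π b < π a → ¬(a ∈ S ↔ b ∈ S) := by
    intro a b hab hba he
    by_cases ha : a ∈ S
    · exact (h ha (he.1 ha) hab).asymm hba
    · exact (hc (by simpa using ha) (by simpa using fun hb => ha (he.2 hb)) hab).asymm hba
  have := key hxy h2
  have := key hyz h1
  have := key (hxy.trans hyz) (h1.trans h2)
  tauto

lemma cnt_excVal_succ_le (i : ℕ) : cnt (excVal π) (i + 1) ≤ cnt (exc π) i := by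
  refine card_le_card_of_injOn π.symm ?_ π.symm.injective.injOn
  intro y hy
  simp only [coe_filter, Set.mem_ofPred_eq, excVal, exc, mem_filter, mem_univ, true_and,
    Equiv.apply_symm_apply] at hy ⊢
  have := Fin.lt_def.1 hy.1
  exact ⟨hy.1, by omega⟩

lemma card_excVal : #(excVal π) = #(exc π) :=
  card_bij' (fun y _ => π.symm y) (fun y _ => π y) (by simp [exc, excVal])
    (by simp [exc, excVal]) (by simp) (by simp)

/-- A permutation avoiding `321` is determined by its excedance positions and values. -/
lemma perm_ext {σ : Equiv.Perm (Fin n)} (hπ : AvoidsPattern π [3, 2, 1])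
    (hσ : AvoidsPattern σ [3, 2, 1]) (he : exc π = exc σ) (hv : excVal π = excVal σ) : π = σ := by
  ext1 x
  by_cases hx : x ∈ exc π
  · have h1 := cnt_eq_of_strictMonoOn (strictMonoOn_exc hπ) (fun _ => apply_mem_excVal) hx
    have h2 := cnt_eq_of_strictMonoOn (strictMonoOn_exc hσ) (fun _ => apply_mem_excVal) (he ▸ hx)
    rw [← he, ← hv] at h2
    exact cnt_injOn (S := excVal π) (apply_mem_excVal.2 hx)
      (by rw [hv]; exact apply_mem_excVal.2 (he ▸ hx)) (h1.symm.trans h2)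
  · have hx' : x ∈ (exc π)ᶜ := mem_compl.2 hx
    have h1 := cnt_eq_of_strictMonoOn (T := (excVal π)ᶜ) (strictMonoOn_exc_compl hπ)
      (fun _ => by simp [apply_mem_excVal]) hx'
    have h2 := cnt_eq_of_strictMonoOn (T := (excVal σ)ᶜ) (strictMonoOn_exc_compl hσ)
      (fun _ => by simp [apply_mem_excVal]) (he ▸ hx')
    rw [← he, ← hv] at h2
    exact cnt_injOn (S := (excVal π)ᶜ) (by simpa [apply_mem_excVal] using hx)
      (by rw [hv]; simpa [apply_mem_excVal, ← he] using hx) (h1.symm.trans h2)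

/-- Positions and values satisfying the ballot condition come from a `321`-avoiding permutation. -/
lemma exists_perm {P V : Finset (Fin n)} (hcard : #P = #V)
    (hle : ∀ i < n, cnt V (i + 1) ≤ cnt P i) :
    ∃ π : Equiv.Perm (Fin n), AvoidsPattern π [3, 2, 1] ∧ exc π = P ∧ excVal π = V := by
  let e : P ≃o V := (P.orderIsoOfFin rfl).symm.trans (V.orderIsoOfFin hcard.symm)
  have hcard' : #Pᶜ = #Vᶜ := by rw [card_compl, card_compl, hcard]
  let e' : (Pᶜ : Finset (Fin n)) ≃o (Vᶜ : Finset (Fin n)) :=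
    ((Pᶜ).orderIsoOfFin rfl).symm.trans ((Vᶜ).orderIsoOfFin hcard'.symm)
  let e'' : {x // x ∉ P} ≃ {x // x ∉ V} :=
    ((Equiv.subtypeEquivRight fun x => by simp).trans e'.toEquiv).trans
      (Equiv.subtypeEquivRight fun x => by simp)
  let π : Equiv.Perm (Fin n) := Equiv.subtypeCongr e.toEquiv e''
  have hπ1 : ∀ x (hx : x ∈ P), π x = e ⟨x, hx⟩ := fun x hx => by
    simp [π, Equiv.subtypeCongr, Equiv.sumCompl_symm_apply_of_pos, hx]
  have hπ2 : ∀ x (hx : x ∉ P), π x = e' ⟨x, mem_compl.2 hx⟩ := fun x hx => by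
    simp [π, Equiv.subtypeCongr, Equiv.sumCompl_symm_apply_of_neg, hx, e'']
    rfl
  have hV : ∀ x, π x ∈ V ↔ x ∈ P := by
    intro x
    by_cases hx : x ∈ P
    · rw [hπ1 x hx]
      simp [hx]
    · rw [hπ2 x hx]
      simpa [hx] using mem_compl.1 (e' ⟨x, mem_compl.2 hx⟩).2
  have hm1 : StrictMonoOn π P := fun x hx y hy hxy => by
    rw [hπ1 x hx, hπ1 y hy]
    exact e.strictMono (a := ⟨x, hx⟩) (b := ⟨y, hy⟩) hxy
  have hm2 : StrictMonoOn π (Pᶜ : Finset (Fin n)) := fun x hx y hy hxy => by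
    rw [hπ2 x (mem_compl.1 hx), hπ2 y (mem_compl.1 hy)]
    exact e'.strictMono (a := ⟨x, hx⟩) (b := ⟨y, hy⟩) hxy
  have hP : ∀ x, x < π x ↔ x ∈ P := by
    intro x
    by_cases hx : x ∈ P
    · simp only [hx, iff_true]
      by_contra hlt
      have h1 := cnt_eq_of_strictMonoOn hm1 hV hx
      have h2 := cnt_succ (S := V) (π x)
      rw [if_pos ((hV x).2 hx)] at h2
      have h3 := hle (π x) (π x).isLt
      have h4 := cnt_mono (S := P) (Fin.le_def.1 (not_lt.1 hlt))
      omega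
    · simp only [hx, iff_false]
      intro hlt
      have hx' : x ∈ Pᶜ := mem_compl.2 hx
      have h1 := cnt_eq_of_strictMonoOn (T := Vᶜ) hm2 (fun y => by simp [hV]) hx'
      have h2 := (cnt_lt_iff hx').2 (Fin.lt_def.1 hlt)
      have h3 := hle (π x) (π x).isLt
      have h4 := cnt_mono (S := V) (Nat.le_succ (π x))
      have h5 := cnt_add_compl (S := P) (π x).isLt.le
      have h6 := cnt_add_compl (S := V) (π x).isLt.le
      simp only [Nat.succ_eq_add_one] at h4
      omega
  refine ⟨π, avoids_321_of_strictMonoOn hm1 hm2, ?_, ?_⟩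
  · ext x
    simp [exc, hP]
  · ext y
    obtain ⟨x, rfl⟩ := π.surjective y
    rw [apply_mem_excVal, mem_exc, hP, hV]

end perm

/-- `π` contains increasing sequences `u`, `l` of length `k` such that every `u i` is inverted with
every `l j`, except possibly for the two corner pairs. -/
def HasGrid (k : ℕ) {n : ℕ} (π : Equiv.Perm (Fin n)) : Prop :=
  ∃ u l : ℕ → Fin n, (∀ i j, i < j → j < k → u i < u j ∧ π (u i) < π (u j)) ∧
    (∀ i j, i < j → j < k → l i < l j ∧ π (l i) < π (l j)) ∧
    ∀ i j, i < k → j < k → (0 < i ∨ j + 1 < k) → (0 < j ∨ i + 1 < k) →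
      u i < l j ∧ π (l j) < π (u i)

/-- Counting form of a grid for the excedance positions `P` and values `V`. -/
def CountGrid (k : ℕ) {n : ℕ} (P V : Finset (Fin n)) : Prop :=
  ∃ s i, i + 2 ≤ n ∧ cnt V i < s ∧ s + k ≤ cnt P i + 2 ∧ cnt V (i + 2) ≤ s ∧
    s + k ≤ cnt P (i + 2) + 1

section grid

variable {n : ℕ} {π : Equiv.Perm (Fin n)}

lemma inversion_mem (h : AvoidsPattern π [3, 2, 1]) {x y : Fin n} (hxy : x < y)
    (hyx : π y < π x) : x ∈ exc π ∧ y ∉ exc π := by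
  by_cases hx : x ∈ exc π
  · exact ⟨hx, fun hy => (strictMonoOn_exc h hx hy hxy).asymm hyx⟩
  · exfalso
    by_cases hy : y ∈ exc π
    · rw [mem_exc] at hx hy
      exact hx ((hxy.trans hy).trans hyx)
    · exact (strictMonoOn_exc_compl h (by simpa using hx) (by simpa using hy) hxy).asymm hyx

lemma inversion_iff (h : AvoidsPattern π [3, 2, 1]) {x y : Fin n} (hx : x ∈ exc π)
    (hy : y ∉ exc π) {s t : ℕ} (hs : cnt (exc π) x = s) (ht : cnt (exc π)ᶜ y = t) :
    x < y ∧ π y < π x ↔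
      cnt (excVal π) (s + t + 1) ≤ s ∧ s < cnt (exc π) (s + t + 1) := by
  have hy' : y ∈ (exc π)ᶜ := mem_compl.2 hy
  have hπx : π x ∈ excVal π := apply_mem_excVal.2 hx
  have hπy : π y ∈ (excVal π)ᶜ := by simpa [apply_mem_excVal] using hy
  have hs' := cnt_eq_of_strictMonoOn (strictMonoOn_exc h) (fun _ => apply_mem_excVal) hx
  have ht' := cnt_eq_of_strictMonoOn (T := (excVal π)ᶜ) (strictMonoOn_exc_compl h)
      (fun _ => by simp [apply_mem_excVal]) hy'
  have h1 := cnt_lt_iff hx (i := s + t + 1)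
  have h2 := cnt_lt_iff hy' (i := s + t + 1)
  have h3 := cnt_lt_iff hπx (i := s + t + 1)
  have h4 := cnt_lt_iff hπy (i := s + t + 1)
  have h5 := (cnt_lt_iff hx (i := n)).2 x.isLt
  have h6 := (cnt_lt_iff hy' (i := n)).2 y.isLt
  have h7 := cnt_add_compl (S := exc π) le_rfl
  have hn : s + t + 1 ≤ n := by omega
  have h8 := cnt_add_compl (S := exc π) hn
  have h9 := cnt_add_compl (S := excVal π) hn
  rw [Fin.lt_def, Fin.lt_def]
  omega

lemma cnt_rect_val {V : Finset (Fin n)} {s t s' t' : ℕ} (h : cnt V (s + t + 1) ≤ s)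
    (hs : s ≤ s') (ht : t' ≤ t) : cnt V (s' + t' + 1) ≤ s' := by
  have h1 := cnt_mono (S := V) (show s' + t' + 1 ≤ s + t + 1 + (s' - s) by omega)
  have h2 := cnt_le_add (S := V) (show s + t + 1 ≤ s + t + 1 + (s' - s) by omega)
  omega

lemma cnt_rect_pos {P : Finset (Fin n)} {s t s' t' : ℕ} (h : s < cnt P (s + t + 1))
    (hs : s' ≤ s) (ht : t ≤ t') : s' < cnt P (s' + t' + 1) := by
  have h1 := cnt_mono (S := P) (show s + t + 1 ≤ s' + t' + 1 + (s - s') by omega)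
  have h2 := cnt_le_add (S := P) (show s' + t' + 1 ≤ s' + t' + 1 + (s - s') by omega)
  omega

lemma cnt_add_le_of_chain {k : ℕ} {S : Finset (Fin n)} {u : ℕ → Fin n} (hu : ∀ i < k, u i ∈ S)
    (hlt : ∀ i j, i < j → j < k → u i < u j) {i j : ℕ} (hij : i ≤ j) (hj : j < k) :
    cnt S (u i) + (j - i) ≤ cnt S (u j) := by
  induction j, hij using Nat.le_induction with
  | base => simp
  | succ j hij ih =>
    have h1 := ih (by omega)
    have h2 := (cnt_lt_iff (hu j (by omega))).2 (Fin.lt_def.1 (hlt j (j + 1) (by omega) hj))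
    omega

lemma hasGrid_iff {k : ℕ} (hk : 3 ≤ k) (h : AvoidsPattern π [3, 2, 1]) :
    HasGrid k π ↔ CountGrid k (exc π) (excVal π) := by
  constructor
  · rintro ⟨u, l, hu, hl, hul⟩
    have hu' : ∀ i < k, u i ∈ exc π := fun i hi => by
      have := hul i 1 hi (by omega) (by omega) (by omega)
      exact (inversion_mem h this.1 this.2).1
    have hl' : ∀ j < k, l j ∈ (exc π)ᶜ := fun j hj => by
      have := hul 1 j (by omega) hj (by omega) (by omega)
      exact mem_compl.2 (inversion_mem h this.1 this.2).2
    have cu {i j} (hij : i ≤ j) (hj : j < k) :=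
      cnt_add_le_of_chain hu' (fun i j h1 h2 => (hu i j h1 h2).1) hij hj
    have cl {i j} (hij : i ≤ j) (hj : j < k) :=
      cnt_add_le_of_chain hl' (fun i j h1 h2 => (hl i j h1 h2).1) hij hj
    have inv {i j} (hi : i < k) (hj : j < k) (h1 : 0 < i ∨ j + 1 < k) (h2 : 0 < j ∨ i + 1 < k) :=
      (inversion_iff h (hu' i hi) (mem_compl.1 (hl' j hj)) rfl rfl).1 (hul i j hi hj h1 h2)
    have u01 := cu (i := 0) (j := 1) (by omega) (by omega)
    have l01 := cl (i := 0) (j := 1) (by omega) (by omega)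
    have u1a := cu (i := 1) (j := k - 2) (by omega) (by omega)
    have l1a := cl (i := 1) (j := k - 2) (by omega) (by omega)
    have u1b := cu (i := 1) (j := k - 1) (by omega) (by omega)
    have l1b := cl (i := 1) (j := k - 1) (by omega) (by omega)
    have i1 := (inv (i := 0) (j := k - 2) (by omega) (by omega) (by omega) (by omega)).1
    have i2 := (inv (i := k - 2) (j := 0) (by omega) (by omega) (by omega) (by omega)).2
    have i3 := (inv (i := 1) (j := k - 1) (by omega) (by omega) (by omega) (by omega)).1
    have i4 := (inv (i := k - 1) (j := 1) (by omega) (by omega) (by omega) (by omega)).2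
    have n1 := (cnt_lt_iff (hu' (k - 1) (by omega)) (i := n)).2 (Fin.isLt _)
    have n2 := (cnt_lt_iff (hl' (k - 1) (by omega)) (i := n)).2 (Fin.isLt _)
    have n3 := cnt_add_compl (S := exc π) le_rfl
    set s := cnt (exc π) (u 1)
    set t := cnt (exc π)ᶜ (l 1)
    have j1 := cnt_rect_val i1 (s' := s - 1) (t' := t + k - 3) (by omega) (by omega)
    have j2 := cnt_rect_pos i2 (s' := s + k - 3) (t' := t - 1) (by omega) (by omega)
    have j3 := cnt_rect_val i3 (s' := s) (t' := t + k - 2) (by omega) (by omega)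
    have j4 := cnt_rect_pos i4 (s' := s + k - 2) (t' := t) (by omega) (by omega)
    rw [show s - 1 + (t + k - 3) + 1 = s + t + k - 3 by omega] at j1
    rw [show s + k - 3 + (t - 1) + 1 = s + t + k - 3 by omega] at j2
    rw [show s + (t + k - 2) + 1 = s + t + k - 3 + 2 by omega] at j3
    rw [show s + k - 2 + t + 1 = s + t + k - 3 + 2 by omega] at j4
    exact ⟨s, s + t + k - 3, by omega, by omega, by omega, by omega, by omega⟩
  · rintro ⟨s, i, hi, h1, h2, h3, h4⟩
    have hc := cnt_add_compl (S := exc π) (show i ≤ n by omega)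
    have hc1 := cnt_add_compl (S := excVal π) hi
    have hc2 := cnt_add_compl (S := exc π) hi
    have hc3 := cnt_add_compl (S := excVal π) le_rfl
    have hc4 := cnt_add_compl (S := exc π) le_rfl
    have hc5 := cnt_mono (S := (excVal π)ᶜ) hi
    have hc6 : cnt (excVal π) n = cnt (exc π) n := by rw [cnt_self, cnt_self, card_excVal]
    obtain ⟨t, rfl⟩ : ∃ t, i = s + t + k - 2 := ⟨i + 2 - s - k, by omega⟩
    have hu : ∀ j, ∃ x, j < k → x ∈ exc π ∧ cnt (exc π) x = s - 1 + j := fun j => by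
      by_cases hj : j < k
      · obtain ⟨x, hx⟩ := exists_cnt_eq (S := exc π) (r := s - 1 + j) (i := s + t + k - 2 + 2)
          (by omega)
        exact ⟨x, fun _ => hx⟩
      · exact ⟨⟨0, by omega⟩, fun h => absurd h hj⟩
    have hl : ∀ j, ∃ x, j < k → x ∈ (exc π)ᶜ ∧ cnt (exc π)ᶜ x = t + j := fun j => by
      by_cases hj : j < k
      · obtain ⟨x, hx⟩ := exists_cnt_eq (S := (exc π)ᶜ) (r := t + j) (i := n) (by omega)
        exact ⟨x, fun _ => hx⟩
      · exact ⟨⟨0, by omega⟩, fun h => absurd h hj⟩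
    choose u hu using hu
    choose l hl using hl
    refine ⟨u, l, fun i j hij hj => ?_, fun i j hij hj => ?_, fun i j hi hj e1 e2 => ?_⟩
    · have hi := hu i (by omega)
      have hj := hu j hj
      have : u i < u j := (cnt_lt_iff hi.1).1 (by omega)
      exact ⟨this, strictMonoOn_exc h hi.1 hj.1 this⟩
    · have hi := hl i (by omega)
      have hj := hl j hj
      have : l i < l j := (cnt_lt_iff hi.1).1 (by omega)
      exact ⟨this, strictMonoOn_exc_compl h hi.1 hj.1 this⟩
    · have hi' := hu i hi
      have hj' := hl j hj
      refine (inversion_iff h hi'.1 (mem_compl.1 hj'.1) hi'.2 hj'.2).2 ⟨?_, ?_⟩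
      · rcases e1 with e1 | e1
        · refine cnt_rect_val (s := s) (t := t + k - 1) ?_ (by omega) (by omega)
          rwa [show s + (t + k - 1) + 1 = s + t + k - 2 + 2 by omega]
        · refine cnt_rect_val (s := s - 1) (t := t + k - 2) ?_ (by omega) (by omega)
          rw [show s - 1 + (t + k - 2) + 1 = s + t + k - 2 by omega]
          omega
      · rcases e2 with e2 | e2
        · refine cnt_rect_pos (s := s + k - 2) (t := t + 1) ?_ (by omega) (by omega)
          rw [show s + k - 2 + (t + 1) + 1 = s + t + k - 2 + 2 by omega]
          omega
        · refine cnt_rect_pos (s := s + k - 3) (t := t) ?_ (by omega) (by omega)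
          rw [show s + k - 3 + t + 1 = s + t + k - 2 by omega]
          omega

end grid

section pattern

lemma containsPattern_iff {n : ℕ} {π : Equiv.Perm (Fin n)} {w : List ℕ} (hw : w.Nodup)
    (hne : w ≠ []) : ContainsPattern π w ↔
      ∃ g : ℕ → Fin n, w.Pairwise fun x y => g x < g y ∧ (x < y ↔ π (g x) < π (g y)) := by
  have hinj := List.nodup_iff_injective_get.1 hw
  constructor
  · rintro ⟨f, hf, h⟩
    have : Nonempty (Fin w.length) := ⟨⟨0, List.length_pos_iff.2 hne⟩⟩
    have hg : ∀ a, Function.invFun w.get (w.get a) = a := Function.leftInverse_invFun hinj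
    refine ⟨f ∘ Function.invFun w.get, List.pairwise_iff_get.2 fun a b hab => ?_⟩
    simp only [Function.comp, hg]
    exact ⟨hf hab, h a b⟩
  · rintro ⟨g, hg⟩
    rw [List.pairwise_iff_get] at hg
    refine ⟨fun a => g (w.get a), fun a b hab => (hg a b hab).1, fun a b => ?_⟩
    rcases lt_trichotomy a b with hab | rfl | hab
    · exact (hg a b hab).2
    · simp
    · have h1 := hg b a hab
      have h2 : w.get a ≠ w.get b := fun e => hab.ne' (hinj e)
      have h3 : π (g (w.get a)) ≠ π (g (w.get b)) := fun e => h1.1.ne' (π.injective e)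
      rw [← not_iff_not, not_lt, not_lt, h2.symm.le_iff_lt, h3.symm.le_iff_lt]
      exact h1.2

lemma pairwise_iff_of_pairwise_lt {l : List ℕ} {R : ℕ → ℕ → Prop} (hl : l.Pairwise (· < ·)) :
    l.Pairwise R ↔ ∀ x ∈ l, ∀ y ∈ l, x < y → R x y := by
  refine ⟨fun h x hx y hy hxy => ?_, fun h => hl.imp_of_mem fun hx hy hxy => h _ hx _ hy hxy⟩
  obtain ⟨a, rfl⟩ := List.get_of_mem hx
  obtain ⟨b, rfl⟩ := List.get_of_mem hy
  rw [List.pairwise_iff_get] at h hl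
  rcases lt_trichotomy a b with hab | rfl | hab
  · exact h a b hab
  · exact absurd hxy (lt_irrefl _)
  · exact absurd (hl b a hab) hxy.asymm

lemma pairwise_append_filter_range' {pre : List ℕ} {m : ℕ} {R : ℕ → ℕ → Prop} :
    (pre ++ (List.range' 1 m).filter fun x => !(pre.contains x)).Pairwise R ↔
      pre.Pairwise R ∧ (∀ x y, 1 ≤ x → x < y → y ≤ m → x ∉ pre → y ∉ pre → R x y) ∧
        ∀ x ∈ pre, ∀ y, 1 ≤ y → y ≤ m → y ∉ pre → R x y := by
  have htail : ((List.range' 1 m).filter fun x => !(pre.contains x)).Pairwise (· < ·) :=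
    List.Pairwise.filter _ List.pairwise_lt_range'
  have hmem : ∀ x, x ∈ ((List.range' 1 m).filter fun x => !(pre.contains x)) ↔
      1 ≤ x ∧ x ≤ m ∧ x ∉ pre := fun x => by
    simp only [List.mem_filter, List.mem_range'_1, Bool.not_eq_true', List.contains_eq_mem,
      decide_eq_false_iff_not, and_assoc]
    exact ⟨fun h => ⟨h.1, by omega, h.2.2⟩, fun h => ⟨h.1, by omega, h.2.2⟩⟩
  rw [List.pairwise_append, pairwise_iff_of_pairwise_lt htail]
  simp only [hmem]
  refine and_congr_right fun _ => and_congr ?_ ?_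
  · exact ⟨fun h x y h1 h2 h3 h4 h5 => h x ⟨h1, by omega, h4⟩ y ⟨by omega, h3, h5⟩ h2,
      fun h x hx y hy hxy => h x y hx.1 hxy hy.2.1 hx.2.2 hy.2.2⟩
  · exact ⟨fun h x hx y h1 h2 h3 => h x hx y ⟨h1, h2, h3⟩,
      fun h x hx y hy => h x hx y hy.1 hy.2.1 hy.2.2⟩

lemma pairwise_gonPattern {k a : ℕ} {sep : Bool} {R : ℕ → ℕ → Prop} (hk : 3 ≤ k)
    (ha : a = k ∨ a = k + 1) : (gonPattern k a sep).Pairwise R ↔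
      (∀ x y, (x = a ∨ k + 2 ≤ x) → x < y → (y = a ∨ k + 2 ≤ y) → y ≤ 2 * k → R x y) ∧
      (∀ x y, 1 ≤ x → x ≠ a → x < y → y ≠ a → y ≤ k + 1 → R x y) ∧
      (∀ x y, (x = a ∨ k + 2 ≤ x) → x ≤ 2 * k → 1 ≤ y → y ≠ a → y ≤ k + 1 →
        (sep = false ∨ x < 2 * k ∨ 1 < y) → R x y) ∧
      (sep = true → R 1 (2 * k)) := by
  have hmid : (List.range' (k + 2) (k - 2)).Pairwise (· < ·) := List.pairwise_lt_range'
  have hmem : ∀ x, x ∈ List.range' (k + 2) (k - 2) ↔ k + 2 ≤ x ∧ x < 2 * k := fun x => by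
    rw [List.mem_range'_1]
    omega
  cases sep
  · rw [gonPattern, pairwise_append_filter_range']
    simp only [List.pairwise_append, List.pairwise_cons, pairwise_iff_of_pairwise_lt hmid, hmem,
      List.mem_append, List.mem_cons,
      List.not_mem_nil, Bool.false_eq_true, if_false, or_false, List.Pairwise.nil, and_true,
      IsEmpty.forall_iff, implies_true, true_and, forall_eq, true_or, forall_const]
    constructor
    · rintro ⟨⟨h1, h2, h3⟩, h4, h5⟩
      refine ⟨fun x y hx hxy hy hy2 => ?_, fun x y _ _ _ _ _ => h4 x y (by omega) (by omega)
        (by omega) (by omega) (by omega), fun x y _ _ _ _ _ => h5 x (by omega) y (by omega)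
        (by omega) (by omega)⟩
      by_cases hxa : x = a
      · exact hxa ▸ h1 y (by omega)
      · by_cases hyk : y = 2 * k
        · exact hyk ▸ h3 x (by omega)
        · exact h2 x (by omega) y (by omega) hxy
    · rintro ⟨h1, h2, h3⟩
      exact ⟨⟨fun y _ => h1 a y (by omega) (by omega) (by omega) (by omega),
        fun x _ y _ hxy => h1 x y (by omega) hxy (by omega) (by omega),
        fun x _ => h1 x _ (by omega) (by omega) (by omega) (by omega)⟩,
        fun x y _ hxy _ _ _ => h2 x y (by omega) (by omega) hxy (by omega) (by omega),
        fun x _ y _ _ _ => h3 x y (by omega) (by omega) (by omega) (by omega) (by omega)⟩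
  · rw [gonPattern, pairwise_append_filter_range']
    simp only [List.pairwise_append, List.pairwise_cons, pairwise_iff_of_pairwise_lt hmid, hmem,
      List.mem_append, List.mem_cons,
      List.not_mem_nil, if_true, or_false, List.Pairwise.nil, and_true,
      IsEmpty.forall_iff, implies_true, forall_eq, false_or,
      Bool.true_eq_false, forall_const]
    constructor
    · rintro ⟨⟨h1, h2, h0, h3⟩, h4, h5⟩
      refine ⟨fun x y hx hxy hy hy2 => ?_, fun x y hx hxa hxy hya hy => ?_,
        fun x y hx hx2 hy hya hy2 hxy => ?_, h0⟩
      · by_cases hxa : x = a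
        · exact hxa ▸ h1 y (by omega)
        · by_cases hyk : y = 2 * k
          · exact hyk ▸ h3 x (by omega) _ (by omega)
          · exact h2 x (by omega) y (by omega) hxy
      · by_cases hx1 : x = 1
        · exact hx1 ▸ h5 1 (by omega) y (by omega) (by omega) (by omega)
        · exact h4 x y (by omega) (by omega) (by omega) (by omega) (by omega)
      · by_cases hy1 : y = 1
        · by_cases hxa : x = a
          · exact hxa ▸ h1 y (by omega)
          · exact hy1 ▸ h3 x (by omega) _ (by omega)
        · exact h5 x (by omega) y (by omega) (by omega) (by omega)
    · rintro ⟨h1, h2, h3, h0⟩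
      refine ⟨⟨fun y hy => ?_, fun x _ y _ hxy => h1 x y (by omega) hxy (by omega) (by omega), h0,
        fun x _ y hy => ?_⟩,
        fun x y _ hxy _ _ _ => h2 x y (by omega) (by omega) hxy (by omega) (by omega),
        fun x hx y _ _ _ => ?_⟩
      · by_cases hy1 : y = 1
        · exact h3 a y (by omega) (by omega) (by omega) (by omega) (by omega) (by omega)
        · exact h1 a y (by omega) (by omega) (by omega) (by omega)
      · rcases hy with rfl | rfl
        · exact h3 x 1 (by omega) (by omega) (by omega) (by omega) (by omega) (by omega)
        · exact h1 x _ (by omega) (by omega) (by omega) (by omega)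
      · by_cases hx1 : x = 1
        · exact h2 x y (by omega) (by omega) (by omega) (by omega) (by omega)
        · exact h3 x y (by omega) (by omega) (by omega) (by omega) (by omega) (by omega)

end pattern

/-- `w` spells a Motzkin-type path from height `h` to `0` of height at most `K` in which a double
step between two points of height `K` repeats the first bit; `mem` is the first bit of the step
before `w` if that step started at height `K`. -/
def GoodWord (K h : ℕ) (mem : Option Bool) {n : ℕ} (w : Fin n → Bool × Bool) : Prop :=
  ∃ H : ℕ → ℕ, H 0 = h ∧ H n = 0 ∧
    (∀ i : Fin n, H (i + 1) + (w i).2.toNat = H i + (w i).1.toNat ∧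
      ((w i).2 = true → 1 ≤ H i) ∧ H (i + 1) ≤ K) ∧
    (∀ (i : ℕ) (hi : i + 1 < n), H i = K → H (i + 2) = K →
      (w ⟨i, by omega⟩).1 = (w ⟨i + 1, hi⟩).1) ∧
    (∀ (hn : 0 < n) (q : Bool), mem = some q → H 1 = K → (w ⟨0, hn⟩).1 = q)

/-- The step `c` may follow height `h` with memory `mem`. -/
def StepOK (K h : ℕ) (mem : Option Bool) (c : Bool × Bool) : Prop :=
  (c.2 = true → 1 ≤ h) ∧ h + c.1.toNat - c.2.toNat ≤ K ∧
    ∀ q, mem = some q → h + c.1.toNat - c.2.toNat = K → c.1 = q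

lemma goodWord_cons {K h : ℕ} {mem : Option Bool} {n : ℕ} {c : Bool × Bool}
    {w : Fin n → Bool × Bool} :
    GoodWord K h mem (Fin.cons c w : Fin (n + 1) → Bool × Bool) ↔ StepOK K h mem c ∧
      GoodWord K (h + c.1.toNat - c.2.toNat) (if h = K then some c.1 else none) w := by
  constructor
  · rintro ⟨H, rfl, hn, hs, ht, hm⟩
    have h0 := hs 0
    simp only [Fin.cons_zero, Fin.val_zero, zero_add] at h0
    have h1 : H 1 = H 0 + c.1.toNat - c.2.toNat := by omega
    refine ⟨⟨h0.2.1, by omega, fun q hq hK => hm n.succ_pos q hq (by omega)⟩,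
      fun i => H (i + 1), h1, hn, fun i => ?_, fun i hi h2 h3 => ?_, fun hn' q hq h2 => ?_⟩
    · simpa using hs i.succ
    · exact ht (i + 1) (by omega) h2 h3
    · split_ifs at hq with hK
      rw [Option.some.injEq] at hq
      rw [← hq]
      exact (ht 0 (by omega) hK h2).symm
  · rintro ⟨⟨h1, h2, h3⟩, H, h0, hn, hs, ht, hm⟩
    refine ⟨fun i => Nat.casesOn i h H, rfl, hn, fun i => ?_, fun i hi e1 e2 => ?_,
      fun _ q hq e => ?_⟩
    · refine Fin.cases ?_ (fun i => ?_) i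
      · refine ⟨?_, h1, h0.trans_le h2⟩
        change H 0 + c.2.toNat = h + c.1.toNat
        rw [h0]
        rcases c with ⟨_, _ | _⟩
        · simp
        · have := h1 rfl
          simp only [Bool.toNat_true]
          omega
      · simpa using hs i
    · rcases i with _ | i
      · exact (hm (by omega) c.1 (if_pos e1) e2).symm
      · exact ht i (by omega) e1 e2
    · exact h3 q hq (h0 ▸ e)

/-- The number of good words. -/
noncomputable def numWords (K h : ℕ) (mem : Option Bool) (n : ℕ) : ℕ :=
  Nat.card {w : Fin n → Bool × Bool // GoodWord K h mem w}

open Classical in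
lemma numWords_succ (K h : ℕ) (mem : Option Bool) (n : ℕ) :
    numWords K h mem (n + 1) = ∑ c : Bool × Bool, if StepOK K h mem c then
      numWords K (h + c.1.toNat - c.2.toNat) (if h = K then some c.1 else none) n else 0 := by
  let e : {w : Fin (n + 1) → Bool × Bool // GoodWord K h mem w} ≃
      Σ c : Bool × Bool, {w : Fin n → Bool × Bool // StepOK K h mem c ∧
        GoodWord K (h + c.1.toNat - c.2.toNat) (if h = K then some c.1 else none) w} :=
    { toFun := fun w => ⟨w.1 0, Fin.tail w.1, goodWord_cons.1 (by
        rw [Fin.cons_self_tail]; exact w.2)⟩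
      invFun := fun x => ⟨Fin.cons x.1 x.2.1, goodWord_cons.2 x.2.2⟩
      left_inv := fun w => Subtype.ext (Fin.cons_self_tail w.1)
      right_inv := fun x => rfl }
  rw [numWords, Nat.card_congr e, Nat.card_sigma]
  refine sum_congr rfl fun c _ => ?_
  by_cases hc : StepOK K h mem c
  · simp only [hc, true_and, numWords, if_true]
  · simp [hc]

section recurrences

variable {K : ℕ}

lemma numWords_bottom (hK : 2 ≤ K) (n : ℕ) :
    numWords K 0 none (n + 1) = numWords K 0 none n + numWords K 1 none n := by
  rw [numWords_succ]
  simp [Fintype.sum_prod_type, StepOK, show 0 ≠ K by omega, show 1 ≤ K by omega]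
  omega

lemma numWords_middle {h : ℕ} (hK : h + 2 ≤ K) (n : ℕ) :
    numWords K (h + 1) none (n + 1) = numWords K h none n + 2 * numWords K (h + 1) none n +
      numWords K (h + 2) none n := by
  rw [numWords_succ]
  simp [Fintype.sum_prod_type, StepOK, add_assoc, show h + 1 ≠ K by omega, show h + 1 ≤ K by omega,
    show h ≤ K by omega, hK]
  omega

lemma numWords_below_top (h n : ℕ) :
    numWords (h + 2) (h + 1) (some false) (n + 1) =
      numWords (h + 2) h none n + 2 * numWords (h + 2) (h + 1) none n := by
  rw [numWords_succ]
  simp [Fintype.sum_prod_type, StepOK, add_assoc]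
  omega

lemma numWords_top_none (h n : ℕ) :
    numWords (h + 2) (h + 2) none (n + 1) = numWords (h + 2) (h + 1) (some false) n +
      numWords (h + 2) (h + 2) (some true) n + numWords (h + 2) (h + 2) (some false) n := by
  rw [numWords_succ]
  simp [Fintype.sum_prod_type, StepOK, add_assoc]
  omega

lemma numWords_top_some (h n : ℕ) (q : Bool) :
    numWords (h + 2) (h + 2) (some q) (n + 1) = numWords (h + 2) (h + 1) (some false) n +
      numWords (h + 2) (h + 2) (some q) n := by
  rw [numWords_succ]
  cases q
  · simp [Fintype.sum_prod_type, StepOK, add_assoc]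
  · simp [Fintype.sum_prod_type, StepOK, add_assoc]
    omega

end recurrences

lemma Lgon_zero (k n : ℕ) : Lgon k n 0 = fgon k n := by simp [Lgon]

lemma Lgon_one (k n : ℕ) : Lgon k n 1 = fgon k n := by simp [Lgon, sum_range_succ]

lemma Lgon_add_two (k n s : ℕ) : Lgon k n (s + 2) = Lgon k n (s + 1) - Lgon k (n - 1) s := by
  have h1 : Lgon k n (s + 1) = ∑ j ∈ range (s + 3),
      (-1 : ℤ) ^ j * ((s + 1 - j).choose j : ℤ) * (fgon k (n - j) : ℤ) := by
    rw [Lgon, sum_range_succ _ (s + 2)]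
    simp
  rw [h1, Lgon, Lgon, sum_range_succ' _ (s + 2), sum_range_succ' _ (s + 2),
    sum_range_succ _ (s + 1), sum_range_succ _ (s + 1)]
  have h2 : ∀ j ∈ range (s + 1),
      (-1 : ℤ) ^ (j + 1) * ((s + 2 - (j + 1)).choose (j + 1) : ℤ) * (fgon k (n - (j + 1)) : ℤ) =
      (-1 : ℤ) ^ (j + 1) * ((s + 1 - (j + 1)).choose (j + 1) : ℤ) * (fgon k (n - (j + 1)) : ℤ) -
      (-1 : ℤ) ^ j * ((s - j).choose j : ℤ) * (fgon k (n - 1 - j) : ℤ) := by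
    intro j hj
    rw [mem_range] at hj
    rw [show s + 2 - (j + 1) = (s - j) + 1 by omega, Nat.choose_succ_succ,
      show s + 1 - (j + 1) = s - j by omega, show n - (j + 1) = n - 1 - j by omega]
    push_cast
    ring
  rw [sum_congr rfl h2, sum_sub_distrib]
  simp
  ring

lemma Lgon_add_four (k n s : ℕ) : Lgon k n (s + 4) =
    Lgon k n (s + 2) - 2 * Lgon k (n - 1) (s + 2) - Lgon k (n - 2) s := by
  have h1 := Lgon_add_two k n (s + 2)
  have h2 := Lgon_add_two k n (s + 1)
  have h3 := Lgon_add_two k (n - 1) s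
  rw [Nat.sub_sub] at h3
  linarith

section solve

variable {k m : ℕ}

lemma numWords_eq_Lgon (hf : ∀ n, numWords (m + 2) 0 none n = fgon k n)
    (h : ℕ) (hm : h ≤ m + 1) (n : ℕ) :
    (numWords (m + 2) h none n : ℤ) = Lgon k (n + h) (2 * h) := by
  induction h using Nat.strong_induction_on generalizing n with
  | _ h ih =>
    match h with
    | 0 => rw [Lgon_zero, hf]; rfl
    | 1 =>
      have h1 := numWords_bottom (K := m + 2) (by omega) n
      have h2 := Lgon_add_two k (n + 1) 0
      rw [hf, hf] at h1
      rw [Lgon_zero, zero_add, Lgon_one] at h2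
      rw [mul_one, h2, h1]
      simp
    | h + 2 =>
      have h1 := numWords_middle (K := m + 2) (h := h) (by omega) n
      zify at h1
      rw [ih (h + 1) (by omega) (by omega), ih (h + 1) (by omega) (by omega),
        ih h (by omega) (by omega)] at h1
      have h2 := Lgon_add_four k (n + (h + 2)) (2 * h)
      rw [show n + (h + 2) - 1 = n + (h + 1) by omega, show n + (h + 2) - 2 = n + h by omega] at h2
      rw [show n + 1 + (h + 1) = n + (h + 2) by omega, show 2 * (h + 1) = 2 * h + 2 by ring] at h1
      rw [show 2 * (h + 2) = 2 * h + 4 by ring]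
      linarith

lemma Lgon_recurrence_aux (hf : ∀ n, numWords (m + 2) 0 none n = fgon k n) (n : ℕ) :
    Lgon k (n + (m + 5)) (2 * m + 4) = Lgon k (n + (m + 4)) (2 * m + 4) +
      Lgon k (n + (m + 2)) (2 * m + 1) + Lgon k (n + (m + 2)) (2 * m + 2) +
      Lgon k (n + (m + 1)) (2 * m + 1) + Lgon k (n + (m + 1)) (2 * m + 2) := by
  have hmid (n) := numWords_eq_Lgon hf (m + 1) le_rfl n
  have hlow (n) := numWords_eq_Lgon hf m (by omega) n
  have hbelow (n) : (numWords (m + 2) (m + 1) (some false) (n + 1) : ℤ) =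
      Lgon k (n + (m + 1)) (2 * m + 1) + Lgon k (n + (m + 1)) (2 * m + 2) := by
    have h1 := numWords_below_top m n
    zify at h1
    rw [hmid, hlow] at h1
    have h2 := Lgon_add_two k (n + (m + 1)) (2 * m)
    rw [show n + (m + 1) - 1 = n + m by omega] at h2
    rw [show 2 * (m + 1) = 2 * m + 2 by ring] at h1
    linarith
  have htop (n) : (numWords (m + 2) (m + 2) none n : ℤ) = Lgon k (n + (m + 2)) (2 * m + 4) := by
    have h1 := numWords_middle (K := m + 2) le_rfl n
    zify at h1
    rw [hmid, hmid, hlow] at h1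
    have h2 := Lgon_add_four k (n + (m + 2)) (2 * m)
    rw [show n + (m + 2) - 1 = n + (m + 1) by omega, show n + (m + 2) - 2 = n + m by omega] at h2
    rw [show n + 1 + (m + 1) = n + (m + 2) by omega, show 2 * (m + 1) = 2 * m + 2 by ring] at h1
    linarith
  have e1 := numWords_top_none m (n + 2)
  have e2 := numWords_top_none m (n + 1)
  have e3 := numWords_top_some m (n + 1) true
  have e4 := numWords_top_some m (n + 1) false
  have b1 := hbelow (n + 1)
  have b0 := hbelow n
  zify at e1 e2 e3 e4
  rw [htop, show n + 2 + 1 + (m + 2) = n + (m + 5) by omega] at e1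
  rw [htop, show n + 1 + 1 + (m + 2) = n + (m + 4) by omega] at e2
  rw [show n + 1 + (m + 1) = n + (m + 2) by omega] at b1
  rw [show n + 1 + 1 = n + 2 by omega] at *
  linarith

end solve

section pattern

variable {n k : ℕ} {π : Equiv.Perm (Fin n)}

lemma containsPattern_gonPattern_iff {a : ℕ} {sep : Bool} (hk : 3 ≤ k) (ha : a = k ∨ a = k + 1) :
    ContainsPattern π (gonPattern k a sep) ↔ ∃ g : ℕ → Fin n,
      (gonPattern k a sep).Pairwise fun x y => g x < g y ∧ (x < y ↔ π (g x) < π (g y)) := by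
  refine containsPattern_iff ?_ (by simp [gonPattern])
  exact (pairwise_gonPattern hk ha).2 ⟨fun x y _ _ _ _ => by omega, fun x y _ _ _ _ _ => by omega,
    fun x y _ _ _ _ _ _ => by omega, fun _ => by omega⟩

lemma hasGrid_of_containsPattern {a : ℕ} {sep : Bool} (hk : 3 ≤ k) (ha : a = k ∨ a = k + 1)
    (h : ContainsPattern π (gonPattern k a sep)) : HasGrid k π := by
  obtain ⟨g, hg⟩ := (containsPattern_gonPattern_iff hk ha).1 h
  obtain ⟨hu, hl, hul, -⟩ := (pairwise_gonPattern hk ha).1 hg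
  refine ⟨fun i => g (if i = 0 then a else k + 1 + i),
    fun j => g (if j + 1 < a then j + 1 else j + 2),
    fun i j hij hj => ?_, fun i j hij hj => ?_, fun i j hi hj e1 e2 => ?_⟩
  · dsimp only
    have hlt : (if i = 0 then a else k + 1 + i) < if j = 0 then a else k + 1 + j := by
      split_ifs <;> omega
    have := hu _ _ (by split_ifs <;> omega) hlt (by split_ifs <;> omega) (by split_ifs <;> omega)
    exact ⟨this.1, this.2.1 hlt⟩
  · dsimp only
    have hlt : (if i + 1 < a then i + 1 else i + 2) < if j + 1 < a then j + 1 else j + 2 := by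
      split_ifs <;> omega
    have := hl _ _ (by split_ifs <;> omega) (by split_ifs <;> omega) hlt (by split_ifs <;> omega)
      (by split_ifs <;> omega)
    exact ⟨this.1, this.2.1 hlt⟩
  · dsimp only
    have hlt : ¬(if i = 0 then a else k + 1 + i) < if j + 1 < a then j + 1 else j + 2 := by
      split_ifs <;> omega
    have := hul (if i = 0 then a else k + 1 + i) (if j + 1 < a then j + 1 else j + 2)
      (by split_ifs <;> omega) (by split_ifs <;> omega) (by split_ifs <;> omega)
      (by split_ifs <;> omega) (by split_ifs <;> omega) (by right; split_ifs <;> omega)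
    refine ⟨this.1, lt_of_le_of_ne (not_lt.1 (this.2.not.1 hlt)) fun e => ?_⟩
    exact this.1.ne' (π.injective e)

lemma containsPattern_of_hasGrid (hk : 3 ≤ k) (h : HasGrid k π) :
    ∃ a sep, (a = k ∨ a = k + 1) ∧ ContainsPattern π (gonPattern k a sep) := by
  obtain ⟨u, l, hu, hl, hul⟩ := h
  obtain ⟨a, ha, hak, hak'⟩ : ∃ a, (a = k ∨ a = k + 1) ∧ (a = k → π (u 0) < π (l (k - 1))) ∧
      (a = k + 1 → π (l (k - 1)) < π (u 0)) := by
    by_cases hlt : π (u 0) < π (l (k - 1))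
    · exact ⟨k, by omega, fun _ => hlt, by omega⟩
    · refine ⟨k + 1, by omega, by omega, fun _ => lt_of_le_of_ne (not_lt.1 hlt) fun e => ?_⟩
      have h1 := (hul 0 0 (by omega) (by omega) (by omega) (by omega)).1
      have h2 := (hl 0 (k - 1) (by omega) (by omega)).1
      exact (h1.trans h2).ne' (π.injective e)
  obtain ⟨sep, hsep, hsep'⟩ : ∃ sep : Bool, (sep = true → l 0 < u (k - 1)) ∧
      (sep = false → u (k - 1) < l 0) := by
    by_cases hlt : l 0 < u (k - 1)
    · exact ⟨true, fun _ => hlt, by simp⟩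
    · refine ⟨false, by simp, fun _ => lt_of_le_of_ne (not_lt.1 hlt) fun e => ?_⟩
      have h1 := (hul (k - 1) 1 (by omega) (by omega) (by omega) (by omega)).2
      have h2 := (hl 0 1 (by omega) (by omega)).2
      rw [e] at h1
      exact h1.asymm h2
  have hval : π (l 0) < π (u (k - 1)) :=
    (hul 0 0 (by omega) (by omega) (by omega) (by omega)).2.trans
      (hu 0 (k - 1) (by omega) (by omega)).2
  have hpos : u 0 < l (k - 1) :=
    (hul 0 0 (by omega) (by omega) (by omega) (by omega)).1.trans
      (hl 0 (k - 1) (by omega) (by omega)).1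
  let g : ℕ → Fin n := fun x => if x = a then u 0 else if k + 2 ≤ x then u (x - k - 1) else
    if x < a then l (x - 1) else l (x - 2)
  have gu : ∀ x, (x = a ∨ k + 2 ≤ x) → g x = u (if x = a then 0 else x - k - 1) := by
    intro x hx
    simp only [g]
    split_ifs <;> first | rfl | omega
  have gl : ∀ x, x ≠ a → x ≤ k + 1 → g x = l (if x < a then x - 1 else x - 2) := by
    intro x hx hx'
    simp only [g]
    split_ifs <;> first | rfl | omega
  refine ⟨a, sep, ha, (containsPattern_gonPattern_iff hk ha).2 ⟨g, (pairwise_gonPattern hk ha).2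
    ⟨fun x y hx hxy hy hy2 => ?_, fun x y hx1 hxa hxy hya hy => ?_,
      fun x y hx hx2 hy1 hya hy hs => ?_, fun hs => ?_⟩⟩⟩
  · rw [gu x hx, gu y hy]
    have := hu (if x = a then 0 else x - k - 1) (if y = a then 0 else y - k - 1)
      (by split_ifs <;> omega) (by split_ifs <;> omega)
    exact ⟨this.1, iff_of_true hxy this.2⟩
  · rw [gl x hxa (by omega), gl y hya hy]
    have := hl (if x < a then x - 1 else x - 2) (if y < a then y - 1 else y - 2)
      (by split_ifs <;> omega) (by split_ifs <;> omega)
    exact ⟨this.1, iff_of_true hxy this.2⟩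
  · by_cases hc : x = k ∧ y = k + 1
    · rw [gu x hx, gl y hya hy, if_pos (by omega), if_neg (by omega),
        show y - 2 = k - 1 by omega]
      exact ⟨hpos, iff_of_true (by omega) (hak (by omega))⟩
    have hyx : ¬x < y := by omega
    by_cases hc1 : x = a ∧ k ≤ y
    · rw [gu x hx, gl y hya hy, if_pos hc1.1, if_pos (by omega), show y - 1 = k - 1 by omega]
      exact ⟨hpos, iff_of_false hyx (hak' (by omega)).asymm⟩
    by_cases hc2 : x = 2 * k ∧ y = 1
    · rw [gu x hx, gl y hya hy, if_neg (by omega), if_pos (by omega),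
        show x - k - 1 = k - 1 by omega, show y - 1 = 0 by omega]
      refine ⟨hsep' ?_, iff_of_false hyx hval.asymm⟩
      rcases hs with hs | hs
      · exact hs
      · omega
    · rw [gu x hx, gl y hya hy]
      have := hul (if x = a then 0 else x - k - 1) (if y < a then y - 1 else y - 2)
        (by split_ifs <;> omega) (by split_ifs <;> omega) (by split_ifs <;> omega)
        (by split_ifs <;> omega)
      exact ⟨this.1, iff_of_false hyx this.2.asymm⟩
  · rw [gl 1 (by omega) (by omega), gu (2 * k) (by omega), if_pos (by omega), if_neg (by omega),
      show 2 * k - k - 1 = k - 1 by omega]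
    exact ⟨hsep hs, iff_of_true (by omega) hval⟩

lemma avoids321Gon_iff (hk : 3 ≤ k) :
    Avoids321Gon k π ↔ AvoidsPattern π [3, 2, 1] ∧ ¬HasGrid k π := by
  refine and_congr_right fun _ => ⟨?_, fun h => ?_⟩
  · rintro ⟨h1, h2, h3, h4⟩ h
    obtain ⟨a, sep, rfl | rfl, hc⟩ := containsPattern_of_hasGrid hk h <;> cases sep
    · exact h2 hc
    · exact h1 hc
    · exact h4 hc
    · exact h3 hc
  · have key {a sep} (ha : a = k ∨ a = k + 1) : AvoidsPattern π (gonPattern k a sep) :=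
      fun hc => h (hasGrid_of_containsPattern hk ha hc)
    exact ⟨key (by simp), key (by simp), key (by simp), key (by simp)⟩

end pattern

section word

variable {n : ℕ}

lemma goodWord_iff {K : ℕ} (hK : 2 ≤ K) {w : Fin n → Bool × Bool} {P V : Finset (Fin n)}
    (hP : ∀ x, x ∈ P ↔ (w x).1 = true) (hV : ∀ x, x ∈ V ↔ (w x).2 = true) :
    GoodWord K 0 none w ↔ #P = #V ∧ (∀ i < n, cnt V (i + 1) ≤ cnt P i) ∧
      ¬CountGrid (K + 1) P V := by
  have sP : ∀ x : Fin n, cnt P (x + 1) = cnt P x + (w x).1.toNat := fun x => by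
    rw [cnt_succ]
    simp only [hP]
    cases (w x).1 <;> rfl
  have sV : ∀ x : Fin n, cnt V (x + 1) = cnt V x + (w x).2.toNat := fun x => by
    rw [cnt_succ]
    simp only [hV]
    cases (w x).2 <;> rfl
  have toNat_inj : ∀ {a b : Bool}, a.toNat = b.toNat → a = b := fun {a b} h => by
    cases a <;> cases b <;> simp_all
  constructor
  · rintro ⟨H, h0, hn, hs, ht, -⟩
    have hH : ∀ i ≤ n, cnt P i = cnt V i + H i := by
      intro i hi
      induction i with
      | zero => simp [cnt_zero, h0]
      | succ i ih =>
        have h1 := sP ⟨i, hi⟩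
        have h2 := sV ⟨i, hi⟩
        have h3 := (hs ⟨i, hi⟩).1
        have := ih (by omega)
        simp only at h1 h2 h3
        omega
    have hle : ∀ i ≤ n, H i ≤ K := by
      intro i hi
      rcases i with _ | i
      · omega
      · exact (hs ⟨i, hi⟩).2.2
    refine ⟨?_, fun i hi => ?_, ?_⟩
    · rw [← cnt_self, ← cnt_self, hH n le_rfl, hn, add_zero]
    · have h2 := sV ⟨i, hi⟩
      have h3 := (hs ⟨i, hi⟩).2.1
      have h4 := hH i hi.le
      simp only at h2 h3
      cases hv : (w ⟨i, hi⟩).2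
      · simp only [hv, Bool.toNat_false] at h2
        omega
      · have := h3 hv
        simp only [hv, Bool.toNat_true] at h2
        omega
    · rintro ⟨s, i, hi, h1, h2, h3, h4⟩
      have e1 := hH i (by omega)
      have e2 := hH (i + 2) hi
      have b1 := hle i (by omega)
      have b2 := hle (i + 2) hi
      have ht' := ht i (by omega) (by omega) (by omega)
      have p1 := sP ⟨i, by omega⟩
      have p2 := sP ⟨i + 1, by omega⟩
      rw [ht'] at p1
      simp only [add_assoc, Nat.reduceAdd] at p1 p2
      omega
  · rintro ⟨hcard, hle, hgrid⟩
    have hle' : ∀ i ≤ n, cnt V i ≤ cnt P i := by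
      intro i hi
      rcases i with _ | i
      · simp [cnt_zero]
      · exact (hle i hi).trans (cnt_mono (Nat.le_succ i))
    have hend : cnt P n = cnt V n := by rw [cnt_self, cnt_self, hcard]
    refine ⟨fun i => cnt P i - cnt V i, by simp [cnt_zero], by simp [hend], fun i => ?_,
      fun i hi h1 h2 => ?_, by simp⟩
    · dsimp only
      have h1 := sP i
      have h2 := sV i
      have h3 := hle' i i.isLt.le
      have h4 := hle i i.isLt
      have h5 := hle' (i + 1) i.isLt
      refine ⟨by omega, fun hv => ?_, ?_⟩
      · rw [hv, Bool.toNat_true] at h2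
        omega
      · by_contra hlt
        have hi : i.val + 1 ≠ n := fun e => by
          rw [e] at hlt
          omega
        have p1 := cnt_le_add (S := V) (show i.val + 1 ≤ i + 2 by omega)
        have p2 := cnt_mono (S := P) (show i.val + 1 ≤ i + 2 by omega)
        have p3 := (w i).1.toNat_le
        exact hgrid ⟨cnt V (i + 1) + 1, i, by omega, by omega, by omega, by omega, by omega⟩
    · dsimp only at h1 h2
      by_contra hne
      have p1 := sP ⟨i, by omega⟩
      have p2 := sP ⟨i + 1, by omega⟩
      have q1 := hle' i (by omega)
      have q2 := hle' (i + 2) (by omega)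
      have c1 := (w ⟨i, by omega⟩).1.toNat_le
      have c2 := (w ⟨i + 1, hi⟩).1.toNat_le
      have c3 := mt toNat_inj hne
      simp only [add_assoc, Nat.reduceAdd] at p1 p2
      exact hgrid ⟨cnt V i + 1, i, by omega, by omega, by omega, by omega, by omega⟩

lemma numWords_eq_fgon {k : ℕ} (hk : 3 ≤ k) : numWords (k - 1) 0 none n = fgon k n := by
  have key : ∀ π : Equiv.Perm (Fin n), AvoidsPattern π [3, 2, 1] →
      (¬HasGrid k π ↔ GoodWord (k - 1) 0 none
        fun x => (decide (x ∈ exc π), decide (x ∈ excVal π))) := by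
    intro π h
    rw [goodWord_iff (P := exc π) (V := excVal π) (by omega) (by simp) (by simp),
      hasGrid_iff hk h, show k - 1 + 1 = k by omega]
    simp [card_excVal, cnt_excVal_succ_le]
  symm
  refine Nat.card_congr (Equiv.ofBijective (fun π => ⟨fun x =>
    (decide (x ∈ exc π.1), decide (x ∈ excVal π.1)), ?_⟩) ⟨?_, ?_⟩)
  · have := (avoids321Gon_iff hk).1 π.2
    exact (key π.1 this.1).1 this.2
  · intro π σ h
    simp only [Subtype.mk.injEq, funext_iff, Prod.mk.injEq, decide_eq_decide] at h
    exact Subtype.ext (perm_ext π.2.1 σ.2.1 (Finset.ext fun x => (h x).1)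
      (Finset.ext fun x => (h x).2))
  · rintro ⟨w, hw⟩
    obtain ⟨h1, h2, -⟩ := (goodWord_iff (P := ({x | (w x).1 = true} : Finset (Fin n)))
      (V := ({x | (w x).2 = true} : Finset (Fin n))) (by omega) (by simp) (by simp)).1 hw
    obtain ⟨π, hπ, hP, hV⟩ := exists_perm h1 h2
    have hword : (fun x => (decide (x ∈ exc π), decide (x ∈ excVal π))) = w := by
      funext x
      simp [hP, hV]
    exact ⟨⟨π, (avoids321Gon_iff hk).2 ⟨hπ, (key π hπ).2 (hword ▸ hw)⟩⟩, Subtype.ext hword⟩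

end word

end Gon

/-- For `k ≥ 3` and `n ≥ 2k`,
`L_n^k(2k−2) = L_{n−1}^k(2k−2) + L_{n−3}^k(2k−5) + L_{n−3}^k(2k−4) + L_{n−4}^k(2k−5) + L_{n−4}^k(2k−4)`. -/
theorem Lgon_recurrence (k n : ℕ) (hk : 3 ≤ k) (hn : 2 * k ≤ n) :
    Lgon k n (2*k - 2) =
      Lgon k (n-1) (2*k - 2) + Lgon k (n-3) (2*k - 5) + Lgon k (n-3) (2*k - 4) +
        Lgon k (n-4) (2*k - 5) + Lgon k (n-4) (2*k - 4) := by
  obtain ⟨m, rfl⟩ : ∃ m, k = m + 3 := ⟨k - 3, by omega⟩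
  obtain ⟨r, rfl⟩ : ∃ r, n = r + (m + 5) := ⟨n - (m + 5), by omega⟩
  have h := Gon.Lgon_recurrence_aux (k := m + 3) (m := m)
    (fun n => Gon.numWords_eq_fgon (n := n) (k := m + 3) (by omega)) r
  rwa [show 2 * (m + 3) - 2 = 2 * m + 4 by omega, show 2 * (m + 3) - 5 = 2 * m + 1 by omega,
    show 2 * (m + 3) - 4 = 2 * m + 2 by omega, show r + (m + 5) - 1 = r + (m + 4) by omega,
    show r + (m + 5) - 3 = r + (m + 2) by omega, show r + (m + 5) - 4 = r + (m + 1) by omega]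
end

section
/- For every n ≥ 5, f_3(n) = 4·f_3(n−1) − 4·f_3(n−2) + 3·f_3(n−3) + f_3(n−4) − f_3(n−5). -/
/-- `f_3(n)`: the number of permutations of `{1,…,n}` avoiding `321` and every pattern
in `𝔓_3 = {351624, 356124, 451623, 456123}`. -/
noncomputable def f3 (n : ℕ) : ℕ :=
  Nat.card {π : Equiv.Perm (Fin n) //
    AvoidsPattern π [3,2,1] ∧ AvoidsPattern π [3,5,1,6,2,4] ∧ AvoidsPattern π [3,5,6,1,2,4] ∧
      AvoidsPattern π [4,5,1,6,2,3] ∧ AvoidsPattern π [4,5,6,1,2,3]}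


open Finset

/-! ### A two-parameter generating tree -/

/-- The first parameter of the `j`-th child (`1 ≤ j`) of a node whose second parameter is `b`. -/
def childLabel (b j : ℕ) : ℕ := if j ≤ max b 1 + 1 then j else max b 1

/-- The number of descendants at depth `d` of a node labelled `(m, b)`. -/
def treeCount : ℕ → ℕ → ℕ → ℕ
  | 0, _, _ => 1
  | d + 1, m, b =>
    treeCount d (m + 1) (b + 1) + ∑ j ∈ range m, treeCount d (childLabel b (j + 1)) 0

/-- The slope of the eventually affine function `m ↦ treeCount d m b`. -/
def treeSlope : ℕ → ℕ → ℕ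
  | 0, _ => 0
  | d + 1, b => treeSlope d (b + 1) + treeCount d (max b 1) 0

/-- The slope of the eventually affine function `b ↦ treeSlope d b`. -/
def slopeStep : ℕ → ℕ
  | 0 => 0
  | d + 1 => slopeStep d + treeSlope d 0

theorem treeCount_succ_left (d : ℕ) : ∀ {m b : ℕ}, max b 1 + 1 ≤ m →
    treeCount d (m + 1) b = treeCount d m b + treeSlope d b := by
  induction d with
  | zero => intros; rfl
  | succ d ih =>
    intro m b h
    have hlabel : childLabel b (m + 1) = max b 1 := if_neg (by omega)
    rw [treeCount, treeCount, treeSlope, sum_range_succ, ih (by omega), hlabel]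
    ring

theorem sum_childLabel {b m : ℕ} (h : m ≤ max b 1 + 1) (F : ℕ → ℕ) :
    ∑ j ∈ range m, F (childLabel b (j + 1)) = ∑ j ∈ range m, F (j + 1) := by
  refine sum_congr rfl fun j hj => ?_
  rw [mem_range] at hj
  rw [childLabel, if_pos (by omega)]

theorem treeCount_succ_self (d : ℕ) : ∀ b : ℕ,
    treeCount d (b + 1) b = treeCount d (b + 1) (b + 1) := by
  induction d with
  | zero => intros; rfl
  | succ d ih =>
    intro b
    rw [treeCount, treeCount, ih, sum_childLabel (by omega) (treeCount d · 0),
      sum_childLabel (by omega) (treeCount d · 0)]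

theorem treeCount_diag_succ (d : ℕ) : ∀ b : ℕ,
    treeCount d (b + 1) (b + 1) = treeCount d b b + treeSlope d (b + 1) := by
  induction d with
  | zero => intros; rfl
  | succ d ih =>
    intro b
    rw [treeCount, treeCount, treeSlope, ih, sum_childLabel (by omega) (treeCount d · 0),
      sum_childLabel (by omega) (treeCount d · 0), sum_range_succ, max_eq_left (by omega)]
    ring

theorem treeSlope_succ (d : ℕ) : ∀ {b : ℕ}, 2 ≤ b →
    treeSlope d (b + 1) = treeSlope d b + slopeStep d := by
  induction d with
  | zero => intros; rfl
  | succ d ih =>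
    intro b h
    rw [treeSlope, treeSlope, slopeStep, ih (by omega), max_eq_left (by omega), max_eq_left (by omega),
      treeCount_succ_left d (by omega)]
    ring

theorem treeCount_zero_eq (d : ℕ) : treeCount (d + 1) 0 0 = treeCount d 1 0 := by
  rw [treeCount, range_zero, sum_empty, treeCount_succ_self, add_zero]

theorem treeCount_one_succ (d : ℕ) :
    treeCount (d + 1) 1 0 = 2 * treeCount d 1 0 + treeSlope d 2 := by
  rw [treeCount, sum_childLabel (by omega) (treeCount d · 0), treeCount_succ_self,
    treeCount_diag_succ, ← treeCount_succ_self]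
  simp
  ring

theorem treeCount_two_succ (d : ℕ) :
    treeCount (d + 1) 2 0 = treeCount (d + 1) 1 0 + treeSlope d 1 + treeCount d 2 0 := by
  rw [treeCount, treeCount, sum_childLabel (by omega) (treeCount d · 0),
    sum_childLabel (by omega) (treeCount d · 0), sum_range_succ,
    treeCount_succ_left d (by omega)]
  ring

theorem treeCount_one_recurrence (d : ℕ) :
    (treeCount (d + 5) 1 0 : ℤ) = 4 * treeCount (d + 4) 1 0 - 4 * treeCount (d + 3) 1 0
      + 3 * treeCount (d + 2) 1 0 + treeCount (d + 1) 1 0 - treeCount d 1 0 := by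
  have hslope_two (k : ℕ) : treeSlope (k + 1) 2 = treeSlope k 2 + slopeStep k + treeCount k 2 0 := by
    rw [treeSlope, treeSlope_succ k le_rfl, max_eq_left (by omega)]
  have hstep (k : ℕ) : slopeStep (k + 1) = slopeStep k + treeSlope k 0 := rfl
  have hslope_zero (k : ℕ) : treeSlope (k + 1) 0 = treeSlope k 1 + treeCount k 1 0 := rfl
  have hslope_one (k : ℕ) : treeSlope (k + 1) 1 = treeSlope k 2 + treeCount k 1 0 := rfl
  have hone := treeCount_one_succ
  have htwo := treeCount_two_succ
  simp only [hone, hslope_two, hstep, hslope_zero, hslope_one, htwo]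
  push_cast
  ring

/-! ### Appending a last value to a permutation -/

/-- Append the value `v` to `σ`, raising by one the values of `σ` that are at least `v`. -/
def appendValue {n : ℕ} (v : Fin (n + 1)) (σ : Equiv.Perm (Fin n)) : Equiv.Perm (Fin (n + 1)) :=
  (finSuccEquiv' (Fin.last n)).trans ((Equiv.optionCongr σ).trans (finSuccEquiv' v).symm)

section appendValue

variable {n : ℕ} (v : Fin (n + 1)) (σ : Equiv.Perm (Fin n))

@[simp] theorem appendValue_last : appendValue v σ (Fin.last n) = v := by
  simp [appendValue]

@[simp] theorem appendValue_castSucc (i : Fin n) :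
    appendValue v σ i.castSucc = v.succAbove (σ i) := by
  simp [appendValue, finSuccEquiv'_last_apply_castSucc]

theorem succAbove_lt_iff_val (x : Fin n) : v.succAbove x < v ↔ (x : ℕ) < v := by
  rw [Fin.succAbove_lt_iff_castSucc_lt, Fin.lt_def, Fin.val_castSucc]

theorem lt_succAbove_iff_val (x : Fin n) : v < v.succAbove x ↔ (v : ℕ) ≤ x := by
  rw [Fin.lt_succAbove_iff_le_castSucc, Fin.le_def, Fin.val_castSucc]

theorem val_succAbove_of_lt {x : Fin n} (h : (x : ℕ) < v) : (v.succAbove x : ℕ) = x := by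
  rw [Fin.succAbove_of_castSucc_lt _ _ (by simpa [Fin.lt_def] using h), Fin.val_castSucc]

theorem val_succAbove_of_le {x : Fin n} (h : (v : ℕ) ≤ x) : (v.succAbove x : ℕ) = x + 1 := by
  rw [Fin.succAbove_of_le_castSucc _ _ (by simpa [Fin.le_def] using h), Fin.val_succ]

theorem exists_castSucc_of_lt {a b : Fin (n + 1)} (h : a < b) : ∃ c : Fin n, c.castSucc = a :=
  Fin.exists_castSucc_eq.2 (h.trans_le (Fin.le_last b)).ne

end appendValue

theorem appendValue_bijective (n : ℕ) : Function.Bijective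
    (fun x : Fin (n + 1) × Equiv.Perm (Fin n) => appendValue x.1 x.2) := by
  rw [Fintype.bijective_iff_injective_and_card]
  refine ⟨fun ⟨v, σ⟩ ⟨w, τ⟩ h => ?_, by simp [Fintype.card_perm, Nat.factorial_succ]⟩
  have hlast := DFunLike.congr_fun h (Fin.last n)
  simp only [appendValue_last] at hlast
  subst hlast
  refine Prod.ext rfl (Equiv.ext fun i => ?_)
  simpa using DFunLike.congr_fun h i.castSucc

/-! ### Avoidance conditions -/

/-- No `321` pattern. -/
def NoDecreasingTriple {n : ℕ} (σ : Equiv.Perm (Fin n)) : Prop :=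
  ∀ i j k, i < j → j < k → σ k < σ j → ¬ σ j < σ i

/-- Positions carrying the first five entries of one of the patterns in `𝔓_3`, where `p₂` and
`p₃` may come in either order. -/
def IsHexagonStart {n : ℕ} (σ : Equiv.Perm (Fin n)) (p₀ p₁ p₂ p₃ p₄ : Fin n) : Prop :=
  (p₀ < p₁ ∧ p₁ < p₂ ∧ p₁ < p₃ ∧ p₂ < p₄ ∧ p₃ < p₄) ∧
    σ p₂ < σ p₄ ∧ σ p₄ < σ p₀ ∧ σ p₀ < σ p₁ ∧ σ p₁ < σ p₃

/-- No pattern in `𝔓_3`. -/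
def NoHexagon {n : ℕ} (σ : Equiv.Perm (Fin n)) : Prop :=
  ∀ p₀ p₁ p₂ p₃ p₄ p₅, IsHexagonStart σ p₀ p₁ p₂ p₃ p₄ → p₄ < p₅ → σ p₄ < σ p₅ →
    ¬ σ p₅ < σ p₁

/-- The permutation avoids `321` and every pattern in `𝔓_3`. -/
def IsGood {n : ℕ} (σ : Equiv.Perm (Fin n)) : Prop := NoDecreasingTriple σ ∧ NoHexagon σ

/-- Appending the value `v` creates no forbidden pattern that ends in the new entry. -/
def CanAppend {n : ℕ} (σ : Equiv.Perm (Fin n)) (v : ℕ) : Prop :=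
  (∀ i k, i < k → σ k < σ i → (σ k : ℕ) < v) ∧
    ∀ p₀ p₁ p₂ p₃ p₄, IsHexagonStart σ p₀ p₁ p₂ p₃ p₄ → (σ p₄ : ℕ) < v → (σ p₁ : ℕ) < v

/-- Some inversion of `σ` has its larger value at least `a`. -/
def HasInversionAbove {n : ℕ} (σ : Equiv.Perm (Fin n)) (a : ℕ) : Prop :=
  ∃ i k, i < k ∧ σ k < σ i ∧ a ≤ σ i

/-- The node of the generating tree at `σ` is labelled `(m, b)`: exactly the `m + 1` largest values
can be appended, and exactly the `b` largest values are trailing fixed points. -/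
def HasLabel {n : ℕ} (σ : Equiv.Perm (Fin n)) (m b : ℕ) : Prop :=
  m ≤ n ∧ b ≤ n ∧ (∀ v ≤ n, CanAppend σ v ↔ n ≤ v + m) ∧
    ∀ a, HasInversionAbove σ a ↔ a + b < n

section transition

variable {n : ℕ} {v : Fin (n + 1)} {σ : Equiv.Perm (Fin n)}

theorem isHexagonStart_appendValue_castSucc {p₀ p₁ p₂ p₃ p₄ : Fin n} :
    IsHexagonStart (appendValue v σ) p₀.castSucc p₁.castSucc p₂.castSucc p₃.castSucc
      p₄.castSucc ↔ IsHexagonStart σ p₀ p₁ p₂ p₃ p₄ := by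
  simp [IsHexagonStart]

theorem isHexagonStart_appendValue_last {p₀ p₁ p₂ p₃ : Fin n} :
    IsHexagonStart (appendValue v σ) p₀.castSucc p₁.castSucc p₂.castSucc p₃.castSucc
      (Fin.last n) ↔ (p₀ < p₁ ∧ p₁ < p₂ ∧ p₁ < p₃) ∧
        (σ p₂ : ℕ) < v ∧ (v : ℕ) ≤ σ p₀ ∧ σ p₀ < σ p₁ ∧ σ p₁ < σ p₃ := by
  simp [IsHexagonStart, Fin.castSucc_lt_last, succAbove_lt_iff_val, lt_succAbove_iff_val]

theorem IsHexagonStart.exists_castSucc {π : Equiv.Perm (Fin (n + 1))}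
    {p₀ p₁ p₂ p₃ p₄ : Fin (n + 1)} (h : IsHexagonStart π p₀ p₁ p₂ p₃ p₄) :
    ∃ q₀ q₁ q₂ q₃ : Fin n, q₀.castSucc = p₀ ∧ q₁.castSucc = p₁ ∧ q₂.castSucc = p₂ ∧
      q₃.castSucc = p₃ := by
  obtain ⟨⟨h01, h12, -, h24, h34⟩, -⟩ := h
  obtain ⟨q₀, rfl⟩ := exists_castSucc_of_lt h01
  obtain ⟨q₁, rfl⟩ := exists_castSucc_of_lt h12
  obtain ⟨q₂, rfl⟩ := exists_castSucc_of_lt h24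
  obtain ⟨q₃, rfl⟩ := exists_castSucc_of_lt h34
  exact ⟨q₀, q₁, q₂, q₃, rfl, rfl, rfl, rfl⟩

theorem noDecreasingTriple_appendValue_iff : NoDecreasingTriple (appendValue v σ) ↔
    NoDecreasingTriple σ ∧ ∀ i k, i < k → σ k < σ i → (σ k : ℕ) < v := by
  constructor
  · refine fun h => ⟨fun i j k hij hjk hv hlt => ?_, fun i k hik hlt => ?_⟩
    · exact h i.castSucc j.castSucc k.castSucc (by simpa) (by simpa) (by simpa) (by simpa)
    · by_contra! hle
      exact h i.castSucc k.castSucc (Fin.last n) (by simpa) (Fin.castSucc_lt_last k)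
        (by simpa [lt_succAbove_iff_val]) (by simpa)
  · rintro ⟨h, hv⟩ i j k hij hjk hkj hji
    obtain ⟨i, rfl⟩ := exists_castSucc_of_lt hij
    obtain ⟨j, rfl⟩ := exists_castSucc_of_lt hjk
    simp only [Fin.castSucc_lt_castSucc_iff, appendValue_castSucc,
      Fin.succAbove_lt_succAbove_iff] at hij hji
    have hj := hv i j hij hji
    induction k using Fin.lastCases with
    | last =>
      simp only [appendValue_last, appendValue_castSucc, lt_succAbove_iff_val] at hkj
      omega
    | cast k =>
      simp only [Fin.castSucc_lt_castSucc_iff, appendValue_castSucc,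
        Fin.succAbove_lt_succAbove_iff] at hjk hkj
      exact h i j k hij hjk hkj hji

theorem noHexagon_appendValue_iff : NoHexagon (appendValue v σ) ↔ NoHexagon σ ∧
    ∀ p₀ p₁ p₂ p₃ p₄, IsHexagonStart σ p₀ p₁ p₂ p₃ p₄ → (σ p₄ : ℕ) < v → (σ p₁ : ℕ) < v := by
  constructor
  · refine fun h => ⟨fun p₀ p₁ p₂ p₃ p₄ p₅ hs h45 hv hlt => ?_, fun p₀ p₁ p₂ p₃ p₄ hs hlt => ?_⟩
    · exact h _ _ _ _ _ p₅.castSucc (isHexagonStart_appendValue_castSucc.2 hs) (by simpa)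
        (by simpa) (by simpa)
    · by_contra! hle
      exact h _ _ _ _ _ (Fin.last n) (isHexagonStart_appendValue_castSucc.2 hs)
        (Fin.castSucc_lt_last p₄) (by simpa [succAbove_lt_iff_val])
        (by simpa [lt_succAbove_iff_val])
  · rintro ⟨h, hv⟩ p₀ p₁ p₂ p₃ p₄ p₅ hs h45 hlt hlt'
    obtain ⟨p₀, p₁, p₂, p₃, rfl, rfl, rfl, rfl⟩ := hs.exists_castSucc
    obtain ⟨p₄, rfl⟩ := exists_castSucc_of_lt h45
    rw [isHexagonStart_appendValue_castSucc] at hs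
    induction p₅ using Fin.lastCases with
    | last =>
      simp only [appendValue_last, appendValue_castSucc, lt_succAbove_iff_val,
        succAbove_lt_iff_val] at hlt hlt'
      exact (hv _ _ _ _ _ hs hlt).not_ge hlt'
    | cast p₅ =>
      simp only [Fin.castSucc_lt_castSucc_iff, appendValue_castSucc,
        Fin.succAbove_lt_succAbove_iff] at h45 hlt hlt'
      exact h _ _ _ _ _ _ hs h45 hlt hlt'

theorem isGood_appendValue_iff : IsGood (appendValue v σ) ↔ IsGood σ ∧ CanAppend σ v := by
  rw [IsGood, IsGood, CanAppend, noDecreasingTriple_appendValue_iff, noHexagon_appendValue_iff]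
  tauto

theorem hasInversionAbove_appendValue_last_iff (a : ℕ) :
    HasInversionAbove (appendValue (Fin.last n) σ) a ↔ HasInversionAbove σ a := by
  constructor
  · rintro ⟨i, k, hik, hlt, ha⟩
    obtain ⟨i, rfl⟩ := exists_castSucc_of_lt hik
    induction k using Fin.lastCases with
    | last => simp [Fin.lt_def] at hlt; omega
    | cast k => exact ⟨i, k, by simpa using hik, by simpa using hlt, by simpa using ha⟩
  · rintro ⟨i, k, hik, hlt, ha⟩
    exact ⟨i.castSucc, k.castSucc, by simpa, by simpa, by simpa⟩

theorem canAppend_appendValue_last_iff (w : ℕ) :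
    CanAppend (appendValue (Fin.last n) σ) w ↔ CanAppend σ w := by
  constructor
  · refine fun h => ⟨fun i k hik hlt => ?_, fun p₀ p₁ p₂ p₃ p₄ hs hlt => ?_⟩
    · simpa using h.1 i.castSucc k.castSucc (by simpa) (by simpa)
    · simpa using h.2 _ _ _ _ _ (isHexagonStart_appendValue_castSucc.2 hs) (by simpa)
  · refine fun h => ⟨fun i k hik hlt => ?_, fun p₀ p₁ p₂ p₃ p₄ hs hlt => ?_⟩
    · obtain ⟨i, rfl⟩ := exists_castSucc_of_lt hik
      induction k using Fin.lastCases with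
      | last => simp [Fin.lt_def] at hlt; omega
      | cast k => simpa using h.1 i k (by simpa using hik) (by simpa using hlt)
    · obtain ⟨p₀, p₁, p₂, p₃, rfl, rfl, rfl, rfl⟩ := hs.exists_castSucc
      induction p₄ using Fin.lastCases with
      | last =>
        have := (isHexagonStart_appendValue_last.1 hs).2.2.1
        simp at this
        omega
      | cast p₄ =>
        rw [isHexagonStart_appendValue_castSucc] at hs
        simpa using h.2 _ _ _ _ _ hs (by simpa using hlt)

theorem HasLabel.appendValue_last {m b : ℕ} (h : HasLabel σ m b) :
    HasLabel (appendValue (Fin.last n) σ) (m + 1) (b + 1) := by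
  obtain ⟨hm, hb, hA, hI⟩ := h
  refine ⟨by omega, by omega, fun w hw => ?_, fun a => ?_⟩
  · rw [canAppend_appendValue_last_iff]
    rcases hw.lt_or_eq with hw | rfl
    · rw [hA w (by omega)]
      omega
    · refine iff_of_true ⟨fun _ k _ _ => ?_, fun _ p₁ _ _ _ _ _ => ?_⟩ (by omega) <;> omega
  · rw [hasInversionAbove_appendValue_last_iff, hI]
    omega

theorem hasInversionAbove_appendValue_iff (hv : (v : ℕ) < n) (a : ℕ) :
    HasInversionAbove (appendValue v σ) a ↔ a < n + 1 := by
  refine ⟨fun ⟨i, _, _, _, ha⟩ => ha.trans_lt (Fin.is_lt _), fun ha => ?_⟩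
  have hle : (v : ℕ) ≤ (⟨n - 1, by omega⟩ : Fin n) := by simp only; omega
  refine ⟨(σ.symm ⟨n - 1, by omega⟩).castSucc, Fin.last n, Fin.castSucc_lt_last _, ?_, ?_⟩
  · simpa [lt_succAbove_iff_val] using hle
  · rw [appendValue_castSucc, Equiv.apply_symm_apply, val_succAbove_of_le _ hle]
    simp only
    omega

theorem canAppend_appendValue_iff {b : ℕ} (hA : CanAppend σ v) (hv : (v : ℕ) < n)
    (hI : ∀ a, HasInversionAbove σ a ↔ a + b < n) (w : ℕ) :
    CanAppend (appendValue v σ) w ↔ (v : ℕ) < w ∧ n ≤ max (w - 1) (v + 1) + max b 1 := by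
  have hmono {x y : Fin n} (hx : (v : ℕ) ≤ x) (hxy : x < y) : σ.symm x < σ.symm y := by
    by_contra! hle
    have hne : σ.symm y ≠ σ.symm x := by simpa using hxy.ne'
    have := hA.1 _ _ (lt_of_le_of_ne hle hne) (by simpa using hxy)
    rw [Equiv.apply_symm_apply] at this
    omega
  constructor
  · intro h
    have hvw : (v : ℕ) < w := by
      have := h.1 (σ.symm ⟨n - 1, by omega⟩).castSucc (Fin.last n) (Fin.castSucc_lt_last _)
        (by simp [lt_succAbove_iff_val]; omega)
      simpa using this
    refine ⟨hvw, ?_⟩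
    by_contra! hlt
    obtain ⟨a, ha⟩ : ∃ a, a = max (w - 1) (v + 1) := ⟨_, rfl⟩
    obtain ⟨i, k, hik, hki, hai⟩ := (hI a).2 (by omega)
    have hk := hA.1 i k hik hki
    have hpi : σ.symm ⟨a, by omega⟩ ≤ i := by
      rcases hai.eq_or_lt with heq | hlt'
      · exact ((Equiv.symm_apply_eq σ).2 (Fin.ext heq)).le
      · simpa using (hmono (x := ⟨a, by omega⟩) (y := σ i) (by simp only; omega)
          (by simpa [Fin.lt_def])).le
    have hs : IsHexagonStart (appendValue v σ) (σ.symm ⟨v, hv⟩).castSucc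
        (σ.symm ⟨a, by omega⟩).castSucc k.castSucc (σ.symm ⟨n - 1, by omega⟩).castSucc
        (Fin.last n) := by
      refine isHexagonStart_appendValue_last.2 ⟨⟨hmono le_rfl ?_, hpi.trans_lt hik,
        hmono ?_ ?_⟩, hk, ?_, ?_, ?_⟩ <;> simp [Fin.lt_def] <;> omega
    have := h.2 _ _ _ _ _ hs (by simpa using hvw)
    rw [appendValue_castSucc, Equiv.apply_symm_apply,
      val_succAbove_of_le _ (by simp only; omega)] at this
    simp only at this
    omega
  · rintro ⟨hvw, hle⟩
    refine ⟨fun i k hik hlt => ?_, fun p₀ p₁ p₂ p₃ p₄ hs hlt => ?_⟩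
    · obtain ⟨i, rfl⟩ := exists_castSucc_of_lt hik
      induction k using Fin.lastCases with
      | last => simpa using hvw
      | cast k =>
        have := hA.1 i k (by simpa using hik) (by simpa using hlt)
        rw [appendValue_castSucc, val_succAbove_of_lt _ this]
        omega
    · obtain ⟨p₀, p₁, p₂, p₃, rfl, rfl, rfl, rfl⟩ := hs.exists_castSucc
      induction p₄ using Fin.lastCases with
      | last =>
        obtain ⟨⟨h01, h12, h13⟩, h2, h0, h01', h13'⟩ := isHexagonStart_appendValue_last.1 hs
        rw [Fin.lt_def] at h01' h13'
        rw [appendValue_castSucc, val_succAbove_of_le _ (by omega)]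
        by_contra! hge
        have := (hI (max (w - 1) (v + 1))).1 ⟨p₁, p₂, h12, by rw [Fin.lt_def]; omega, by omega⟩
        have := (σ p₃).is_lt
        omega
      | cast p₄ =>
        rw [isHexagonStart_appendValue_castSucc] at hs
        have h4 := hA.1 p₀ p₄ (hs.1.1.trans (hs.1.2.1.trans hs.1.2.2.2.1)) hs.2.2.1
        have h1 := hA.2 _ _ _ _ _ hs h4
        rw [appendValue_castSucc, val_succAbove_of_lt _ h1]
        omega

theorem HasLabel.appendValue {m b : ℕ} (h : HasLabel σ m b) (hA : CanAppend σ v)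
    (hv : (v : ℕ) < n) : HasLabel (appendValue v σ) (childLabel b (n - v)) 0 := by
  have hc : childLabel b (n - v) = if n - v ≤ max b 1 + 1 then n - v else max b 1 := rfl
  refine ⟨by split_ifs at hc <;> omega, by omega, fun w hw => ?_, fun a => ?_⟩
  · rw [canAppend_appendValue_iff hA hv h.2.2.2]
    split_ifs at hc <;> omega
  · exact hasInversionAbove_appendValue_iff hv a

theorem HasLabel.unique {m b m' b' : ℕ} (h : HasLabel σ m b) (h' : HasLabel σ m' b') :
    m = m' ∧ b = b' := by
  obtain ⟨hm, hb, hA, hI⟩ := h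
  obtain ⟨hm', hb', hA', hI'⟩ := h'
  have h₁ := (hA (n - m) (by omega)).symm.trans (hA' (n - m) (by omega))
  have h₂ := (hA (n - m') (by omega)).symm.trans (hA' (n - m') (by omega))
  have h₃ := (hI (n - b)).symm.trans (hI' (n - b))
  have h₄ := (hI (n - b')).symm.trans (hI' (n - b'))
  omega

end transition

theorem IsGood.exists_hasLabel : ∀ {n : ℕ} {σ : Equiv.Perm (Fin n)}, IsGood σ →
    ∃ l : ℕ × ℕ, HasLabel σ l.1 l.2
  | 0, σ, _ => ⟨(0, 0), le_rfl, le_rfl,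
      fun _ _ => iff_of_true ⟨fun i => i.elim0, fun i => i.elim0⟩ (by omega),
      fun _ => iff_of_false (fun ⟨i, _⟩ => i.elim0) (by omega)⟩
  | n + 1, π, h => by
    obtain ⟨⟨v, σ⟩, rfl⟩ := (appendValue_bijective n).2 π
    obtain ⟨hσ, hv⟩ := isGood_appendValue_iff.1 h
    obtain ⟨l, hl⟩ := hσ.exists_hasLabel
    rcases (Nat.lt_succ_iff.1 v.is_lt).lt_or_eq with hlt | heq
    · exact ⟨(_, _), hl.appendValue hv hlt⟩
    · obtain rfl : v = Fin.last n := Fin.ext heq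
      exact ⟨(_, _), hl.appendValue_last⟩

open Classical in
/-- The label of the node of the generating tree at `σ`. -/
noncomputable def nodeLabel {n : ℕ} (σ : Equiv.Perm (Fin n)) : ℕ × ℕ :=
  if h : ∃ l : ℕ × ℕ, HasLabel σ l.1 l.2 then h.choose else 0

theorem HasLabel.nodeLabel_eq {n : ℕ} {σ : Equiv.Perm (Fin n)} {m b : ℕ}
    (h : HasLabel σ m b) : nodeLabel σ = (m, b) := by
  have hex : ∃ l : ℕ × ℕ, HasLabel σ l.1 l.2 := ⟨(m, b), h⟩
  rw [nodeLabel, dif_pos hex]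
  have := hex.choose_spec.unique h
  exact Prod.ext this.1 this.2

open Classical in
theorem sum_appendValue {n d : ℕ} {σ : Equiv.Perm (Fin n)} (hσ : IsGood σ) :
    (∑ v : Fin (n + 1), if IsGood (appendValue v σ) then
      treeCount d (nodeLabel (appendValue v σ)).1 (nodeLabel (appendValue v σ)).2 else 0) =
    treeCount (d + 1) (nodeLabel σ).1 (nodeLabel σ).2 := by
  obtain ⟨⟨m, b⟩, hl⟩ := hσ.exists_hasLabel
  simp only at hl
  obtain ⟨F, hF⟩ : ∃ F : ℕ → ℕ, ∀ j, F j = if j = 0 then treeCount d (m + 1) (b + 1) else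
      if j ≤ m then treeCount d (childLabel b j) 0 else 0 := ⟨_, fun _ => rfl⟩
  have hterm (v : Fin (n + 1)) : (if IsGood (appendValue v σ) then
      treeCount d (nodeLabel (appendValue v σ)).1 (nodeLabel (appendValue v σ)).2 else 0) =
      F (n + 1 - 1 - (v : ℕ)) := by
    have hiff := hl.2.2.1 v (by omega)
    simp only [isGood_appendValue_iff, hσ, true_and, Nat.add_sub_cancel, hF]
    rcases (Nat.lt_succ_iff.1 v.is_lt).lt_or_eq with hlt | heq
    · rw [if_neg (by omega : ¬ n - (v : ℕ) = 0)]
      by_cases hv : CanAppend σ v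
      · rw [if_pos hv, if_pos (by have := hiff.1 hv; omega), (hl.appendValue hv hlt).nodeLabel_eq]
      · rw [if_neg hv, if_neg (by rw [hiff] at hv; omega)]
    · obtain rfl : v = Fin.last n := Fin.ext heq
      rw [if_pos (hiff.2 (by simp)), if_pos (by simp), hl.appendValue_last.nodeLabel_eq]
  rw [sum_congr rfl fun v _ => hterm v, Fin.sum_univ_eq_sum_range
    (fun k => F (n + 1 - 1 - k)),
    sum_range_reflect, sum_range_succ', hl.nodeLabel_eq, treeCount, add_comm, hF 0,
    if_pos rfl]
  congr 1
  have hm := hl.1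
  rw [← sum_subset (range_subset_range.2 hm)]
  · refine sum_congr rfl fun j hj => ?_
    rw [mem_range] at hj
    rw [hF, if_neg (by omega), if_pos (by omega)]
  · intro j _ hj
    rw [mem_range] at hj
    rw [hF, if_neg (by omega), if_neg (by omega)]

open Classical in
theorem sum_treeCount (d : ℕ) : ∀ n : ℕ,
    (∑ π : Equiv.Perm (Fin (n + d)), if IsGood π then 1 else 0) =
    ∑ σ : Equiv.Perm (Fin n),
      if IsGood σ then treeCount d (nodeLabel σ).1 (nodeLabel σ).2 else 0 := by
  induction d with
  | zero => intro n; rfl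
  | succ d ih =>
    intro n
    rw [show n + (d + 1) = n + 1 + d by omega, ih,
      ← (appendValue_bijective n).sum_comp, Fintype.sum_prod_type_right]
    refine sum_congr rfl fun σ _ => ?_
    by_cases hσ : IsGood σ
    · rw [if_pos hσ, ← sum_appendValue hσ]
    · simp [isGood_appendValue_iff, hσ]

/-! ### Translation to pattern avoidance -/

theorem containsPattern_three {n : ℕ} (π : Equiv.Perm (Fin n)) :
    ContainsPattern π [3, 2, 1] ↔ ∃ i j k, i < j ∧ j < k ∧ π k < π j ∧ π j < π i := by
  constructor
  · rintro ⟨f, hf, h⟩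
    exact ⟨f (0 : Fin 3), f (1 : Fin 3), f (2 : Fin 3), hf (by decide), hf (by decide),
      (h (2 : Fin 3) (1 : Fin 3)).1 (by decide), (h (1 : Fin 3) (0 : Fin 3)).1 (by decide)⟩
  · rintro ⟨i, j, k, hij, hjk, hkj, hji⟩
    refine ⟨(![i, j, k] : Fin 3 → Fin n), Fin.strictMono_iff_lt_succ.2 ?_, ?_⟩
    · simp [Fin.forall_fin_succ, hij, hjk]
    · simp [Fin.forall_fin_succ, hkj, hji, hkj.le, hji.le, hkj.trans hji, (hkj.trans hji).le]

theorem noDecreasingTriple_iff {n : ℕ} (π : Equiv.Perm (Fin n)) :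
    NoDecreasingTriple π ↔ AvoidsPattern π [3, 2, 1] := by
  rw [AvoidsPattern, containsPattern_three]
  exact ⟨fun h ⟨i, j, k, hij, hjk, hkj, hji⟩ => h i j k hij hjk hkj hji,
    fun h i j k hij hjk hkj hji => h ⟨i, j, k, hij, hjk, hkj, hji⟩⟩

theorem containsPattern_of_isHexagonStart {n : ℕ} {π : Equiv.Perm (Fin n)}
    {p₀ p₁ p₂ p₃ p₄ p₅ : Fin n} (hs : IsHexagonStart π p₀ p₁ p₂ p₃ p₄) (h45 : p₄ < p₅)
    (hv45 : π p₄ < π p₅) (hv51 : π p₅ < π p₁) :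
    ContainsPattern π [3, 5, 1, 6, 2, 4] ∨ ContainsPattern π [3, 5, 6, 1, 2, 4] ∨
      ContainsPattern π [4, 5, 1, 6, 2, 3] ∨ ContainsPattern π [4, 5, 6, 1, 2, 3] := by
  obtain ⟨⟨h01, h12, h13, h24, h34⟩, hv24, hv40, hv01, hv13⟩ := hs
  have hne : p₂ ≠ p₃ := by rintro rfl; order
  have hvne : π p₀ ≠ π p₅ := π.injective.ne (by order)
  rcases hne.lt_or_gt with h23 | h32 <;> rcases hvne.lt_or_gt with hv | hv
  · refine Or.inl ⟨(![p₀, p₁, p₂, p₃, p₄, p₅] : Fin 6 → Fin n),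
      Fin.strictMono_iff_lt_succ.2 ?_, ?_⟩ <;>
    simp [Fin.forall_fin_succ] <;> omega
  · refine Or.inr (Or.inr (Or.inl ⟨(![p₀, p₁, p₂, p₃, p₄, p₅] : Fin 6 → Fin n),
      Fin.strictMono_iff_lt_succ.2 ?_, ?_⟩)) <;>
    simp [Fin.forall_fin_succ] <;> omega
  · refine Or.inr (Or.inl ⟨(![p₀, p₁, p₃, p₂, p₄, p₅] : Fin 6 → Fin n),
      Fin.strictMono_iff_lt_succ.2 ?_, ?_⟩) <;>
    simp [Fin.forall_fin_succ] <;> omega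
  · refine Or.inr (Or.inr (Or.inr ⟨(![p₀, p₁, p₃, p₂, p₄, p₅] : Fin 6 → Fin n),
      Fin.strictMono_iff_lt_succ.2 ?_, ?_⟩)) <;>
    simp [Fin.forall_fin_succ] <;> omega

theorem NoHexagon.avoidsPattern {n : ℕ} {π : Equiv.Perm (Fin n)} (h : NoHexagon π) {w : List ℕ}
    (p : Fin 6 → Fin w.length)
    (hpos : p 0 < p 1 ∧ p 1 < p 2 ∧ p 1 < p 3 ∧ p 2 < p 4 ∧ p 3 < p 4 ∧ p 4 < p 5)
    (hval : w.get (p 2) < w.get (p 4) ∧ w.get (p 4) < w.get (p 0) ∧ w.get (p 0) < w.get (p 1) ∧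
      w.get (p 1) < w.get (p 3) ∧ w.get (p 4) < w.get (p 5) ∧ w.get (p 5) < w.get (p 1)) :
    AvoidsPattern π w := by
  rintro ⟨f, hf, hfw⟩
  obtain ⟨h01, h12, h13, h24, h34, h45⟩ := hpos
  simp only [hfw] at hval
  obtain ⟨hv24, hv40, hv01, hv13, hv45, hv51⟩ := hval
  exact h _ _ _ _ _ _ ⟨⟨hf h01, hf h12, hf h13, hf h24, hf h34⟩, hv24, hv40, hv01, hv13⟩
    (hf h45) hv45 hv51

theorem noHexagon_iff {n : ℕ} (π : Equiv.Perm (Fin n)) : NoHexagon π ↔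
    AvoidsPattern π [3, 5, 1, 6, 2, 4] ∧ AvoidsPattern π [3, 5, 6, 1, 2, 4] ∧
      AvoidsPattern π [4, 5, 1, 6, 2, 3] ∧ AvoidsPattern π [4, 5, 6, 1, 2, 3] := by
  constructor
  · intro h
    exact ⟨h.avoidsPattern (![0, 1, 2, 3, 4, 5] : Fin 6 → Fin 6) (by decide) (by decide),
      h.avoidsPattern (![0, 1, 3, 2, 4, 5] : Fin 6 → Fin 6) (by decide) (by decide),
      h.avoidsPattern (![0, 1, 2, 3, 4, 5] : Fin 6 → Fin 6) (by decide) (by decide),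
      h.avoidsPattern (![0, 1, 3, 2, 4, 5] : Fin 6 → Fin 6) (by decide) (by decide)⟩
  · rintro ⟨h₁, h₂, h₃, h₄⟩ p₀ p₁ p₂ p₃ p₄ p₅ hs h45 hv45 hv51
    rcases containsPattern_of_isHexagonStart hs h45 hv45 hv51 with h | h | h | h
    exacts [h₁ h, h₂ h, h₃ h, h₄ h]

theorem f3_eq_treeCount (n : ℕ) : f3 n = treeCount n 0 0 := by
  classical
  have hcard (k : ℕ) : f3 k = ∑ π : Equiv.Perm (Fin k), if IsGood π then 1 else 0 := by
    simp only [f3, ← noDecreasingTriple_iff, ← noHexagon_iff]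
    rw [Nat.card_eq_fintype_card, Fintype.card_subtype, card_filter]
    exact sum_congr rfl fun _ _ => if_congr Iff.rfl rfl rfl
  have hgood : IsGood (1 : Equiv.Perm (Fin 0)) := ⟨fun i => i.elim0, fun i => i.elim0⟩
  obtain ⟨l, hl⟩ := hgood.exists_hasLabel
  have hl0 : l = (0, 0) := Prod.ext (Nat.le_zero.1 hl.1) (Nat.le_zero.1 hl.2.1)
  have hsum := sum_treeCount n 0
  rw [← hcard, Nat.zero_add, Fintype.sum_subsingleton (ι := Equiv.Perm (Fin 0)) _ 1, if_pos hgood,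
    hl.nodeLabel_eq, hl0] at hsum
  exact hsum

/-- For `n ≥ 5`, `f_3(n) = 4f_3(n−1) − 4f_3(n−2) + 3f_3(n−3) + f_3(n−4) − f_3(n−5)`. -/
theorem f3_recurrence (n : ℕ) (hn : 5 ≤ n) :
    (f3 n : ℤ) = 4 * f3 (n-1) - 4 * f3 (n-2) + 3 * f3 (n-3) + f3 (n-4) - f3 (n-5) := by
  simp only [f3_eq_treeCount]
  obtain ⟨d, rfl⟩ := Nat.exists_eq_add_of_le' hn
  rcases d with _ | d
  · decide
  · simpa [treeCount_zero_eq] using treeCount_one_recurrence d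
end

section
/- For every n ≥ 6, f_4(n) = 6·f_4(n−1) − 11·f_4(n−2) + 9·f_4(n−3) − 4·f_4(n−4) − 4·f_4(n−5) + f_4(n−6). -/
/-- `f_4(n)`: the number of permutations of `{1,…,n}` avoiding `321` and every pattern
in `𝔓_4 = {46718235, 46781235, 56718234, 56781234}` (the 321-hexagon-avoiding permutations). -/
noncomputable def f4 (n : ℕ) : ℕ :=
  Nat.card {π : Equiv.Perm (Fin n) //
    AvoidsPattern π [3,2,1] ∧ AvoidsPattern π [4,6,7,1,8,2,3,5] ∧
      AvoidsPattern π [4,6,7,8,1,2,3,5] ∧ AvoidsPattern π [5,6,7,1,8,2,3,4] ∧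
        AvoidsPattern π [5,6,7,8,1,2,3,4]}

/-- Two consecutive steps clash if they differ in both coordinates. -/
def Clash (l l' : Bool × Bool) : Prop := l.1 ≠ l'.1 ∧ l.2 ≠ l'.2

instance (l l' : Bool × Bool) : Decidable (Clash l l') := by
  unfold Clash; infer_instance

/-- The number of indices below `i` whose first coordinate is `true`. -/
def openCount (s : ℕ → Bool × Bool) (i : ℕ) : ℕ := Nat.count (fun j => (s j).1 = true) i

/-- The number of indices below `i` whose second coordinate is `true`. -/
def closeCount (s : ℕ → Bool × Bool) (i : ℕ) : ℕ := Nat.count (fun j => (s j).2 = true) i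

/-- `s` encodes a lattice path of length `n` from height `h` to height `0`, staying weakly
between heights `0` and `3`, in which a `true` in the second coordinate only occurs at positive
height and consecutive steps starting at height `3` do not clash. The optional letter `m` is a
previous step with which the first step of `s` must not clash. -/
structure GoodWord (n h : ℕ) (m : Option (Bool × Bool)) (s : ℕ → Bool × Bool) : Prop where
  close_le : ∀ i, closeCount s (i + 1) ≤ h + openCount s i
  balanced : h + openCount s n = closeCount s n
  height_le : ∀ i, h + openCount s i ≤ closeCount s i + 3
  no_clash : ∀ i, h + openCount s i = closeCount s i + 3 → ¬ Clash (s i) (s (i + 1))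
  start : ∀ l ∈ m, ¬ Clash l (s 0)
  support : ∀ i, n ≤ i → s i = (false, false)

/-- The number of good words. -/
noncomputable def goodCount (n h : ℕ) (m : Option (Bool × Bool)) : ℕ :=
  Nat.card {s // GoodWord n h m s}

/-- Prepend a letter to a word. -/
def consWord (l : Bool × Bool) (t : ℕ → Bool × Bool) : ℕ → Bool × Bool
  | 0 => l
  | i + 1 => t i

/-- The letter `l` may be read at height `h` after the letter `m`. -/
def Allowed (h : ℕ) (m : Option (Bool × Bool)) (l : Bool × Bool) : Prop :=
  (l.2 = true → 1 ≤ h) ∧ h ≤ 3 ∧ ∀ l' ∈ m, ¬ Clash l' l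

instance (h : ℕ) (m : Option (Bool × Bool)) (l : Bool × Bool) : Decidable (Allowed h m l) := by
  unfold Allowed; infer_instance

lemma openCount_consWord (l : Bool × Bool) (t : ℕ → Bool × Bool) (i : ℕ) :
    openCount (consWord l t) (i + 1) = openCount t i + l.1.toNat := by
  unfold openCount
  rw [Nat.count_succ']
  cases h : l.1 <;> simp [consWord, h] <;> rfl

lemma closeCount_consWord (l : Bool × Bool) (t : ℕ → Bool × Bool) (i : ℕ) :
    closeCount (consWord l t) (i + 1) = closeCount t i + l.2.toNat := by
  unfold closeCount
  rw [Nat.count_succ']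
  cases h : l.2 <;> simp [consWord, h] <;> rfl

lemma goodWord_consWord_iff (n h : ℕ) (m : Option (Bool × Bool)) (l : Bool × Bool)
    (t : ℕ → Bool × Bool) :
    GoodWord (n + 1) h m (consWord l t) ↔ Allowed h m l ∧
      GoodWord n (h + l.1.toNat - l.2.toNat) (if h = 3 then some l else none) t := by
  have o0 : ∀ s, openCount s 0 = 0 := fun s => Nat.count_zero _
  have c0 : ∀ s, closeCount s 0 = 0 := fun s => Nat.count_zero _
  have hl : l.2 = true ↔ l.2.toNat = 1 := by cases l.2 <;> simp
  have hl' : l.2.toNat ≤ 1 := by cases l.2 <;> simp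
  constructor
  · rintro ⟨h1, h2, h3, h4, h5, h6⟩
    have k1 := h1 0
    have k3 := h3 0
    have k4 := h4 0
    simp only [closeCount_consWord, o0, c0] at k1 k3 k4
    refine ⟨⟨fun hh => by rw [hl] at hh; omega, by omega, h5⟩, ?_, ?_, ?_, ?_, ?_, ?_⟩
    · intro i
      have := h1 (i + 1)
      simp only [closeCount_consWord, openCount_consWord] at this
      omega
    · simp only [closeCount_consWord, openCount_consWord] at h2
      omega
    · intro i
      have := h3 (i + 1)
      simp only [closeCount_consWord, openCount_consWord] at this
      omega
    · intro i hi
      have := h4 (i + 1)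
      simp only [closeCount_consWord, openCount_consWord] at this
      exact this (by omega)
    · intro l' hl'
      split_ifs at hl' with hh
      · simp only [Option.mem_def, Option.some.injEq] at hl'
        subst hl'
        exact k4 (by omega)
      · simp at hl'
    · intro i hi
      exact h6 (i + 1) (by omega)
  · rintro ⟨⟨g1, g2, g3⟩, h1, h2, h3, h4, h5, h6⟩
    rw [hl] at g1
    refine ⟨?_, ?_, ?_, ?_, g3, ?_⟩
    · rintro (_ | i)
      · simp only [closeCount_consWord, o0, c0]
        omega
      · have := h1 i
        rw [closeCount_consWord, openCount_consWord]
        omega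
    · simp only [closeCount_consWord, openCount_consWord]
      omega
    · rintro (_ | i)
      · simp only [o0, c0]
        omega
      · have := h3 i
        rw [closeCount_consWord, openCount_consWord]
        omega
    · rintro (_ | i) hi
      · simp only [o0, c0] at hi
        exact h5 l (by simp [show h = 3 by omega])
      · rw [closeCount_consWord, openCount_consWord] at hi
        exact h4 i (by omega)
    · rintro (_ | i) hi
      · omega
      · exact h6 i (by omega)

instance finite_goodWord (n h : ℕ) (m : Option (Bool × Bool)) :
    Finite {s // GoodWord n h m s} := by
  refine Finite.of_injective (β := Fin n → Bool × Bool) (fun s i => s.1 i) ?_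
  rintro ⟨s, hs⟩ ⟨t, ht⟩ hst
  ext1
  funext i
  by_cases hi : i < n
  · exact congrFun hst ⟨i, hi⟩
  · exact (hs.support i (by omega)).trans (ht.support i (by omega)).symm

lemma goodCount_succ (n h : ℕ) (m : Option (Bool × Bool)) :
    goodCount (n + 1) h m = ∑ l : Bool × Bool, if Allowed h m l then
      goodCount n (h + l.1.toNat - l.2.toNat) (if h = 3 then some l else none) else 0 := by
  let e : {s // GoodWord (n + 1) h m s} ≃ Σ l : Bool × Bool, {t // Allowed h m l ∧
      GoodWord n (h + l.1.toNat - l.2.toNat) (if h = 3 then some l else none) t} :=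
    { toFun := fun s => ⟨s.1 0, fun i => s.1 (i + 1), by
        rw [← goodWord_consWord_iff]
        convert s.2 using 1
        funext i
        cases i <;> rfl⟩
      invFun := fun p => ⟨consWord p.1 p.2.1, (goodWord_consWord_iff ..).2 p.2.2⟩
      left_inv := fun s => by
        ext1
        funext i
        cases i <;> rfl
      right_inv := fun p => rfl }
  have hfin : ∀ l : Bool × Bool, Finite {t // Allowed h m l ∧
      GoodWord n (h + l.1.toNat - l.2.toNat) (if h = 3 then some l else none) t} := fun l =>
    Finite.of_injective (β := {t // GoodWord n (h + l.1.toNat - l.2.toNat)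
      (if h = 3 then some l else none) t}) (fun t => ⟨t.1, t.2.2⟩)
      fun a b hab => Subtype.ext (Subtype.mk.inj hab)
  rw [goodCount, Nat.card_congr e, Nat.card_sigma]
  refine Finset.sum_congr rfl fun l _ => ?_
  by_cases hl : Allowed h m l
  · rw [if_pos hl]
    exact Nat.card_congr (Equiv.subtypeEquivRight fun t => and_iff_right hl)
  · rw [if_neg hl]
    have : IsEmpty {t // Allowed h m l ∧
        GoodWord n (h + l.1.toNat - l.2.toNat) (if h = 3 then some l else none) t} :=
      ⟨fun t => hl t.2.1⟩
    exact Nat.card_of_isEmpty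

lemma goodCount_zero_pos (h : ℕ) (hh : 0 < h) (m : Option (Bool × Bool)) :
    goodCount 0 h m = 0 := by
  have : IsEmpty {s // GoodWord 0 h m s} :=
    ⟨fun s => by have := s.2.balanced; simp [openCount, closeCount] at this; omega⟩
  exact Nat.card_of_isEmpty

lemma goodCount_zero_zero : goodCount 0 0 none = 1 := by
  rw [goodCount, Nat.card_eq_one_iff_unique]
  refine ⟨⟨fun s t => ?_⟩, ⟨fun _ => (false, false), ?_⟩⟩
  · ext1
    funext i
    exact (s.2.support i (by omega)).trans (t.2.support i (by omega)).symm
  · constructor <;> simp [openCount, closeCount, Clash]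

lemma goodCount_four (n : ℕ) (m : Option (Bool × Bool)) : goodCount n 4 m = 0 := by
  cases n with
  | zero => exact goodCount_zero_pos 4 (by omega) m
  | succ n => simp [goodCount_succ, Allowed]

lemma goodCount_recurrence (n : ℕ) :
    (goodCount (n + 6) 0 none : ℤ) = 6 * goodCount (n + 5) 0 none
      - 11 * goodCount (n + 4) 0 none + 9 * goodCount (n + 3) 0 none
      - 4 * goodCount (n + 2) 0 none - 4 * goodCount (n + 1) 0 none + goodCount n 0 none := by
  have e0 (k : ℕ) : goodCount (k + 1) 0 none = goodCount k 0 none + goodCount k 1 none := by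
    simp [goodCount_succ, Fintype.sum_prod_type, Allowed]; omega
  have e1 (k : ℕ) : goodCount (k + 1) 1 none =
      goodCount k 0 none + 2 * goodCount k 1 none + goodCount k 2 none := by
    simp [goodCount_succ, Fintype.sum_prod_type, Allowed]; omega
  have e2 (k : ℕ) : goodCount (k + 1) 2 none =
      goodCount k 1 none + 2 * goodCount k 2 none + goodCount k 3 none := by
    simp [goodCount_succ, Fintype.sum_prod_type, Allowed]; omega
  have e2' (k : ℕ) : goodCount (k + 1) 2 (some (false, true)) =
      goodCount k 1 none + 2 * goodCount k 2 none := by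
    simp [goodCount_succ, Fintype.sum_prod_type, Allowed, Clash]; omega
  have e3 (k : ℕ) : goodCount (k + 1) 3 none = goodCount k 3 (some (true, true)) +
      goodCount k 3 (some (false, false)) + goodCount k 2 (some (false, true)) := by
    simp [goodCount_succ, Fintype.sum_prod_type, Allowed, goodCount_four]; omega
  have e3t (k : ℕ) : goodCount (k + 1) 3 (some (true, true)) =
      goodCount k 3 (some (true, true)) + goodCount k 2 (some (false, true)) := by
    simp [goodCount_succ, Fintype.sum_prod_type, Allowed, Clash, goodCount_four]
  have e3f (k : ℕ) : goodCount (k + 1) 3 (some (false, false)) =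
      goodCount k 3 (some (false, false)) + goodCount k 2 (some (false, true)) := by
    simp [goodCount_succ, Fintype.sum_prod_type, Allowed, Clash, goodCount_four]; omega
  simp only [e0, e1, e2, e2', e3, e3t, e3f]
  push_cast
  ring

/-- `σ` contains a decreasing subsequence of length three. -/
def HasDecr (σ : Equiv.Perm ℕ) : Prop :=
  ∃ i j k, i < j ∧ j < k ∧ σ k < σ j ∧ σ j < σ i

/-- `σ` contains a hexagon: two increasing subsequences of length four, in which every element
of the first one is inverted with every element of the second one, except possibly for the
pairs `(a₁, b₄)` and `(a₄, b₁)`. -/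
def HasHexagon (σ : Equiv.Perm ℕ) : Prop :=
  ∃ a₁ a₂ a₃ a₄ b₁ b₂ b₃ b₄, (a₁ < a₂ ∧ a₂ < a₃ ∧ a₃ < a₄) ∧ (b₁ < b₂ ∧ b₂ < b₃ ∧ b₃ < b₄) ∧
    (a₃ < b₁ ∧ a₄ < b₂) ∧ (σ a₁ < σ a₂ ∧ σ a₂ < σ a₃ ∧ σ a₃ < σ a₄) ∧
    (σ b₁ < σ b₂ ∧ σ b₂ < σ b₃ ∧ σ b₃ < σ b₄) ∧ (σ b₃ < σ a₁ ∧ σ b₄ < σ a₂)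

/-- The word recording the positions and the values of the strict excedances of `σ`. -/
def excedanceWord (σ : Equiv.Perm ℕ) (i : ℕ) : Bool × Bool :=
  (decide (i < σ i), decide (σ.symm i < i))

section Counting

lemma card_le_of_mapsTo (σ : Equiv.Perm ℕ) (A B : Finset ℕ) (h : ∀ x ∈ A, σ x ∈ B) :
    A.card ≤ B.card :=
  Finset.card_le_card_of_injOn σ h σ.injective.injOn

lemma count_add_count_not (p : ℕ → Prop) [DecidablePred p] (i : ℕ) :
    Nat.count p i + Nat.count (fun j => ¬ p j) i = i := by
  induction i with
  | zero => simp
  | succ i ih =>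
    rw [Nat.count_succ, Nat.count_succ]
    split_ifs <;> omega

lemma exists_count_eq (p : ℕ → Prop) [DecidablePred p] {k n : ℕ} (h : k < Nat.count p n) :
    ∃ j, p j ∧ Nat.count p j = k := by
  induction n with
  | zero => simp at h
  | succ n ih =>
    by_cases hk : k < Nat.count p n
    · exact ih hk
    · rw [Nat.count_succ] at h
      split_ifs at h with hp
      · exact ⟨n, hp, by omega⟩
      · omega

end Counting

section Permutations

variable {σ : Equiv.Perm ℕ}

lemma exists_lt_of_lt_apply {j : ℕ} (hj : j < σ j) : ∃ k, j < k ∧ σ k < σ j := by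
  by_contra! hc
  have := card_le_of_mapsTo σ.symm (Finset.range (σ j)) (Finset.range j) (fun x hx => by
    simp only [Finset.mem_range] at hx ⊢
    by_contra hlt
    rcases (not_lt.1 hlt).lt_or_eq with h | h
    · have := hc _ h
      simp at this
      omega
    · rw [h] at hx
      simp at hx)
  simp at this
  omega

lemma exists_gt_of_apply_le {i j : ℕ} (hi : σ i ≤ i) (hij : i < j) (hinv : σ j < σ i) :
    ∃ k, k < i ∧ σ i < σ k := by
  by_contra! hc
  have := card_le_of_mapsTo σ (insert j (Finset.range i)) (Finset.range (σ i)) (fun x hx => by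
    simp only [Finset.mem_insert, Finset.mem_range] at hx ⊢
    rcases hx with rfl | hx
    · exact hinv
    · exact lt_of_le_of_ne (hc x hx) (fun h => by have := σ.injective h; omega))
  rw [Finset.card_insert_of_notMem (by simp; omega)] at this
  simp at this
  omega

lemma lt_apply_of_inversion (hσ : ¬ HasDecr σ) {i j : ℕ} (hij : i < j) (hinv : σ j < σ i) : i < σ i := by
  by_contra h
  obtain ⟨k, hk, hk'⟩ := exists_gt_of_apply_le (not_lt.1 h) hij hinv
  exact hσ ⟨k, i, j, hk, hij, hinv, hk'⟩

lemma apply_le_of_inversion (hσ : ¬ HasDecr σ) {i j : ℕ} (hij : i < j) (hinv : σ j < σ i) : σ j ≤ j := by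
  by_contra h
  obtain ⟨k, hk, hk'⟩ := exists_lt_of_lt_apply (not_le.1 h)
  exact hσ ⟨i, j, k, hij, hk, hk', hinv⟩

lemma apply_lt_apply_of_iff (hσ : ¬ HasDecr σ) {i j : ℕ} (h : i < σ i ↔ j < σ j) (hij : i < j) : σ i < σ j := by
  by_contra hlt
  have hne : σ i ≠ σ j := fun h => by have := σ.injective h; omega
  have h1 := lt_apply_of_inversion hσ hij (by omega)
  have h2 := apply_le_of_inversion hσ hij (by omega)
  omega

lemma lt_of_apply_lt_apply (hσ : ¬ HasDecr σ) {i j : ℕ} (h : i < σ i ↔ j < σ j) (hij : σ i < σ j) : i < j := by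
  by_contra hlt
  rcases (not_lt.1 hlt).lt_or_eq with h' | h'
  · have := apply_lt_apply_of_iff hσ h.symm h'
    omega
  · subst h'
    omega

lemma openCount_excedanceWord (σ : Equiv.Perm ℕ) (i : ℕ) :
    openCount (excedanceWord σ) i = ((Finset.range i).filter fun j => j < σ j).card := by
  simp [openCount, Nat.count_eq_card_filter_range, excedanceWord]

lemma closeCount_excedanceWord (σ : Equiv.Perm ℕ) (i : ℕ) :
    closeCount (excedanceWord σ) i = ((Finset.range i).filter fun v => σ.symm v < v).card := by
  simp [closeCount, Nat.count_eq_card_filter_range, excedanceWord]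

lemma closeCount_succ_le (σ : Equiv.Perm ℕ) (i : ℕ) :
    closeCount (excedanceWord σ) (i + 1) ≤ openCount (excedanceWord σ) i := by
  rw [openCount_excedanceWord, closeCount_excedanceWord]
  refine card_le_of_mapsTo σ.symm _ _ fun v hv => ?_
  simp only [Finset.mem_filter, Finset.mem_range, Equiv.apply_symm_apply] at hv ⊢
  omega

lemma card_excedances_across (σ : Equiv.Perm ℕ) (i : ℕ) :
    ((Finset.range i).filter fun p => i ≤ σ p).card + closeCount (excedanceWord σ) i =
      openCount (excedanceWord σ) i := by
  rw [openCount_excedanceWord, closeCount_excedanceWord,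
    ← Finset.card_filter_add_card_filter_not (s := (Finset.range i).filter fun j => j < σ j)
      (fun j => i ≤ σ j), Finset.filter_filter, Finset.filter_filter]
  congr 1
  · congr 1
    ext p
    simp only [Finset.mem_filter, Finset.mem_range]
    omega
  · refine le_antisymm (card_le_of_mapsTo σ.symm _ _ fun v hv => ?_)
      (card_le_of_mapsTo σ _ _ fun v hv => ?_) <;>
    simp only [Finset.mem_filter, Finset.mem_range, Equiv.apply_symm_apply,
      Equiv.symm_apply_apply] at hv ⊢ <;> omega

lemma card_antiexcedances_across (σ : Equiv.Perm ℕ) (i : ℕ) :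
    ((Finset.range i).filter fun v => i ≤ σ.symm v).card =
      ((Finset.range i).filter fun p => i ≤ σ p).card := by
  have h1 := Finset.card_filter_add_card_filter_not (s := Finset.range i) (fun v => i ≤ σ.symm v)
  have h2 := Finset.card_filter_add_card_filter_not (s := Finset.range i) (fun p => i ≤ σ p)
  have h3 : ((Finset.range i).filter fun v => ¬ i ≤ σ.symm v).card =
      ((Finset.range i).filter fun p => ¬ i ≤ σ p).card := by
    refine le_antisymm (card_le_of_mapsTo σ.symm _ _ fun v hv => ?_)
      (card_le_of_mapsTo σ _ _ fun v hv => ?_) <;>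
    simp only [Finset.mem_filter, Finset.mem_range, Equiv.apply_symm_apply,
      Equiv.symm_apply_apply] at hv ⊢ <;> omega
  omega

lemma closeCount_apply_of_lt (hσ : ¬ HasDecr σ) {i : ℕ} (hi : i < σ i) :
    closeCount (excedanceWord σ) (σ i) = openCount (excedanceWord σ) i := by
  rw [openCount_excedanceWord, closeCount_excedanceWord]
  refine le_antisymm (card_le_of_mapsTo σ.symm _ _ fun v hv => ?_)
    (card_le_of_mapsTo σ _ _ fun v hv => ?_)
  · simp only [Finset.mem_filter, Finset.mem_range, Equiv.apply_symm_apply] at hv ⊢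
    exact ⟨lt_of_apply_lt_apply hσ (by simp [hi, hv.2]) (by simpa using hv.1), hv.2⟩
  · simp only [Finset.mem_filter, Finset.mem_range, Equiv.symm_apply_apply] at hv ⊢
    exact ⟨apply_lt_apply_of_iff hσ (by simp [hi, hv.2]) hv.1, hv.2⟩

lemma closeCount_apply_of_le (hσ : ¬ HasDecr σ) {i : ℕ} (hi : σ i ≤ i) :
    σ i + openCount (excedanceWord σ) i = i + closeCount (excedanceWord σ) (σ i) := by
  rw [openCount_excedanceWord, closeCount_excedanceWord]
  have h1 := Finset.card_filter_add_card_filter_not (s := Finset.range i) (fun j => j < σ j)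
  have h2 := Finset.card_filter_add_card_filter_not (s := Finset.range (σ i))
    (fun v => σ.symm v < v)
  have h3 : ((Finset.range (σ i)).filter fun v => ¬ σ.symm v < v).card =
      ((Finset.range i).filter fun j => ¬ j < σ j).card := by
    refine le_antisymm (card_le_of_mapsTo σ.symm _ _ fun v hv => ?_)
      (card_le_of_mapsTo σ _ _ fun v hv => ?_)
    · simp only [Finset.mem_filter, Finset.mem_range, Equiv.apply_symm_apply] at hv ⊢
      exact ⟨lt_of_apply_lt_apply hσ (by simp; omega) (by simpa using hv.1), hv.2⟩
    · simp only [Finset.mem_filter, Finset.mem_range, Equiv.symm_apply_apply] at hv ⊢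
      exact ⟨apply_lt_apply_of_iff hσ (by omega) hv.1, hv.2⟩
  simp only [Finset.card_range] at h1 h2
  omega

lemma eq_of_excedanceWord_eq {τ : Equiv.Perm ℕ} (hσ : ¬ HasDecr σ) (hτ : ¬ HasDecr τ)
    (h : excedanceWord σ = excedanceWord τ) : σ = τ := by
  ext i
  have hi : i < σ i ↔ i < τ i := by
    have := congrArg Prod.fst (congrFun h i)
    simpa [excedanceWord] using this
  by_cases hlt : i < σ i
  · refine Nat.count_injective (p := fun j => (excedanceWord σ j).2 = true)
      (by simpa [excedanceWord] using hlt) (by rw [h]; simpa [excedanceWord] using hi.1 hlt) ?_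
    have h1 := closeCount_apply_of_lt hσ hlt
    have h2 := closeCount_apply_of_lt hτ (hi.1 hlt)
    rw [← h] at h2
    exact h1.trans h2.symm
  · refine Nat.count_injective (p := fun j => ¬ (excedanceWord σ j).2 = true)
      (by simpa [excedanceWord] using hlt) (by
        rw [h]
        simpa [excedanceWord] using (not_congr hi).1 hlt) ?_
    have h1 := closeCount_apply_of_le hσ (not_lt.1 hlt)
    have h2 := closeCount_apply_of_le hτ (not_lt.1 ((not_congr hi).1 hlt))
    rw [← h] at h2
    have h3 := count_add_count_not (fun j => (excedanceWord σ j).2 = true) (σ i)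
    have h4 := count_add_count_not (fun j => (excedanceWord σ j).2 = true) (τ i)
    unfold closeCount at h1 h2
    omega

lemma exists_four_lt {s : Finset ℕ} (hs : 4 ≤ s.card) :
    ∃ a b c d, a ∈ s ∧ b ∈ s ∧ c ∈ s ∧ d ∈ s ∧ a < b ∧ b < c ∧ c < d := by
  obtain ⟨t, hts, ht⟩ := Finset.exists_subset_card_eq hs
  have hmem := fun i => hts (Finset.orderEmbOfFin_mem t ht i)
  have hlt {i j : Fin 4} (hij : i < j) := (t.orderEmbOfFin ht).strictMono hij
  exact ⟨_, _, _, _, hmem 0, hmem 1, hmem 2, hmem 3, hlt (by decide), hlt (by decide),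
    hlt (by decide)⟩

lemma exists_three_lt {s : Finset ℕ} (hs : 3 ≤ s.card) :
    ∃ a b c, a ∈ s ∧ b ∈ s ∧ c ∈ s ∧ a < b ∧ b < c := by
  obtain ⟨t, hts, ht⟩ := Finset.exists_subset_card_eq hs
  have hmem := fun i => hts (Finset.orderEmbOfFin_mem t ht i)
  have hlt {i j : Fin 3} (hij : i < j) := (t.orderEmbOfFin ht).strictMono hij
  exact ⟨_, _, _, hmem 0, hmem 1, hmem 2, hlt (by decide), hlt (by decide)⟩

lemma openCount_le_of_not_hasHexagon (hσ : ¬ HasDecr σ) (hex : ¬ HasHexagon σ) (i : ℕ) :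
    openCount (excedanceWord σ) i ≤ closeCount (excedanceWord σ) i + 3 := by
  by_contra hlt
  have h1 := card_excedances_across σ i
  have h2 := card_antiexcedances_across σ i
  obtain ⟨a₁, a₂, a₃, a₄, ha₁, ha₂, ha₃, ha₄, a₁₂, a₂₃, a₃₄⟩ := exists_four_lt
    (s := (Finset.range i).filter fun p => i ≤ σ p) (by omega)
  obtain ⟨v₁, v₂, v₃, v₄, hv₁, hv₂, hv₃, hv₄, v₁₂, v₂₃, v₃₄⟩ := exists_four_lt
    (s := (Finset.range i).filter fun v => i ≤ σ.symm v) (by omega)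
  obtain ⟨b₁, rfl⟩ := σ.surjective v₁
  obtain ⟨b₂, rfl⟩ := σ.surjective v₂
  obtain ⟨b₃, rfl⟩ := σ.surjective v₃
  obtain ⟨b₄, rfl⟩ := σ.surjective v₄
  simp only [Finset.mem_filter, Finset.mem_range, Equiv.symm_apply_apply] at *
  have A₁₂ := apply_lt_apply_of_iff hσ (by omega) a₁₂
  have A₂₃ := apply_lt_apply_of_iff hσ (by omega) a₂₃
  have A₃₄ := apply_lt_apply_of_iff hσ (by omega) a₃₄
  have B₁₂ := lt_of_apply_lt_apply hσ (by omega) v₁₂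
  have B₂₃ := lt_of_apply_lt_apply hσ (by omega) v₂₃
  have B₃₄ := lt_of_apply_lt_apply hσ (by omega) v₃₄
  exact hex ⟨a₁, a₂, a₃, a₄, b₁, b₂, b₃, b₄, by omega⟩

lemma not_clash_of_not_hasHexagon (hσ : ¬ HasDecr σ) (hex : ¬ HasHexagon σ) {i : ℕ}
    (hi : openCount (excedanceWord σ) i = closeCount (excedanceWord σ) i + 3) :
    ¬ Clash (excedanceWord σ i) (excedanceWord σ (i + 1)) := by
  rintro ⟨hu, hv⟩
  have h1 := card_excedances_across σ i
  have h2 := card_antiexcedances_across σ i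
  obtain ⟨a₁, a₂, a₃, ha₁, ha₂, ha₃, a₁₂, a₂₃⟩ := exists_three_lt
    (s := (Finset.range i).filter fun p => i ≤ σ p) (by omega)
  obtain ⟨v₁, v₂, v₃, hv₁, hv₂, hv₃, v₁₂, v₂₃⟩ := exists_three_lt
    (s := (Finset.range i).filter fun v => i ≤ σ.symm v) (by omega)
  obtain ⟨b₁, rfl⟩ := σ.surjective v₁
  obtain ⟨b₂, rfl⟩ := σ.surjective v₂
  obtain ⟨b₃, rfl⟩ := σ.surjective v₃
  have hx : ∃ x y, ((x = i ∧ y = i + 1) ∨ (x = i + 1 ∧ y = i)) ∧ x < σ x := by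
    by_cases h : i < σ i
    · exact ⟨i, i + 1, by omega, h⟩
    · exact ⟨i + 1, i, by omega, by simpa [excedanceWord, h] using hu⟩
  have hy : ∃ x y, ((x = i ∧ y = i + 1) ∨ (x = i + 1 ∧ y = i)) ∧ x ≤ σ.symm x := by
    by_cases h : σ.symm i < i
    · exact ⟨i + 1, i, by omega, by simpa [excedanceWord, h] using hv⟩
    · exact ⟨i, i + 1, by omega, by omega⟩
  obtain ⟨a₄, x', hxx, ha₄⟩ := hx
  obtain ⟨v₄, y', hyy, hv₄⟩ := hy
  obtain ⟨b₄, rfl⟩ := σ.surjective v₄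
  simp only [Finset.mem_filter, Finset.mem_range, Equiv.symm_apply_apply] at *
  have A₁₂ := apply_lt_apply_of_iff hσ (by omega) a₁₂
  have A₂₃ := apply_lt_apply_of_iff hσ (by omega) a₂₃
  have A₃₄ := apply_lt_apply_of_iff hσ (i := a₃) (j := a₄) (by omega) (by omega)
  have B₁₂ := lt_of_apply_lt_apply hσ (by omega) v₁₂
  have B₂₃ := lt_of_apply_lt_apply hσ (by omega) v₂₃
  have B₃₄ := lt_of_apply_lt_apply hσ (i := b₃) (j := b₄) (by omega) (by omega)
  have hne : a₄ ≠ b₂ := by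
    rintro rfl
    omega
  have hne' : σ b₄ ≠ σ a₂ := fun h => by
    have := σ.injective h
    subst this
    omega
  exact hex ⟨a₁, a₂, a₃, a₄, b₁, b₂, b₃, b₄, by omega⟩

/-- The word of a permutation with a hexagon either exceeds height `3` or has a clash at
height `3`. -/
lemma not_goodWord_of_hasHexagon (hσ : ¬ HasDecr σ) (hex : HasHexagon σ) (n : ℕ) :
    ¬ GoodWord n 0 none (excedanceWord σ) := by
  rintro ⟨-, -, hle, hclash, -, -⟩
  obtain ⟨a₁, a₂, a₃, a₄, b₁, b₂, b₃, b₄, ⟨a₁₂, a₂₃, a₃₄⟩, ⟨b₁₂, b₂₃, b₃₄⟩, ⟨h₃₁, h₄₂⟩,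
    ⟨A₁₂, A₂₃, A₃₄⟩, ⟨B₁₂, B₂₃, B₃₄⟩, ⟨H₃₁, H₄₂⟩⟩ := hex
  have u₁ := lt_apply_of_inversion hσ (i := a₁) (j := b₃) (by omega) (by omega)
  have u₂ := lt_apply_of_inversion hσ (i := a₂) (j := b₃) (by omega) (by omega)
  have u₃ := lt_apply_of_inversion hσ (i := a₃) (j := b₃) (by omega) (by omega)
  have u₄ := lt_apply_of_inversion hσ (i := a₄) (j := b₃) (by omega) (by omega)
  have l₁ := apply_le_of_inversion hσ (i := a₂) (j := b₁) (by omega) (by omega)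
  have l₂ := apply_le_of_inversion hσ (i := a₂) (j := b₂) (by omega) (by omega)
  have l₃ := apply_le_of_inversion hσ (i := a₂) (j := b₃) (by omega) (by omega)
  have l₄ := apply_le_of_inversion hσ (i := a₂) (j := b₄) (by omega) (by omega)
  set s := excedanceWord σ with hs
  have osucc (j : ℕ) : openCount s (j + 1) = openCount s j + if j < σ j then 1 else 0 := by
    simp [openCount, Nat.count_succ, hs, excedanceWord]
  have csucc (b : ℕ) : closeCount s (b + 1) = closeCount s b + if σ.symm b < b then 1 else 0 := by
    simp [closeCount, Nat.count_succ, hs, excedanceWord]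
  have omono {x y : ℕ} (h : x ≤ y) : openCount s x ≤ openCount s y := Nat.count_monotone _ h
  have cmono {x y : ℕ} (h : x ≤ y) : closeCount s x ≤ closeCount s y := Nat.count_monotone _ h
  have olow {x y : ℕ} (h : x ≤ y) : openCount s y + x ≤ openCount s x + y := by
    induction y, h using Nat.le_induction with
    | base => omega
    | succ y _ ih => rw [osucc]; split_ifs <;> omega
  have clow {x y : ℕ} (h : x ≤ y) : closeCount s y + x ≤ closeCount s x + y := by
    induction y, h using Nat.le_induction with
    | base => omega
    | succ y _ ih => rw [csucc]; split_ifs <;> omega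
  have oup {j : ℕ} (h : j < σ j) : openCount s (j + 1) = openCount s j + 1 := by
    rw [osucc, if_pos h]
  have odown {j : ℕ} (h : σ j ≤ j) : openCount s (j + 1) = openCount s j := by
    rw [osucc, if_neg (not_lt.2 h), add_zero]
  have cdown {j : ℕ} (h : σ j ≤ j) : closeCount s (σ j + 1) = closeCount s (σ j) := by
    rw [csucc, if_neg (by simpa using h), add_zero]
  have p₁ : openCount s a₁ + 1 ≤ openCount s a₂ := oup u₁ ▸ omono a₁₂
  have p₂ : openCount s a₂ + 1 ≤ openCount s a₃ := oup u₂ ▸ omono a₂₃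
  have p₃ : openCount s a₃ + 1 ≤ openCount s a₄ := oup u₃ ▸ omono a₃₄
  have p₄ := oup u₄
  have p₃' := oup u₃
  have q₁ : openCount s b₂ + (b₁ + 1) ≤ openCount s b₁ + b₂ := odown l₁ ▸ olow b₁₂
  have q₂ : openCount s b₃ + (b₂ + 1) ≤ openCount s b₂ + b₃ := odown l₂ ▸ olow b₂₃
  have q₃ : openCount s b₄ + (b₃ + 1) ≤ openCount s b₃ + b₄ := odown l₃ ▸ olow b₃₄
  have r₁ := closeCount_apply_of_lt hσ u₁
  have r₂ := closeCount_apply_of_lt hσ u₂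
  have t₃ := closeCount_apply_of_le hσ l₃
  have t₄ := closeCount_apply_of_le hσ l₄
  rw [← hs] at r₁ r₂ t₃ t₄
  have t₃' := cdown l₃
  have t₄' := cdown l₄
  have hb₂ : openCount s b₂ ≤ b₂ := Nat.count_le _
  obtain ⟨i, hi⟩ : ∃ i, i + openCount s b₂ = openCount s a₂ + b₂ + 1 :=
    ⟨openCount s a₂ + b₂ + 1 - openCount s b₂, by omega⟩
  have hO : openCount s a₂ + 2 ≤ openCount s i := by
    rcases lt_or_ge a₃ i with h | h
    · have := omono (show a₃ + 1 ≤ i from h)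
      omega
    · have := olow (show i ≤ b₁ by omega)
      omega
  have hC : closeCount s i + 1 ≤ openCount s a₂ := by
    rcases le_or_gt i (σ a₁) with h | h
    · have := cmono h
      omega
    · have := clow (show σ b₃ + 1 ≤ i by omega)
      omega
  have hO' : openCount s a₂ + 3 ≤ openCount s (i + 2) := by
    rcases lt_or_ge a₄ (i + 2) with h | h
    · have := omono (show a₄ + 1 ≤ i + 2 from h)
      omega
    · have := olow (show i + 2 ≤ b₂ by omega)
      omega
  have hC' : closeCount s (i + 2) ≤ openCount s a₂ := by
    rcases le_or_gt (i + 2) (σ a₂) with h | h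
    · have := cmono h
      omega
    · have := clow (show σ b₄ + 1 ≤ i + 2 by omega)
      omega
  have e₁ := hle i
  have e₂ := hle (i + 2)
  refine hclash i (by omega) ⟨fun h => ?_, fun h => ?_⟩
  · have o₁ := osucc i
    have o₂ : openCount s (i + 2) = _ := osucc (i + 1)
    have hiff : i < σ i ↔ i + 1 < σ (i + 1) := by simpa [hs, excedanceWord] using h
    simp only [← hiff] at o₂
    split_ifs at o₁ o₂ <;> omega
  · have c₁ := csucc i
    have c₂ : closeCount s (i + 2) = _ := csucc (i + 1)
    have hiff : σ.symm i < i ↔ σ.symm (i + 1) < i + 1 := by simpa [hs, excedanceWord] using h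
    simp only [← hiff] at c₂
    split_ifs at c₁ c₂ <;> omega

lemma goodWord_excedanceWord {n : ℕ} (hfix : ∀ i, n ≤ i → σ i = i) (hσ : ¬ HasDecr σ)
    (hex : ¬ HasHexagon σ) : GoodWord n 0 none (excedanceWord σ) where
  close_le i := by simpa using closeCount_succ_le σ i
  balanced := by
    have h : ((Finset.range n).filter fun p => n ≤ σ p) = ∅ := by
      rw [Finset.filter_eq_empty_iff]
      intro p hp hn
      have := σ.injective (hfix _ hn)
      simp at hp
      omega
    have := card_excedances_across σ n
    rw [h] at this
    simp at this
    omega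
  height_le i := by simpa using openCount_le_of_not_hasHexagon hσ hex i
  no_clash i hi := not_clash_of_not_hasHexagon hσ hex (by omega)
  start := by simp
  support i hi := by
    have h : σ.symm i = i := by rw [Equiv.symm_apply_eq, hfix i hi]
    simp [excedanceWord, h, hfix i hi]

end Permutations

section Reconstruction

/-- `i` and `j` agree on membership in `E` and `V` and have equal rank among the
elements with the same membership. -/
def SameRank (E V : ℕ → Prop) [DecidablePred E] [DecidablePred V] (i j : ℕ) : Prop :=
  (E i ∧ V j ∧ Nat.count E i = Nat.count V j) ∨
    (¬ E i ∧ ¬ V j ∧ Nat.count (fun k => ¬ E k) i = Nat.count (fun k => ¬ V k) j)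

variable {E V : ℕ → Prop} [DecidablePred E] [DecidablePred V]

lemma SameRank.symm {i j : ℕ} (h : SameRank E V i j) : SameRank V E j i := by
  rcases h with ⟨h1, h2, h3⟩ | ⟨h1, h2, h3⟩
  · exact Or.inl ⟨h2, h1, h3.symm⟩
  · exact Or.inr ⟨h2, h1, h3.symm⟩

lemma SameRank.unique {i j k : ℕ} (h : SameRank E V i j) (h' : SameRank E V i k) : j = k := by
  rcases h with ⟨h1, h2, h3⟩ | ⟨h1, h2, h3⟩ <;> rcases h' with ⟨g1, g2, g3⟩ | ⟨g1, g2, g3⟩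
  · exact Nat.count_injective h2 g2 (h3.symm.trans g3)
  · exact absurd h1 g1
  · exact absurd g1 h1
  · exact Nat.count_injective (p := fun k => ¬ V k) h2 g2 (h3.symm.trans g3)

lemma exists_sameRank {n : ℕ} (h : ∀ m, n ≤ m → Nat.count E m = Nat.count V m) (i : ℕ) :
    ∃ j, SameRank E V i j := by
  have hm := h (max n (i + 1)) (le_max_left _ _)
  have hi : i < max n (i + 1) := lt_of_lt_of_le (Nat.lt_succ_self i) (le_max_right _ _)
  by_cases hE : E i
  · obtain ⟨j, hj, hj'⟩ := exists_count_eq V (hm ▸ Nat.count_strict_mono hE hi)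
    exact ⟨j, Or.inl ⟨hE, hj, hj'.symm⟩⟩
  · have hlt := Nat.count_strict_mono (p := fun k => ¬ E k) hE hi
    have h1 := count_add_count_not E (max n (i + 1))
    have h2 := count_add_count_not V (max n (i + 1))
    obtain ⟨j, hj, hj'⟩ := exists_count_eq (fun k => ¬ V k)
      (k := Nat.count (fun k => ¬ E k) i) (n := max n (i + 1)) (by omega)
    exact ⟨j, Or.inr ⟨hE, hj, hj'.symm⟩⟩

lemma exists_perm_sameRank {n : ℕ} (h : ∀ m, n ≤ m → Nat.count E m = Nat.count V m) :
    ∃ σ : Equiv.Perm ℕ, ∀ i, SameRank E V i (σ i) := by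
  choose f hf using exists_sameRank h
  choose g hg using exists_sameRank fun m hm => (h m hm).symm
  exact ⟨⟨f, g, fun i => (hg (f i)).unique (hf i).symm, fun i => (hf (g i)).unique (hg i).symm⟩,
    hf⟩

lemma not_hasDecr_of_sameRank {σ : Equiv.Perm ℕ} (h : ∀ i, SameRank E V i (σ i)) :
    ¬ HasDecr σ := by
  have key : ∀ i j, i < j → (E i ↔ E j) → σ i < σ j := by
    intro i j hij hE
    rcases h i with ⟨h1, h2, h3⟩ | ⟨h1, h2, h3⟩ <;> rcases h j with ⟨g1, g2, g3⟩ | ⟨g1, g2, g3⟩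
    · have := Nat.count_strict_mono h1 hij
      exact Nat.lt_of_count_lt_count (p := V) (by omega)
    · exact absurd (hE.1 h1) g1
    · exact absurd (hE.2 g1) h1
    · have := Nat.count_strict_mono (p := fun k => ¬ E k) h1 hij
      exact Nat.lt_of_count_lt_count (p := fun k => ¬ V k) (by omega)
  rintro ⟨i, j, k, hij, hjk, h1, h2⟩
  have hij' := mt (key i j hij) (by omega)
  have hjk' := mt (key j k hjk) (by omega)
  have hik' := mt (key i k (by omega)) (by omega)
  tauto

lemma exists_excedanceWord_eq {n : ℕ} {s : ℕ → Bool × Bool} (hs : GoodWord n 0 none s) :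
    ∃ σ : Equiv.Perm ℕ, (∀ i, n ≤ i → σ i = i) ∧ ¬ HasDecr σ ∧ ¬ HasHexagon σ ∧
      excedanceWord σ = s := by
  have hbal : ∀ m, n ≤ m → openCount s m = closeCount s m := by
    intro m hm
    induction m, hm using Nat.le_induction with
    | base => simpa using hs.balanced
    | succ m hm ih =>
      unfold openCount closeCount at ih ⊢
      simp [Nat.count_succ, hs.support m hm, ih]
  obtain ⟨σ, hσ⟩ := exists_perm_sameRank (E := fun j => (s j).1 = true)
    (V := fun j => (s j).2 = true) hbal
  have hdecr := not_hasDecr_of_sameRank hσ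
  have hsupp : ∀ i, n ≤ i → σ i = i := fun i hi => by
    refine (hσ i).unique (Or.inr ⟨?_, ?_, ?_⟩)
    · simp [hs.support i hi]
    · simp [hs.support i hi]
    · have h1 := count_add_count_not (fun j => (s j).1 = true) i
      have h2 := count_add_count_not (fun j => (s j).2 = true) i
      have h3 := hbal i hi
      unfold openCount closeCount at h3
      beta_reduce
      omega
  have hexc : ∀ i, i < σ i ↔ (s i).1 = true := by
    intro i
    rcases hσ i with ⟨h1, h2, h3⟩ | ⟨h1, h2, h3⟩
    · refine iff_of_true ?_ h1
      have := hs.close_le (σ i)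
      unfold openCount closeCount at this
      rw [Nat.count_succ, if_pos h2] at this
      exact Nat.lt_of_count_lt_count (p := fun j => (s j).1 = true) (by omega)
    · refine iff_of_false (fun hlt => ?_) h1
      have h4 := Nat.count_strict_mono (p := fun k => ¬ (s k).1 = true) h1 hlt
      have h5 := hs.close_le (σ i)
      unfold openCount closeCount at h5
      rw [Nat.count_succ] at h5
      have h6 := count_add_count_not (fun j => (s j).1 = true) (σ i)
      have h7 := count_add_count_not (fun j => (s j).2 = true) (σ i)
      beta_reduce at h3
      omega
  have hword : excedanceWord σ = s := by
    funext i
    have h2 : σ.symm i < i ↔ (s i).2 = true := by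
      have h3 := hexc (σ.symm i)
      rw [Equiv.apply_symm_apply] at h3
      rw [h3]
      have h4 := hσ (σ.symm i)
      rw [Equiv.apply_symm_apply] at h4
      rcases h4 with h | h <;> simp [h.1, h.2.1]
    ext1
    · simp [excedanceWord, hexc i]
    · simp [excedanceWord, h2]
  exact ⟨σ, hsupp, hdecr, fun hex => not_goodWord_of_hasHexagon hdecr hex n (hword ▸ hs), hword⟩

end Reconstruction

/-- The permutations of `ℕ` fixing every `i ≥ n` without decreasing triples and hexagons are
equinumerous with the good words of length `n`. -/
lemma card_perm_nat (n : ℕ) :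
    Nat.card {σ : Equiv.Perm ℕ // (∀ i, n ≤ i → σ i = i) ∧ ¬ HasDecr σ ∧ ¬ HasHexagon σ} =
      goodCount n 0 none := by
  refine Nat.card_congr (Equiv.ofBijective
    (fun σ => ⟨excedanceWord σ.1, goodWord_excedanceWord σ.2.1 σ.2.2.1 σ.2.2.2⟩) ⟨?_, ?_⟩)
  · intro σ τ h
    exact Subtype.ext (eq_of_excedanceWord_eq σ.2.2.1 τ.2.2.1 (Subtype.mk.inj h))
  · rintro ⟨s, hs⟩
    obtain ⟨σ, h1, h2, h3, h4⟩ := exists_excedanceWord_eq hs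
    exact ⟨⟨σ, h1, h2, h3⟩, Subtype.ext h4⟩

section Transfer

/-- Extend a permutation of `Fin n` to a permutation of `ℕ` fixing every `i ≥ n`. -/
def extendEquiv (n : ℕ) :
    Equiv.Perm (Fin n) ≃ {σ : Equiv.Perm ℕ // ∀ i, ¬ i < n → σ i = i} :=
  (Equiv.permCongr Fin.equivSubtype).trans (Equiv.Perm.subtypeEquivSubtypePerm (· < n))

lemma extendEquiv_apply {n : ℕ} (α : Equiv.Perm (Fin n)) (i : Fin n) :
    (extendEquiv n α).1 i = α i := by
  simp only [extendEquiv, Equiv.trans_apply]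
  rw [Equiv.Perm.subtypeEquivSubtypePerm_apply_of_mem (p := (· < n)) _ i.2]
  simp [Equiv.permCongr_apply, Fin.equivSubtype]

lemma lt_of_inversion {n : ℕ} {σ : Equiv.Perm ℕ} (h : ∀ i, ¬ i < n → σ i = i) {i j : ℕ}
    (hij : i < j) (hinv : σ j < σ i) : j < n := by
  by_contra hj
  have h1 := h j hj
  have := σ.injective (h (σ i) (by omega))
  omega

lemma exists_fin_val_eq {n i : ℕ} (h : i < n) : ∃ j : Fin n, (j : ℕ) = i := ⟨⟨i, h⟩, rfl⟩

/-- The pattern `w` is contained in `α` if there are increasing positions at which the values of `α` increase when read in the order given by `τ`, the inverse of `w`. -/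
lemma containsPattern_of_chain {n k : ℕ} (α : Equiv.Perm (Fin n)) (w : List ℕ)
    (τ : Fin k → Fin w.length) (hτ : ∀ i, w.get (τ i) = i + 1) (hsurj : Function.Surjective τ)
    (f : Fin w.length → Fin n) (hf : StrictMono f)
    (hα : StrictMono fun i => α (f (τ i))) : ContainsPattern α w := by
  refine ⟨f, hf, fun a b => ?_⟩
  obtain ⟨i, rfl⟩ := hsurj a
  obtain ⟨j, rfl⟩ := hsurj b
  rw [hτ, hτ, hα.lt_iff_lt]
  simp

lemma containsPattern_decr_iff {n : ℕ} (α : Equiv.Perm (Fin n)) :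
    ContainsPattern α [3, 2, 1] ↔ HasDecr (extendEquiv n α).1 := by
  have hα := extendEquiv_apply α
  constructor
  · rintro ⟨f, hf, h⟩
    refine ⟨f (0 : Fin 3), f (1 : Fin 3), f (2 : Fin 3), hf (by decide), hf (by decide), ?_, ?_⟩ <;>
    rw [hα, hα, Fin.val_fin_lt]
    · exact (h (2 : Fin 3) (1 : Fin 3)).1 (by decide)
    · exact (h (1 : Fin 3) (0 : Fin 3)).1 (by decide)
  · rintro ⟨i, j, k, hij, hjk, h1, h2⟩
    have hk := lt_of_inversion (extendEquiv n α).2 hjk h1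
    obtain ⟨i, rfl⟩ := exists_fin_val_eq (show i < n by omega)
    obtain ⟨j, rfl⟩ := exists_fin_val_eq (show j < n by omega)
    obtain ⟨k, rfl⟩ := exists_fin_val_eq (show k < n by omega)
    simp only [hα, Fin.val_fin_lt] at hij hjk h1 h2
    refine containsPattern_of_chain α _ (![2, 1, 0] : Fin 3 → Fin 3) (by decide) (by decide)
      (![i, j, k] : Fin 3 → Fin n) ?_ ?_ <;>
    refine Fin.strictMono_iff_lt_succ.2 fun a => ?_ <;> fin_cases a <;> assumption

lemma hasHexagon_of_containsPattern {n : ℕ} {α : Equiv.Perm (Fin n)} {w : List ℕ}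
    (a b : Fin 4 → Fin w.length)
    (hpos : (a 0 < a 1 ∧ a 1 < a 2 ∧ a 2 < a 3) ∧ (b 0 < b 1 ∧ b 1 < b 2 ∧ b 2 < b 3) ∧
      (a 2 < b 0 ∧ a 3 < b 1))
    (hval : (w.get (a 0) < w.get (a 1) ∧ w.get (a 1) < w.get (a 2) ∧ w.get (a 2) < w.get (a 3)) ∧
      (w.get (b 0) < w.get (b 1) ∧ w.get (b 1) < w.get (b 2) ∧ w.get (b 2) < w.get (b 3)) ∧
      (w.get (b 2) < w.get (a 0) ∧ w.get (b 3) < w.get (a 1)))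
    (hw : ContainsPattern α w) : HasHexagon (extendEquiv n α).1 := by
  obtain ⟨f, hf, h⟩ := hw
  refine ⟨f (a 0), f (a 1), f (a 2), f (a 3), f (b 0), f (b 1), f (b 2), f (b 3), ?_⟩
  simp only [extendEquiv_apply, Fin.val_fin_lt, hf.lt_iff_lt, ← h]
  exact ⟨hpos.1, hpos.2.1, hpos.2.2, hval⟩

lemma containsPattern_hexagon_iff {n : ℕ} (α : Equiv.Perm (Fin n)) :
    (ContainsPattern α [4,6,7,1,8,2,3,5] ∨ ContainsPattern α [4,6,7,8,1,2,3,5] ∨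
      ContainsPattern α [5,6,7,1,8,2,3,4] ∨ ContainsPattern α [5,6,7,8,1,2,3,4]) ↔
      HasHexagon (extendEquiv n α).1 := by
  constructor
  · rintro (h | h | h | h)
    · exact hasHexagon_of_containsPattern (w := [4,6,7,1,8,2,3,5])
        (![0, 1, 2, 4] : Fin 4 → Fin 8) (![3, 5, 6, 7] : Fin 4 → Fin 8) (by decide) (by decide) h
    · exact hasHexagon_of_containsPattern (w := [4,6,7,8,1,2,3,5])
        (![0, 1, 2, 3] : Fin 4 → Fin 8) (![4, 5, 6, 7] : Fin 4 → Fin 8) (by decide) (by decide) h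
    · exact hasHexagon_of_containsPattern (w := [5,6,7,1,8,2,3,4])
        (![0, 1, 2, 4] : Fin 4 → Fin 8) (![3, 5, 6, 7] : Fin 4 → Fin 8) (by decide) (by decide) h
    · exact hasHexagon_of_containsPattern (w := [5,6,7,8,1,2,3,4])
        (![0, 1, 2, 3] : Fin 4 → Fin 8) (![4, 5, 6, 7] : Fin 4 → Fin 8) (by decide) (by decide) h
  · rintro ⟨a₁, a₂, a₃, a₄, b₁, b₂, b₃, b₄, ⟨a₁₂, a₂₃, a₃₄⟩, ⟨b₁₂, b₂₃, b₃₄⟩, ⟨h₃₁, h₄₂⟩,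
      ⟨A₁₂, A₂₃, A₃₄⟩, ⟨B₁₂, B₂₃, B₃₄⟩, ⟨H₃₁, H₄₂⟩⟩
    have hb₄ := lt_of_inversion (extendEquiv n α).2 (show a₂ < b₄ by omega) (by omega)
    obtain ⟨a₁, rfl⟩ := exists_fin_val_eq (show a₁ < n by omega)
    obtain ⟨a₂, rfl⟩ := exists_fin_val_eq (show a₂ < n by omega)
    obtain ⟨a₃, rfl⟩ := exists_fin_val_eq (show a₃ < n by omega)
    obtain ⟨a₄, rfl⟩ := exists_fin_val_eq (show a₄ < n by omega)
    obtain ⟨b₁, rfl⟩ := exists_fin_val_eq (show b₁ < n by omega)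
    obtain ⟨b₂, rfl⟩ := exists_fin_val_eq (show b₂ < n by omega)
    obtain ⟨b₃, rfl⟩ := exists_fin_val_eq (show b₃ < n by omega)
    obtain ⟨b₄, rfl⟩ := exists_fin_val_eq (show b₄ < n by omega)
    simp only [extendEquiv_apply, Fin.val_fin_lt] at *
    have hne : a₄ ≠ b₁ := by
      rintro rfl
      omega
    have hne' : α a₁ ≠ α b₄ := fun h => by
      have := α.injective h
      omega
    rcases lt_or_gt_of_ne hne with hp | hp <;> rcases lt_or_gt_of_ne hne' with hv | hv
    · refine Or.inr (Or.inl (containsPattern_of_chain α _ (![4, 5, 6, 0, 7, 1, 2, 3] : Fin 8 → Fin 8)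
        (by decide) (by decide) (![a₁, a₂, a₃, a₄, b₁, b₂, b₃, b₄] : Fin 8 → Fin n) ?_ ?_)) <;>
      refine Fin.strictMono_iff_lt_succ.2 fun i => ?_ <;> fin_cases i <;> assumption
    · refine Or.inr (Or.inr (Or.inr (containsPattern_of_chain α _
        (![4, 5, 6, 7, 0, 1, 2, 3] : Fin 8 → Fin 8)
        (by decide) (by decide) (![a₁, a₂, a₃, a₄, b₁, b₂, b₃, b₄] : Fin 8 → Fin n) ?_ ?_))) <;>
      refine Fin.strictMono_iff_lt_succ.2 fun i => ?_ <;> fin_cases i <;> assumption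
    · refine Or.inl (containsPattern_of_chain α _ (![3, 5, 6, 0, 7, 1, 2, 4] : Fin 8 → Fin 8)
        (by decide) (by decide) (![a₁, a₂, a₃, b₁, a₄, b₂, b₃, b₄] : Fin 8 → Fin n) ?_ ?_) <;>
      refine Fin.strictMono_iff_lt_succ.2 fun i => ?_ <;> fin_cases i <;> assumption
    · refine Or.inr (Or.inr (Or.inl (containsPattern_of_chain α _
        (![3, 5, 6, 7, 0, 1, 2, 4] : Fin 8 → Fin 8)
        (by decide) (by decide) (![a₁, a₂, a₃, b₁, a₄, b₂, b₃, b₄] : Fin 8 → Fin n) ?_ ?_))) <;>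
      refine Fin.strictMono_iff_lt_succ.2 fun i => ?_ <;> fin_cases i <;> assumption

end Transfer

lemma f4_eq_goodCount (n : ℕ) : f4 n = goodCount n 0 none := by
  rw [← card_perm_nat, f4]
  refine Nat.card_congr (((extendEquiv n).subtypeEquiv (q := fun σ => ¬ HasDecr σ.1 ∧
    ¬ HasHexagon σ.1) fun α => ?_).trans ((Equiv.subtypeSubtypeEquivSubtypeInter _
      (fun σ => ¬ HasDecr σ ∧ ¬ HasHexagon σ)).trans (Equiv.subtypeEquivRight fun σ => ?_)))
  · rw [← containsPattern_hexagon_iff, ← containsPattern_decr_iff]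
    simp only [AvoidsPattern, not_or]
  · simp only [not_lt]

/-- For `n ≥ 6`,
`f_4(n) = 6f_4(n−1) − 11f_4(n−2) + 9f_4(n−3) − 4f_4(n−4) − 4f_4(n−5) + f_4(n−6)`. -/
theorem f4_recurrence (n : ℕ) (hn : 6 ≤ n) :
    (f4 n : ℤ) = 6 * f4 (n-1) - 11 * f4 (n-2) + 9 * f4 (n-3) - 4 * f4 (n-4)
      - 4 * f4 (n-5) + f4 (n-6) := by
  obtain ⟨m, rfl⟩ := Nat.exists_eq_add_of_le' hn
  simp only [f4_eq_goodCount]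
  exact goodCount_recurrence m
end

section
/- Let k ≥ 3, n ≥ 3, 1 ≤ m ≤ n−2 and 3 ≤ i_1 < i_2 < ⋯ < i_m ≤ n. Then f_k(n; i_1,…,i_m, j) = 0 for every j with 2 ≤ j ≤ i_m − 1 and j ∉ {i_1,…,i_m}. Consequently, f_k(n; i_1,…,i_m) = f_k(n; i_1,…,i_m, 1) + Σ_{j=i_m+1}^{n} f_k(n; i_1,…,i_m, j). -/
theorem startsWith_append_singleton {n : ℕ} (π : Equiv.Perm (Fin n)) (l : List ℕ) (v : ℕ)
    (h : l.length < n) :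
    StartsWith π (l ++ [v]) ↔ StartsWith π l ∧ ((π ⟨l.length, h⟩ : Fin n) : ℕ) + 1 = v := by
  constructor
  · intro H
    refine ⟨fun j hj => ?_, ?_⟩
    · have := H ⟨j, by simp⟩ hj
      simpa using this
    · have := H ⟨l.length, by simp⟩ h
      simpa using this
  · rintro ⟨H, hv⟩ ⟨j, hjl⟩ hj
    rcases Nat.lt_or_ge j l.length with hlt | hge
    · have := H ⟨j, hlt⟩ hj
      simpa [List.getElem_append_left hlt] using this
    · obtain rfl : j = l.length := by
        simp at hjl
        omega
      simpa using hv

/-- Classifying the permutations counted by `fstart k n l` by their next entry. -/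
theorem fstart_eq_sum_append (k n : ℕ) (l : List ℕ) (h : l.length < n) :
    fstart k n l = ∑ v ∈ Finset.Icc 1 n, fstart k n (l ++ [v]) := by
  classical
  simp only [fstart, Nat.card_eq_fintype_card, Fintype.card_subtype]
  rw [Finset.card_eq_sum_card_fiberwise (t := Finset.Icc 1 n)
    (f := fun π : Equiv.Perm (Fin n) => ((π ⟨l.length, h⟩ : Fin n) : ℕ) + 1)]
  · refine Finset.sum_congr rfl fun v _ => ?_
    rw [Finset.filter_filter]
    congr 1
    ext π
    simp [startsWith_append_singleton π l v h, and_assoc]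
  · intro π _
    simp only [Finset.coe_Icc, Set.mem_Icc]
    omega

theorem containsPattern_321 {n : ℕ} {π : Equiv.Perm (Fin n)} {a b c : Fin n}
    (hab : a < b) (hbc : b < c) (h₁ : π b < π a) (h₂ : π c < π b) :
    ContainsPattern π [3, 2, 1] := by
  have h₃ := h₂.trans h₁
  refine ⟨![a, b, c], ?_, ?_⟩
  · refine Fin.strictMono_iff_lt_succ.2 fun j => ?_
    fin_cases j
    · exact hab
    · exact hbc
  · intro x y
    change Fin 3 at x y
    fin_cases x <;> fin_cases y <;> simp [h₁, h₂, h₃, h₁.le, h₂.le, h₃.le]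

theorem StartsWith.apply_ofFn {n m : ℕ} {π : Equiv.Perm (Fin n)} {i : Fin m → ℕ}
    (H : StartsWith π (List.ofFn i)) (a : Fin m) (h : (a : ℕ) < n) :
    ((π ⟨a, h⟩ : Fin n) : ℕ) + 1 = i a := by
  simpa using H ⟨a, by simp⟩ h

theorem fstart_append_eq_zero_of_mem (k n m : ℕ) (hmn : m < n) (i : Fin m → ℕ) (a : Fin m) :
    fstart k n (List.ofFn i ++ [i a]) = 0 := by
  rw [fstart, Nat.card_eq_zero]
  refine Or.inl ⟨fun ⟨π, _, H⟩ => ?_⟩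
  rw [startsWith_append_singleton _ _ _ (by simpa using hmn)] at H
  have ha := H.1.apply_ofFn a (by omega)
  have hval := π.injective (Fin.ext (Nat.add_right_cancel (ha.trans H.2.symm)))
  simp [Fin.ext_iff] at hval
  omega

/-- A descent from `i a` to `j`, with every entry so far at least `2`, leaves `1` to the right
and hence creates a `321`. -/
theorem fstart_append_eq_zero_of_lt (k n m : ℕ) (hmn : m < n) (i : Fin m → ℕ)
    (hlb : ∀ b, 2 ≤ i b) (a : Fin m) (j : ℕ) (hj : 2 ≤ j) (hja : j < i a) :
    fstart k n (List.ofFn i ++ [j]) = 0 := by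
  rw [fstart, Nat.card_eq_zero]
  refine Or.inl ⟨fun ⟨π, hπ, H⟩ => hπ.1 ?_⟩
  rw [startsWith_append_singleton _ _ _ (by simpa using hmn)] at H
  obtain ⟨H, hm⟩ := H
  simp only [List.length_ofFn] at hm
  obtain ⟨p, hp⟩ := π.surjective ⟨0, by omega⟩
  have hp0 : ((π p : Fin n) : ℕ) = 0 := by rw [hp]
  have ha := H.apply_ofFn a (by omega)
  have hmp : m < (p : ℕ) := by
    rcases lt_trichotomy (p : ℕ) m with hlt | heq | hgt
    · have h₁ := H.apply_ofFn ⟨p, hlt⟩ p.2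
      have h₂ := hlb ⟨p, hlt⟩
      simp only [Fin.eta] at h₁
      omega
    · subst heq
      simp only [Fin.eta] at hm
      omega
    · exact hgt
  refine containsPattern_321 (a := ⟨a, by omega⟩) (b := ⟨m, hmn⟩) (c := p) ?_ ?_ ?_ ?_
  · exact a.2
  · exact hmp
  · rw [Fin.lt_def]; omega
  · rw [Fin.lt_def]; omega

/-- Lemma: for `k ≥ 3`, `n ≥ 3`, `1 ≤ m ≤ n−2` and `3 ≤ i₁ < ⋯ < i_m ≤ n`:
`f_k(n; i₁,…,i_m, j) = 0` for `2 ≤ j ≤ i_m − 1` with `j ∉ {i₁,…,i_m}`; consequently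
`f_k(n; i₁,…,i_m) = f_k(n; i₁,…,i_m, 1) + Σ_{j=i_m+1}^{n} f_k(n; i₁,…,i_m, j)`. -/
theorem fstart_append_split (k n m : ℕ) (hk : 3 ≤ k) (hn : 3 ≤ n)
    (hm1 : 1 ≤ m) (hm2 : m ≤ n - 2) (i : Fin m → ℕ) (hi : StrictMono i)
    (hlb : 3 ≤ i ⟨0, by omega⟩) (hub : i ⟨m-1, by omega⟩ ≤ n) :
    (∀ j : ℕ, 2 ≤ j → j ≤ i ⟨m-1, by omega⟩ - 1 → (∀ a : Fin m, i a ≠ j) →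
        fstart k n (List.ofFn i ++ [j]) = 0) ∧
      fstart k n (List.ofFn i) =
        fstart k n (List.ofFn i ++ [1]) +
          ∑ j ∈ Finset.Icc (i ⟨m-1, by omega⟩ + 1) n, fstart k n (List.ofFn i ++ [j]) := by
  have hmn : m < n := by omega
  have hlb' : ∀ b, 2 ≤ i b := fun b =>
    le_trans (by omega) (hi.monotone (show (⟨0, by omega⟩ : Fin m) ≤ b from Nat.zero_le _))
  have hzero : ∀ j : ℕ, 2 ≤ j → j < i ⟨m-1, by omega⟩ →
      fstart k n (List.ofFn i ++ [j]) = 0 := fun j hj hlt =>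
    fstart_append_eq_zero_of_lt k n m hmn i hlb' _ j hj hlt
  refine ⟨fun j hj hlt _ => hzero j hj (by omega), ?_⟩
  have hlast := hlb' ⟨m-1, by omega⟩
  rw [fstart_eq_sum_append k n _ (by simpa using hmn),
    ← Finset.add_sum_Ioc_eq_sum_Icc (by omega : 1 ≤ n)]
  congr 1
  symm
  refine Finset.sum_subset (fun j hj => ?_) fun j hj hj' => ?_
  · simp only [Finset.mem_Icc, Finset.mem_Ioc] at *
    omega
  · simp only [Finset.mem_Icc, Finset.mem_Ioc] at *
    rcases Nat.lt_or_ge j (i ⟨m-1, by omega⟩) with hlt | hge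
    · exact hzero j (by omega) hlt
    · have hji : j = i ⟨m-1, Nat.sub_one_lt_of_lt hm1⟩ := by omega
      rw [hji]
      exact fstart_append_eq_zero_of_mem k n m hmn i _
end

section
/- Let k ≥ 3, n ≥ 3, 1 ≤ m ≤ min{k−3, n−1} and 2 ≤ i_1 < i_2 < ⋯ < i_m ≤ n. Then f_k(n; i_1,…,i_m, 1) = f_k(n−1; i_1−1,…,i_m−1). -/
/-- The permutation obtained from `σ` by inserting a new least entry at position `p`. -/
def insertLeast {n : ℕ} (p : Fin (n + 1)) (σ : Equiv.Perm (Fin n)) :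
    Equiv.Perm (Fin (n + 1)) :=
  ((finSuccEquiv' p).trans (Equiv.optionCongr σ)).trans (finSuccEquiv' 0).symm

theorem insertLeast_self {n : ℕ} (p : Fin (n + 1)) (σ : Equiv.Perm (Fin n)) :
    insertLeast p σ p = 0 := by
  simp [insertLeast]

theorem insertLeast_succAbove {n : ℕ} (p : Fin (n + 1)) (σ : Equiv.Perm (Fin n)) (j : Fin n) :
    insertLeast p σ (p.succAbove j) = (σ j).succ := by
  simp [insertLeast]

theorem insertLeast_injective {n : ℕ} (p : Fin (n + 1)) :
    Function.Injective (insertLeast p) := by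
  intro σ τ h
  ext j
  have hj := congrArg (fun π : Equiv.Perm (Fin (n + 1)) => π (p.succAbove j)) h
  simp only [insertLeast_succAbove] at hj
  exact congrArg Fin.val (Fin.succ_injective _ hj)

theorem exists_insertLeast_eq {n : ℕ} {p : Fin (n + 1)} {π : Equiv.Perm (Fin (n + 1))}
    (h : π p = 0) : ∃ σ, insertLeast p σ = π := by
  set e : Option (Fin n) ≃ Option (Fin n) :=
    ((finSuccEquiv' p).symm.trans π).trans (finSuccEquiv' 0) with he
  have hnone : e none = none := by simp [he, h]
  refine ⟨Equiv.removeNone e, ?_⟩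
  have hcongr : Equiv.optionCongr (Equiv.removeNone e) = e := by
    ext1 x
    cases x with
    | none => simp [hnone]
    | some x =>
      have hx : e (some x) ≠ none := fun hx => by
        have := e.injective (hx.trans hnone.symm)
        simp at this
      obtain ⟨y, hy⟩ := Option.ne_none_iff_exists'.1 hx
      exact Equiv.removeNone_some e ⟨y, hy⟩
  rw [insertLeast, hcongr]
  ext1 x
  simp [he]

theorem ContainsPattern.insertLeast {n : ℕ} {σ : Equiv.Perm (Fin n)} {w : List ℕ}
    (h : ContainsPattern σ w) (p : Fin (n + 1)) : ContainsPattern (insertLeast p σ) w := by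
  obtain ⟨f, hf, hw⟩ := h
  refine ⟨fun a => p.succAbove (f a), (Fin.strictMono_succAbove p).comp hf, fun a b => ?_⟩
  simp only [insertLeast_succAbove, Fin.succ_lt_succ_iff]
  exact hw a b

/-- An occurrence of a pattern that does not use the inserted entry survives its removal. -/
theorem containsPattern_of_insertLeast {n : ℕ} {σ : Equiv.Perm (Fin n)} {w : List ℕ}
    {p : Fin (n + 1)} {f : Fin w.length → Fin (n + 1)} (hf : StrictMono f)
    (hw : ∀ a b : Fin w.length,
      w.get a < w.get b ↔ insertLeast p σ (f a) < insertLeast p σ (f b))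
    (hp : ∀ a, f a ≠ p) : ContainsPattern σ w := by
  choose g hg using fun a => Fin.exists_succAbove_eq (hp a)
  refine ⟨g, fun a b hab => ?_, fun a b => ?_⟩
  · have := hf hab
    rwa [← hg a, ← hg b, (Fin.strictMono_succAbove p).lt_iff_lt] at this
  · rw [hw a b, ← hg a, ← hg b]
    simp only [insertLeast_succAbove, Fin.succ_lt_succ_iff]

/-- If no entry among the first `p + 1` entries of a pattern is its minimum, then inserting
a least entry at position `p` preserves avoidance of that pattern. -/
theorem AvoidsPattern.insertLeast_of_exists_lt {n : ℕ} {σ : Equiv.Perm (Fin n)} {w : List ℕ}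
    {p : Fin (n + 1)} (h : AvoidsPattern σ w)
    (hw : ∀ a : Fin w.length, (a : ℕ) ≤ p → ∃ b, w.get b < w.get a) :
    AvoidsPattern (insertLeast p σ) w := by
  rintro ⟨f, hf, hfw⟩
  refine h (containsPattern_of_insertLeast hf hfw fun a ha => ?_)
  have hle : ∀ (c : ℕ) (hc : c < w.length), c ≤ (f ⟨c, hc⟩ : ℕ) := by
    intro c
    induction c with
    | zero => intro _; exact Nat.zero_le _
    | succ c ih =>
      intro hc
      have hlt : f ⟨c, by omega⟩ < f ⟨c + 1, hc⟩ := hf (by simp [Fin.lt_def])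
      have := ih (by omega)
      rw [Fin.lt_def] at hlt
      omega
  obtain ⟨b, hb⟩ := hw a (by simpa [ha] using hle a a.2)
  have := (hfw b a).1 hb
  rw [ha, insertLeast_self] at this
  exact Fin.not_lt_zero _ this

theorem AvoidsPattern.insertLeast_of_monotone {n : ℕ} {σ : Equiv.Perm (Fin n)}
    {p : Fin (n + 1)} (h : AvoidsPattern σ [3, 2, 1])
    (hσ : ∀ a b : Fin n, a < b → (b : ℕ) < p → σ a < σ b) :
    AvoidsPattern (insertLeast p σ) [3, 2, 1] := by
  rintro ⟨f, hf, hfw⟩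
  refine h (containsPattern_of_insertLeast hf hfw fun a ha => ?_)
  have h01 : f 0 < f 1 := hf (by decide)
  have h12 : f 1 < f 2 := hf (by decide)
  have v10 := (hfw 1 0).1 (by decide)
  have v21 := (hfw 2 1).1 (by decide)
  have ha2 : f 2 = p := by
    have : a = 0 ∨ a = 1 ∨ a = 2 := by
      clear ha
      revert a
      decide
    rcases this with rfl | rfl | rfl
    · rw [ha, insertLeast_self] at v10
      exact absurd v10 (Fin.not_lt_zero _)
    · rw [ha, insertLeast_self] at v21
      exact absurd v21 (Fin.not_lt_zero _)
    · exact ha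
  rw [ha2] at h12
  obtain ⟨x, hx⟩ := Fin.exists_succAbove_eq (h01.trans h12).ne
  obtain ⟨y, hy⟩ := Fin.exists_succAbove_eq h12.ne
  rw [← hx, ← hy, (Fin.strictMono_succAbove p).lt_iff_lt] at h01
  rw [← hx, ← hy, insertLeast_succAbove, insertLeast_succAbove, Fin.succ_lt_succ_iff] at v10
  have hyp : (y : ℕ) < p := by
    rw [← hy, Fin.succAbove_lt_iff_castSucc_lt] at h12
    exact h12
  exact absurd (hσ x y h01 hyp) v10.not_gt

theorem one_mem_gonPattern {k a : ℕ} (hk : 1 ≤ k) (s : Bool) : 1 ∈ gonPattern k a s := by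
  by_cases h : 1 ∈ a :: (List.range' (k+2) (k-2) ++ (if s then [1, 2*k] else [2*k]))
  · exact List.mem_append_left _ h
  · refine List.mem_append_right _ (List.mem_filter.2 ⟨?_, ?_⟩)
    · rw [List.mem_range'_1]; omega
    · simpa using h

theorem one_lt_gonPattern_get {k a : ℕ} (ha : 2 ≤ a) (s : Bool)
    (c : Fin (gonPattern k a s).length) (hc : (c : ℕ) < k - 2) :
    1 < (gonPattern k a s).get c := by
  have hsplit : ∃ r, gonPattern k a s = (a :: List.range' (k+2) (k-2)) ++ r := by
    simp [gonPattern]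
  obtain ⟨r, hr⟩ := hsplit
  have hlen : (c : ℕ) < (a :: List.range' (k+2) (k-2)).length := by simp; omega
  have hget : (gonPattern k a s).get c = (a :: List.range' (k+2) (k-2))[(c : ℕ)] := by
    simp only [List.get_eq_getElem, hr]
    exact List.getElem_append_left hlen
  have hmem := List.getElem_mem hlen
  rw [← hget, List.mem_cons, List.mem_range'_1] at hmem
  omega

theorem AvoidsPattern.insertLeast_gonPattern {n k a : ℕ} {s : Bool} {σ : Equiv.Perm (Fin n)}
    {p : Fin (n + 1)} (h : AvoidsPattern σ (gonPattern k a s)) (ha : 2 ≤ a)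
    (hp : (p : ℕ) < k - 2) : AvoidsPattern (insertLeast p σ) (gonPattern k a s) := by
  refine h.insertLeast_of_exists_lt fun c hc => ?_
  obtain ⟨b, hb⟩ := List.get_of_mem (one_mem_gonPattern (k := k) (a := a) (by omega) s)
  exact ⟨b, hb ▸ one_lt_gonPattern_get ha s c (by omega)⟩

theorem avoids321Gon_insertLeast_iff {n k : ℕ} {σ : Equiv.Perm (Fin n)} {p : Fin (n + 1)}
    (hp : (p : ℕ) < k - 2) (hσ : ∀ a b : Fin n, a < b → (b : ℕ) < p → σ a < σ b) :
    Avoids321Gon k (insertLeast p σ) ↔ Avoids321Gon k σ := by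
  constructor
  · rintro ⟨h₁, h₂, h₃, h₄, h₅⟩
    exact ⟨fun h => h₁ (h.insertLeast p), fun h => h₂ (h.insertLeast p),
      fun h => h₃ (h.insertLeast p), fun h => h₄ (h.insertLeast p),
      fun h => h₅ (h.insertLeast p)⟩
  · rintro ⟨h₁, h₂, h₃, h₄, h₅⟩
    exact ⟨h₁.insertLeast_of_monotone hσ, h₂.insertLeast_gonPattern (by omega) hp,
      h₃.insertLeast_gonPattern (by omega) hp, h₄.insertLeast_gonPattern (by omega) hp,
      h₅.insertLeast_gonPattern (by omega) hp⟩

theorem startsWith_iff_getElem {n : ℕ} {π : Equiv.Perm (Fin n)} {l : List ℕ} :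
    StartsWith π l ↔
      ∀ (j : ℕ) (hj : j < l.length) (hn : j < n), (π ⟨j, hn⟩ : ℕ) + 1 = l[j] :=
  ⟨fun h j hj hn => h ⟨j, hj⟩ hn, fun h j hn => h j j.2 hn⟩

theorem startsWith_append_one_iff {n : ℕ} {π : Equiv.Perm (Fin (n + 1))} {l : List ℕ}
    (hl : l.length < n + 1) :
    StartsWith π (l ++ [1]) ↔ StartsWith π l ∧ π ⟨l.length, hl⟩ = 0 := by
  simp only [startsWith_iff_getElem]
  constructor
  · intro h
    refine ⟨fun j hj hn => ?_, ?_⟩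
    · rw [h j (by simp; omega) hn, List.getElem_append_left hj]
    · have := h l.length (by simp) hl
      rw [List.getElem_concat_length rfl] at this
      exact Fin.ext (by simpa using this)
  · rintro ⟨h, h0⟩ j hj hn
    rcases Nat.lt_or_ge j l.length with hlt | hge
    · rw [h j hlt hn, List.getElem_append_left hlt]
    · obtain rfl : j = l.length := by simp at hj; omega
      rw [List.getElem_concat_length rfl, h0]
      rfl

theorem startsWith_insertLeast_iff {n m : ℕ} {σ : Equiv.Perm (Fin n)} (hm : m < n + 1)
    {i : Fin m → ℕ} (hi : ∀ a, 2 ≤ i a) :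
    StartsWith (insertLeast ⟨m, hm⟩ σ) (List.ofFn i) ↔
      StartsWith σ (List.ofFn fun a => i a - 1) := by
  have hval : ∀ (j : ℕ) (hj : j < m),
      (insertLeast ⟨m, hm⟩ σ ⟨j, by omega⟩ : ℕ) = (σ ⟨j, by omega⟩ : ℕ) + 1 := by
    intro j hj
    have hs : (⟨m, hm⟩ : Fin (n + 1)).succAbove ⟨j, by omega⟩ = ⟨j, by omega⟩ :=
      Fin.succAbove_of_castSucc_lt _ _ (by simpa [Fin.lt_def] using hj)
    rw [← hs, insertLeast_succAbove, Fin.val_succ]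
  simp only [startsWith_iff_getElem, List.length_ofFn, List.getElem_ofFn]
  refine forall_congr' fun j => forall_congr' fun hj => ?_
  have := hi ⟨j, hj⟩
  have := hval j hj
  constructor
  · intro h hn
    have := h (by omega)
    omega
  · intro h hn
    have := h (by omega)
    omega

/-- Lemma: for `k ≥ 3`, `n ≥ 3`, `1 ≤ m ≤ min{k−3, n−1}` and `2 ≤ i₁ < ⋯ < i_m ≤ n`:
`f_k(n; i₁,…,i_m, 1) = f_k(n−1; i₁−1,…,i_m−1)`. -/
theorem fstart_append_one (k n m : ℕ) (hk : 3 ≤ k) (hn : 3 ≤ n)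
    (hm1 : 1 ≤ m) (hm2 : m ≤ k - 3) (hm3 : m ≤ n - 1) (i : Fin m → ℕ) (hi : StrictMono i)
    (hlb : 2 ≤ i ⟨0, by omega⟩) (hub : i ⟨m-1, by omega⟩ ≤ n) :
    fstart k n (List.ofFn i ++ [1]) = fstart k (n-1) (List.ofFn (fun a => i a - 1)) := by
  obtain ⟨n, rfl⟩ : ∃ N, n = N + 1 := ⟨n - 1, by omega⟩
  simp only [Nat.add_sub_cancel] at hm3 ⊢
  have hm : m < n + 1 := by omega
  have hi2 : ∀ a, 2 ≤ i a := fun a => hlb.trans (hi.monotone (Nat.zero_le _))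
  have hstart : ∀ π : Equiv.Perm (Fin (n + 1)), StartsWith π (List.ofFn i ++ [1]) ↔
      StartsWith π (List.ofFn i) ∧ π ⟨m, hm⟩ = 0 := fun π => by
    rw [startsWith_append_one_iff (by simpa using hm)]
    simp only [List.length_ofFn]
  have hmono : ∀ σ : Equiv.Perm (Fin n), StartsWith σ (List.ofFn fun a => i a - 1) →
      ∀ a b : Fin n, a < b → (b : ℕ) < m → σ a < σ b := by
    intro σ hσ a b hab hb
    simp only [startsWith_iff_getElem, List.length_ofFn, List.getElem_ofFn] at hσ
    have hab' : (a : ℕ) < b := hab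
    have h₁ := hσ a (by omega) a.2
    have h₂ := hσ b hb b.2
    have h₃ : i ⟨a, by omega⟩ < i ⟨b, hb⟩ := hi hab'
    have := hi2 ⟨a, by omega⟩
    simp only [Fin.eta] at h₁ h₂
    rw [Fin.lt_def]
    omega
  have hiff : ∀ σ : Equiv.Perm (Fin n),
      (Avoids321Gon k (insertLeast ⟨m, hm⟩ σ) ∧
        StartsWith (insertLeast ⟨m, hm⟩ σ) (List.ofFn i ++ [1])) ↔
      (Avoids321Gon k σ ∧ StartsWith σ (List.ofFn fun a => i a - 1)) := fun σ => by
    rw [hstart, startsWith_insertLeast_iff hm hi2, and_iff_left (insertLeast_self _ σ)]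
    exact and_congr_left fun hσ =>
      avoids321Gon_insertLeast_iff (show m < k - 2 by omega) (hmono σ hσ)
  refine (Nat.card_congr (Equiv.ofBijective
    (fun σ => ⟨insertLeast ⟨m, hm⟩ σ.1, (hiff σ.1).2 σ.2⟩) ⟨fun σ τ h => ?_, ?_⟩)).symm
  · exact Subtype.ext (insertLeast_injective _ (congrArg Subtype.val h))
  · rintro ⟨π, hπ⟩
    obtain ⟨σ, rfl⟩ := exists_insertLeast_eq ((hstart π).1 hπ.2).2
    exact ⟨⟨σ, (hiff σ).1 hπ⟩, rfl⟩
end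

section
/- Let k ≥ 3 and let 1 ≤ s ≤ min{k−1, n}. Then f_k(n; s) = Σ_{j=0}^{s−1} (−1)^j binom(s−1−j, j) f_k(n−1−j), where binom(a,b) denotes the binomial coefficient, equal to 0 when b > a. -/
/-- The permutation sending `p` to `q` whose remaining entries are order-isomorphic to `σ`. -/
def insertEntry {n : ℕ} (p q : Fin (n + 1)) (σ : Equiv.Perm (Fin n)) : Equiv.Perm (Fin (n + 1)) :=
  (finSuccEquiv' p).trans (σ.optionCongr.trans (finSuccEquiv' q).symm)

@[simp]
lemma insertEntry_self {n : ℕ} (p q : Fin (n + 1)) (σ : Equiv.Perm (Fin n)) :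
    insertEntry p q σ p = q := by
  simp [insertEntry]

@[simp]
lemma insertEntry_succAbove {n : ℕ} (p q : Fin (n + 1)) (σ : Equiv.Perm (Fin n)) (i : Fin n) :
    insertEntry p q σ (p.succAbove i) = q.succAbove (σ i) := by
  simp [insertEntry]

lemma insertEntry_injective {n : ℕ} (p q : Fin (n + 1)) :
    Function.Injective (insertEntry (n := n) p q) := by
  intro σ τ h
  ext i : 1
  have := congrArg (fun e => e (p.succAbove i)) h
  simpa using this

lemma exists_insertEntry_eq {n : ℕ} (p q : Fin (n + 1)) (π : Equiv.Perm (Fin (n + 1)))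
    (h : π p = q) : ∃ σ, insertEntry p q σ = π := by
  have hne : ∀ i, π (p.succAbove i) ≠ q := fun i hi =>
    Fin.succAbove_ne p i (π.injective (hi.trans h.symm))
  choose g hg using fun i => Fin.exists_succAbove_eq (hne i)
  have hinj : Function.Injective g := by
    intro i j hij
    have := (hg i).symm.trans ((congrArg _ hij).trans (hg j))
    exact Fin.succAbove_right_injective (π.injective this)
  refine ⟨Equiv.ofBijective g (Finite.injective_iff_bijective.mp hinj), ?_⟩
  ext x : 1
  rcases Fin.eq_self_or_eq_succAbove p x with rfl | ⟨i, rfl⟩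
  · simp [h]
  · simp [hg]

/-- Permutations sending `p` to `q` may be counted after deleting that entry. -/
lemma card_insertEntry {n : ℕ} (p q : Fin (n + 1)) {P : Equiv.Perm (Fin (n + 1)) → Prop}
    {Q : Equiv.Perm (Fin n) → Prop} (hP : ∀ π, P π → π p = q)
    (hPQ : ∀ σ, P (insertEntry p q σ) ↔ Q σ) : Nat.card {π // P π} = Nat.card {σ // Q σ} := by
  refine (Nat.card_eq_of_bijective
    (fun σ : {σ // Q σ} => (⟨insertEntry p q σ, (hPQ _).mpr σ.2⟩ : {π // P π})) ⟨?_, ?_⟩).symm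
  · intro σ τ h
    exact Subtype.ext (insertEntry_injective p q (congrArg Subtype.val h))
  · rintro ⟨π, hπ⟩
    obtain ⟨σ, rfl⟩ := exists_insertEntry_eq p q π (hP π hπ)
    exact ⟨⟨σ, (hPQ σ).mp hπ⟩, rfl⟩

lemma card_subtype_split {α : Type*} [Finite α] (P Q : α → Prop) :
    Nat.card {x // P x} = Nat.card {x // P x ∧ Q x} + Nat.card {x // P x ∧ ¬ Q x} := by
  classical
  have := Fintype.ofFinite α
  simp only [Nat.card_eq_fintype_card, Fintype.card_subtype, ← Finset.filter_filter]
  exact (Finset.card_filter_add_card_filter_not _).symm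

lemma ContainsPattern.insertEntry {n : ℕ} {σ : Equiv.Perm (Fin n)} {w : List ℕ}
    (h : ContainsPattern σ w) (p q : Fin (n + 1)) : ContainsPattern (insertEntry p q σ) w := by
  obtain ⟨f, hf, hw⟩ := h
  refine ⟨fun a => p.succAbove (f a), (Fin.strictMono_succAbove p).comp hf, fun a b => ?_⟩
  rw [hw]
  simp [(Fin.strictMono_succAbove q).lt_iff_lt]

/-- An occurrence of a pattern that does not use the inserted entry survives its deletion. -/
lemma ContainsPattern.of_insertEntry {n : ℕ} {σ : Equiv.Perm (Fin n)} {w : List ℕ}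
    {p q : Fin (n + 1)} {f : Fin w.length → Fin (n + 1)} (hf : StrictMono f)
    (hw : ∀ a b, w.get a < w.get b ↔
      _root_.insertEntry p q σ (f a) < _root_.insertEntry p q σ (f b))
    (hp : ∀ a, f a ≠ p) : ContainsPattern σ w := by
  choose g hg using fun a => Fin.exists_succAbove_eq (hp a)
  refine ⟨g, fun a b hab => ?_, fun a b => ?_⟩
  · rw [← (Fin.strictMono_succAbove p).lt_iff_lt, hg, hg]
    exact hf hab
  · rw [hw, ← hg, ← hg]
    simp [(Fin.strictMono_succAbove q).lt_iff_lt]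

lemma Avoids321Gon.of_insertEntry {k n : ℕ} {σ : Equiv.Perm (Fin n)} {p q : Fin (n + 1)}
    (h : Avoids321Gon k (insertEntry p q σ)) : Avoids321Gon k σ :=
  ⟨fun c => h.1 (c.insertEntry p q), fun c => h.2.1 (c.insertEntry p q),
    fun c => h.2.2.1 (c.insertEntry p q), fun c => h.2.2.2.1 (c.insertEntry p q),
    fun c => h.2.2.2.2 (c.insertEntry p q)⟩

/-- Inserting a new minimum in one of the first two positions creates no occurrence of a pattern
neither of whose first two entries is its minimum. -/
lemma AvoidsPattern.insertEntry_zero {n : ℕ} {σ : Equiv.Perm (Fin n)} {w : List ℕ}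
    (h : AvoidsPattern σ w) {p : Fin (n + 1)} (hp : (p : ℕ) ≤ 1)
    (hmin : ∀ a : Fin w.length, (a : ℕ) ≤ 1 → ∃ b, w.get b < w.get a) :
    AvoidsPattern (insertEntry p 0 σ) w := by
  rintro ⟨f, hf, hw⟩
  refine h (.of_insertEntry hf hw fun a ha => ?_)
  have hle : (a : ℕ) ≤ 1 := by
    by_contra! h1
    have h01 : f ⟨0, by omega⟩ < f ⟨1, by omega⟩ := hf (by simp)
    have h1a : f ⟨1, by omega⟩ < f a := hf h1
    rw [Fin.lt_def] at h01 h1a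
    rw [ha] at h1a
    omega
  obtain ⟨b, hb⟩ := hmin a hle
  rw [hw, ha] at hb
  simp at hb

lemma length_gonPattern_pos (k a : ℕ) (sep : Bool) : 0 < (gonPattern k a sep).length := by
  simp [gonPattern]

lemma gonPattern_get_zero (k a : ℕ) (sep : Bool) (i : Fin (gonPattern k a sep).length)
    (hi : (i : ℕ) = 0) : (gonPattern k a sep).get i = a := by
  obtain ⟨i, h⟩ := i
  subst hi
  simp [gonPattern]

lemma gonPattern_get_one {k : ℕ} (hk : 3 ≤ k) (a : ℕ) (sep : Bool)
    (i : Fin (gonPattern k a sep).length) (hi : (i : ℕ) = 1) :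
    (gonPattern k a sep).get i = k + 2 := by
  obtain ⟨i, h⟩ := i
  subst hi
  obtain ⟨k, rfl⟩ := Nat.exists_eq_add_of_le' hk
  simp [gonPattern, List.range'_succ]

/-- Every value of `{1, …, 2k}` occurs in a `k`-gon pattern. -/
lemma mem_gonPattern {k x : ℕ} (a : ℕ) (sep : Bool) (h1 : 1 ≤ x) (h2 : x ≤ 2 * k) :
    x ∈ gonPattern k a sep := by
  rw [gonPattern]
  simp only [List.mem_append, List.mem_filter, List.mem_range'_1]
  by_cases hx : x ∈ a :: (List.range' (k+2) (k-2) ++ (if sep then [1, 2*k] else [2*k]))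
  · exact Or.inl hx
  · exact Or.inr ⟨by omega, by rw [Bool.not_eq_true', List.contains_eq_mem]; exact decide_eq_false hx⟩

lemma exists_gonPattern_get_eq {k x : ℕ} (a : ℕ) (sep : Bool) (h1 : 1 ≤ x) (h2 : x ≤ 2 * k) :
    ∃ b, (gonPattern k a sep).get b = x :=
  List.mem_iff_get.mp (mem_gonPattern a sep h1 h2)

lemma AvoidsPattern.insertEntry_zero_gonPattern {k n a : ℕ} (hk : 3 ≤ k) (ha : k ≤ a) {sep : Bool}
    {σ : Equiv.Perm (Fin n)} (h : AvoidsPattern σ (gonPattern k a sep)) {p : Fin (n + 1)}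
    (hp : (p : ℕ) ≤ 1) : AvoidsPattern (insertEntry p 0 σ) (gonPattern k a sep) := by
  refine h.insertEntry_zero hp fun i hi => ?_
  obtain ⟨b, hb⟩ := exists_gonPattern_get_eq (k := k) a sep le_rfl (by omega)
  refine ⟨b, ?_⟩
  rw [hb]
  rcases Nat.le_one_iff_eq_zero_or_eq_one.mp hi with hi | hi
  · rw [gonPattern_get_zero k a sep i hi]
    omega
  · rw [gonPattern_get_one hk a sep i hi]
    omega

/-- Inserting a new minimum in one of the first two positions preserves avoidance. -/
lemma avoids321Gon_insertEntry_zero {k n : ℕ} (hk : 3 ≤ k) {σ : Equiv.Perm (Fin n)}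
    {p : Fin (n + 1)} (hp : (p : ℕ) ≤ 1) :
    Avoids321Gon k (insertEntry p 0 σ) ↔ Avoids321Gon k σ := by
  refine ⟨.of_insertEntry, fun h => ⟨h.1.insertEntry_zero hp ?_,
    h.2.1.insertEntry_zero_gonPattern hk le_rfl hp,
    h.2.2.1.insertEntry_zero_gonPattern hk le_rfl hp,
    h.2.2.2.1.insertEntry_zero_gonPattern hk (by omega) hp,
    h.2.2.2.2.insertEntry_zero_gonPattern hk (by omega) hp⟩⟩
  intro a ha
  refine ⟨⟨2, by simp⟩, ?_⟩
  fin_cases a <;> simp at ha ⊢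

/-- A new first entry with fewer than `k - 1` smaller entries takes part in no `k`-gon pattern. -/
lemma AvoidsPattern.insertEntry_first_gonPattern {k n a : ℕ} (ha : k ≤ a) {sep : Bool}
    {σ : Equiv.Perm (Fin n)} (h : AvoidsPattern σ (gonPattern k a sep)) {q : Fin (n + 1)}
    (hq : (q : ℕ) + 1 < k) : AvoidsPattern (insertEntry 0 q σ) (gonPattern k a sep) := by
  rintro ⟨f, hf, hw⟩
  refine h (.of_insertEntry hf hw fun i hi => ?_)
  have hi0 : (i : ℕ) = 0 := by
    by_contra hne
    have : f ⟨0, length_gonPattern_pos k a sep⟩ < f i := hf (Fin.mk_lt_of_lt_val (by omega))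
    simp [hi] at this
  choose g hg using fun x : Fin (k - 1) =>
    exists_gonPattern_get_eq (k := k) (x := x + 1) a sep (by omega) (by omega)
  have hlt : ∀ x, insertEntry 0 q σ (f (g x)) < q := by
    intro x
    have : insertEntry 0 q σ (f (g x)) < insertEntry 0 q σ (f i) := by
      rw [← hw, hg, gonPattern_get_zero k a sep i hi0]
      omega
    simpa [hi] using this
  have hinj : Function.Injective fun x => (⟨_, hlt x⟩ : Fin (q : ℕ)) := by
    intro x y hxy
    have hfg : f (g x) = f (g y) :=
      (insertEntry 0 q σ).injective (Fin.ext (Fin.mk.inj hxy))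
    have := congrArg (gonPattern k a sep).get (hf.injective hfg)
    rw [hg, hg] at this
    omega
  have := Fintype.card_le_of_injective _ hinj
  simp at this
  omega

lemma containsPattern_321_iff {n : ℕ} {π : Equiv.Perm (Fin n)} :
    ContainsPattern π [3, 2, 1] ↔ ∃ i j l, i < j ∧ j < l ∧ π j < π i ∧ π l < π j := by
  constructor
  · rintro ⟨f, hf, hw⟩
    exact ⟨f ⟨0, by simp⟩, f ⟨1, by simp⟩, f ⟨2, by simp⟩, hf (by simp), hf (by simp),
      (hw _ _).mp (by simp), (hw _ _).mp (by simp)⟩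
  · rintro ⟨i, j, l, hij, hjl, h1, h2⟩
    have h3 := h2.trans h1
    refine ⟨![i, j, l], ?_, ?_⟩
    · rw [Fin.strictMono_iff_lt_succ]
      intro a
      fin_cases a <;> simp [hij, hjl]
    · intro a b
      fin_cases a <;> fin_cases b <;> simp [h1, h2, h3, h1.le, h2.le, h3.le]

/-- Prepending an entry at most as large as the old first one preserves avoidance of `321`. -/
lemma AvoidsPattern.insertEntry_first_321 {n : ℕ} {σ : Equiv.Perm (Fin (n + 1))}
    (h : AvoidsPattern σ [3, 2, 1]) {q : Fin (n + 2)} (hq : (q : ℕ) ≤ σ 0) :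
    AvoidsPattern (insertEntry 0 q σ) [3, 2, 1] := by
  rw [AvoidsPattern, containsPattern_321_iff] at h ⊢
  rintro ⟨i, j, l, hij, hjl, h1, h2⟩
  apply h
  obtain ⟨j, rfl⟩ := Fin.exists_succ_eq.mpr (Fin.ne_zero_of_lt hij)
  obtain ⟨l, rfl⟩ := Fin.exists_succ_eq.mpr (Fin.ne_zero_of_lt hjl)
  have hs : ∀ i : Fin (n + 1), insertEntry 0 q σ i.succ = q.succAbove (σ i) := fun i => by
    rw [← Fin.zero_succAbove, insertEntry_succAbove]
  have hlt : ∀ a b, q.succAbove a < q.succAbove b ↔ a < b := fun _ _ =>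
    (Fin.strictMono_succAbove q).lt_iff_lt
  have hjl' : j < l := by simpa using hjl
  rw [hs, hs, hlt] at h2
  rw [hs] at h1
  rcases Fin.eq_zero_or_eq_succ i with rfl | ⟨i, rfl⟩
  · rw [insertEntry_self, Fin.succAbove_lt_iff_castSucc_lt] at h1
    have h0 : σ j < σ 0 := by
      rw [Fin.lt_def] at h1 ⊢
      simp at h1
      omega
    refine ⟨0, j, l, Fin.pos_of_ne_zero ?_, hjl', h0, h2⟩
    rintro rfl
    exact lt_irrefl _ h0
  · rw [hs, hlt] at h1
    exact ⟨i, j, l, by simpa using hij, hjl', h1, h2⟩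

lemma startsWith_singleton_iff {n s : ℕ} {π : Equiv.Perm (Fin (n + 1))} :
    StartsWith π [s] ↔ (π 0 : ℕ) + 1 = s := by
  simp [StartsWith]

/-- The number of 321-`k`-gon-avoiding permutations of `{1, …, n + 1}` whose first entry is at
least `s`. -/
noncomputable def fstartGe (k n s : ℕ) : ℕ :=
  Nat.card {π : Equiv.Perm (Fin (n + 1)) // Avoids321Gon k π ∧ s ≤ (π 0 : ℕ) + 1}

lemma fstartGe_one (k n : ℕ) : fstartGe k n 1 = fgon k (n + 1) := by
  simp [fstartGe, fgon]

lemma fstartGe_eq_add (k n s : ℕ) :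
    fstartGe k n s = fstart k (n + 1) [s] + fstartGe k n (s + 1) := by
  rw [fstartGe, card_subtype_split _ (fun π => StartsWith π [s])]
  congr 1
  · refine Nat.card_congr (Equiv.subtypeEquivRight fun π => ?_)
    rw [startsWith_singleton_iff, and_assoc]
    exact and_congr_right fun _ => by omega
  · refine Nat.card_congr (Equiv.subtypeEquivRight fun π => ?_)
    rw [startsWith_singleton_iff, and_assoc]
    exact and_congr_right fun _ => by omega

lemma fstart_one {k : ℕ} (hk : 3 ≤ k) (n : ℕ) : fstart k (n + 1) [1] = fgon k n := by
  refine card_insertEntry 0 0 ?_ ?_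
  · rintro π ⟨-, h⟩
    rw [startsWith_singleton_iff] at h
    exact Fin.ext (by simpa using h)
  · intro σ
    rw [startsWith_singleton_iff, avoids321Gon_insertEntry_zero hk (by simp)]
    simp

lemma card_second_eq_min {k : ℕ} (hk : 3 ≤ k) (n s : ℕ) :
    Nat.card {π : Equiv.Perm (Fin (n + 2)) //
      (Avoids321Gon k π ∧ StartsWith π [s + 1]) ∧ π 1 = 0} =
      fstart k (n + 1) [s] := by
  refine card_insertEntry 1 0 (fun π h => h.2) fun σ => ?_
  have h0 : insertEntry 1 0 σ 0 = (σ 0).succ := by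
    have := insertEntry_succAbove 1 0 σ 0
    simpa using this
  rw [avoids321Gon_insertEntry_zero hk (by simp), startsWith_singleton_iff,
    startsWith_singleton_iff, h0]
  simp

lemma card_second_ne_min {k n s : ℕ} (hs1 : 1 ≤ s) (hsk : s + 1 < k) (hsn : s ≤ n + 1) :
    Nat.card {π : Equiv.Perm (Fin (n + 2)) //
      (Avoids321Gon k π ∧ StartsWith π [s + 1]) ∧ ¬ π 1 = 0} =
      fstartGe k n (s + 1) := by
  obtain ⟨q, hq⟩ : ∃ q : Fin (n + 2), (q : ℕ) = s := ⟨⟨s, by omega⟩, rfl⟩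
  refine card_insertEntry 0 q (fun π h => ?_) fun σ => ?_
  · have := startsWith_singleton_iff.mp h.1.2
    exact Fin.ext (by omega)
  have h1 : insertEntry 0 q σ 1 = q.succAbove (σ 0) := by
    have := insertEntry_succAbove 0 q σ 0
    simpa using this
  constructor
  · rintro ⟨⟨h, -⟩, hne⟩
    refine ⟨h.of_insertEntry, ?_⟩
    by_contra! hlt
    have hlt' : q.succAbove (σ 0) < q := by
      rw [Fin.succAbove_lt_iff_castSucc_lt, Fin.lt_def, Fin.val_castSucc]
      omega
    refine h.1 (containsPattern_321_iff.mpr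
      ⟨0, 1, (insertEntry 0 q σ).symm 0, by simp, ?_, by simpa [h1] using hlt', ?_⟩)
    · have ha : (insertEntry 0 q σ).symm 0 ≠ 0 := by
        rw [Ne, Equiv.symm_apply_eq, insertEntry_self]
        rintro rfl
        simp at hq
        omega
      have hb : (insertEntry 0 q σ).symm 0 ≠ 1 := by
        rw [Ne, Equiv.symm_apply_eq]
        exact fun h0 => hne h0.symm
      generalize (insertEntry 0 q σ).symm 0 = x at ha hb
      rw [Ne, Fin.ext_iff, Fin.val_zero] at ha
      rw [Ne, Fin.ext_iff, Fin.val_one] at hb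
      rw [Fin.lt_def, Fin.val_one]
      omega
    · rw [Equiv.apply_symm_apply]
      exact Fin.pos_of_ne_zero hne
  · rintro ⟨h, hle⟩
    have hqk : (q : ℕ) + 1 < k := hq ▸ hsk
    refine ⟨⟨⟨h.1.insertEntry_first_321 (by simp [hq]; omega),
      h.2.1.insertEntry_first_gonPattern le_rfl hqk,
      h.2.2.1.insertEntry_first_gonPattern le_rfl hqk,
      h.2.2.2.1.insertEntry_first_gonPattern (by omega) hqk,
      h.2.2.2.2.insertEntry_first_gonPattern (by omega) hqk⟩, ?_⟩, ?_⟩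
    · simp [startsWith_singleton_iff, hq]
    · rw [h1, Fin.succAbove_of_le_castSucc _ _ (by rw [Fin.le_def]; simp [hq]; omega)]
      exact Fin.succ_ne_zero _

/-- Deleting an entry gives the ballot-type recurrence
`f_k(n + 2; s + 1) = Σ_{i ≥ s} f_k(n + 1; i)`. -/
lemma fstart_succ {k n s : ℕ} (hs1 : 1 ≤ s) (hsk : s + 1 < k) (hsn : s ≤ n + 1) :
    fstart k (n + 2) [s + 1] = fstartGe k n s := by
  rw [fstartGe_eq_add, fstart, card_subtype_split _ (fun π => π 1 = 0),
    card_second_eq_min (by omega), card_second_ne_min hs1 hsk hsn]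

lemma fstart_sub {k n s : ℕ} (hs1 : 1 ≤ s) (hsk : s + 2 < k) (hsn : s + 1 ≤ n + 1) :
    (fstart k (n + 2) [s + 2] : ℤ) = fstart k (n + 2) [s + 1] - fstart k (n + 1) [s] := by
  rw [fstart_succ hs1 (by omega) (by omega), fstart_succ (s := s + 1) (by omega) hsk hsn,
    fstartGe_eq_add k n s]
  push_cast
  ring

lemma Lgon_sub (k n s : ℕ) :
    Lgon k (n + 1) (s + 2) = Lgon k (n + 1) (s + 1) - Lgon k n s := by
  simp only [Lgon]
  rw [Finset.sum_range_succ' _ (s + 1), Finset.sum_range_succ' _ (s + 2),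
    Finset.sum_range_succ _ (s + 1), add_sub_right_comm, ← Finset.sum_sub_distrib]
  congr 1
  simp only [show s + 2 - (s + 1 + 1) = 0 by omega, Nat.choose_zero_succ]
  rw [Nat.cast_zero, mul_zero, zero_mul, add_zero]
  refine Finset.sum_congr rfl fun j hj => ?_
  rw [Finset.mem_range] at hj
  rw [show s + 2 - (j + 1) = s - j + 1 by omega, show s + 1 - (j + 1) = s - j by omega,
    show n + 1 - (j + 1) = n - j by omega, Nat.choose_succ_succ]
  push_cast
  ring

lemma fstart_eq_Lgon {k : ℕ} (hk : 3 ≤ k) (s n : ℕ) (hsk : s + 1 < k) (hsn : s ≤ n) :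
    (fstart k (n + 1) [s + 1] : ℤ) = Lgon k n s := by
  induction s using Nat.twoStepInduction generalizing n with
  | zero => simp [fstart_one hk, Lgon]
  | one =>
    obtain ⟨n, rfl⟩ := Nat.exists_eq_add_of_le' hsn
    rw [fstart_succ le_rfl hsk (by omega), fstartGe_one]
    simp [Lgon, Finset.sum_range_succ]
  | more s ih1 ih2 =>
    obtain ⟨n, rfl⟩ := Nat.exists_eq_add_of_le' (show 1 ≤ n by omega)
    rw [Lgon_sub, ← ih1 n (by omega) (by omega), ← ih2 (n + 1) (by omega) (by omega)]
    exact fstart_sub (by omega) hsk (by omega)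

/-- For `k ≥ 3` and `1 ≤ s ≤ min{k−1, n}`:
`f_k(n; s) = Σ_{j=0}^{s−1} (−1)^j C(s−1−j, j) f_k(n−1−j)`. -/
theorem fstart_single (k n s : ℕ) (hk : 3 ≤ k) (hs1 : 1 ≤ s) (hs2 : s ≤ k - 1) (hs3 : s ≤ n) :
    (fstart k n [s] : ℤ) =
      ∑ j ∈ Finset.range s, (-1 : ℤ)^j * ((s-1-j).choose j : ℤ) * (fgon k (n-1-j) : ℤ) := by
  obtain ⟨s, rfl⟩ := Nat.exists_eq_add_of_le' hs1
  obtain ⟨n, rfl⟩ := Nat.exists_eq_add_of_le' (hs1.trans hs3)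
  exact fstart_eq_Lgon hk s n (by omega) (by omega)
end
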